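/- Assume (P₂), (Q₂) with p̄ < q⁻ := inf q, and (E_∞): lim_{|x|,|y|→∞} p(x,y) = p̄ and lim_{|x|→∞} q(x) = q_∞ for some q_∞ ∈ (1,∞). Let f satisfy (F1)–(F4). Then there exists a sequence {λ_k}_{k≥1} of positive real numbers with λ_{k+1} < λ_k for all k such that for every k ∈ ℕ and every λ ∈ (λ_{k+1}, λ_k), the problem Lu + |u|^{p̄−2}u = f(x,u) + λ|u|^{q(x)−2}u in ℝ^N admits at least k pairs {±u} of nontrivial weak solutions in W^{s,p(·,·)}(ℝ^N). -/

import Mathlib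

open MeasureTheory Filter Topology Set
open scoped ENNReal NNReal

noncomputable section

/-- Euclidean space `ℝ^N`. -/
abbrev Euc (N : ℕ) := EuclideanSpace ℝ (Fin N)

/-- The modular of the variable exponent Lebesgue space `L^{h(·)}_μ`. -/
def varModular {α : Type*} [MeasurableSpace α] (μ : Measure α) (h : α → ℝ) (u : α → ℝ) : ℝ≥0∞ :=
  ∫⁻ x, ENNReal.ofReal (|u x| ^ (h x)) ∂μ

/-- The Luxemburg norm on the variable exponent Lebesgue space `L^{h(·)}_μ`. -/
def luxNorm {α : Type*} [MeasurableSpace α] (μ : Measure α) (h : α → ℝ) (u : α → ℝ) : ℝ :=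
  sInf {c : ℝ | 0 < c ∧ varModular μ h (fun x => u x / c) ≤ 1}

/-- Membership in the variable exponent Lebesgue space `L^{h(·)}_μ`. -/
def MemVarLp {α : Type*} [MeasurableSpace α] (μ : Measure α) (h : α → ℝ) (u : α → ℝ) : Prop :=
  AEStronglyMeasurable u μ ∧ varModular μ h u < ⊤

/-- The integrand of the Gagliardo-type seminorm with variable exponent. -/
def sobKernel {N : ℕ} (s : ℝ) (p : Euc N → Euc N → ℝ) (u : Euc N → ℝ) (x y : Euc N) : ℝ≥0∞ :=
  ENNReal.ofReal (|u x - u y| ^ (p x y) / dist x y ^ ((N : ℝ) + s * p x y))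

/-- The modular of the fractional Sobolev space `W^{s,p(·,·)}(Ω)`. -/
def sobModular {N : ℕ} (Ω : Set (Euc N)) (s : ℝ) (p : Euc N → Euc N → ℝ)
    (u : Euc N → ℝ) : ℝ≥0∞ :=
  (∫⁻ x in Ω, ENNReal.ofReal (|u x| ^ (p x x))) + ∫⁻ x in Ω, ∫⁻ y in Ω, sobKernel s p u x y

/-- The Luxemburg-type norm of the fractional Sobolev space `W^{s,p(·,·)}(Ω)`. -/
def sobNorm {N : ℕ} (Ω : Set (Euc N)) (s : ℝ) (p : Euc N → Euc N → ℝ) (u : Euc N → ℝ) : ℝ :=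
  sInf {c : ℝ | 0 < c ∧ sobModular Ω s p (fun x => u x / c) ≤ 1}

/-- Membership in the fractional Sobolev space `W^{s,p(·,·)}(Ω)`. -/
def MemSob {N : ℕ} (Ω : Set (Euc N)) (s : ℝ) (p : Euc N → Euc N → ℝ) (u : Euc N → ℝ) : Prop :=
  AEStronglyMeasurable u (volume.restrict Ω) ∧ sobModular Ω s p u < ⊤

/-- `F(x,t) = ∫_0^t f(x,τ) dτ`. -/
def Fint {N : ℕ} (f : Euc N → ℝ → ℝ) (x : Euc N) (t : ℝ) : ℝ :=
  ∫ τ in (0 : ℝ)..t, f x τ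

/-- Weak solution of `L u + |u|^{p̄-2} u = f(x,u) + λ |u|^{q(x)-2} u` in `ℝ^N`. -/
def IsWeakSolution {N : ℕ} (s : ℝ) (p : Euc N → Euc N → ℝ) (pbar : ℝ) (q : Euc N → ℝ)
    (f : Euc N → ℝ → ℝ) (lam : ℝ) (u : Euc N → ℝ) : Prop :=
  MemSob Set.univ s p u ∧
  ∀ v : Euc N → ℝ, MemSob Set.univ s p v →
    (∫ x, ∫ y, |u x - u y| ^ (p x y - 2) * (u x - u y) * (v x - v y) /
        dist x y ^ ((N : ℝ) + s * p x y)) +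
      (∫ x, |u x| ^ (pbar - 2) * u x * v x) =
    (∫ x, f x (u x) * v x) + lam * ∫ x, |u x| ^ (q x - 2) * u x * v x

set_option linter.unusedSectionVars false

/-! ### Mod 2 chains -/
abbrev Ch (V : Type*) := List V →₀ ZMod 2

lemma zm2_self {C : Type*} [AddCommGroup C] [Module (ZMod 2) C] (c : C) : c + c = 0 := by
  have h : (2 : ZMod 2) • c = c + c := two_smul _ c
  rw [← h, show (2 : ZMod 2) = 0 from rfl, zero_smul]

def cone {V : Type*} (v : V) : Ch V →ₗ[ZMod 2] Ch V := Finsupp.lmapDomain _ _ (List.cons v)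

def bdl {V : Type*} : List V → Ch V
  | [] => 0
  | v :: l => Finsupp.single l 1 + cone v (bdl l)

def bd {V : Type*} : Ch V →ₗ[ZMod 2] Ch V := Finsupp.linearCombination (ZMod 2) bdl

@[simp] lemma cone_single {V : Type*} (v : V) (l : List V) (a : ZMod 2) :
    cone v (Finsupp.single l a) = Finsupp.single (v :: l) a := by
  simp [cone]

@[simp] lemma bd_single {V : Type*} (l : List V) :
    bd (Finsupp.single l 1) = bdl l := by simp [bd]

lemma ch_ext {V M : Type*} [AddCommGroup M] [Module (ZMod 2) M] {f g : Ch V →ₗ[ZMod 2] M}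
    (h : ∀ l, f (Finsupp.single l 1) = g (Finsupp.single l 1)) : f = g := by
  apply Finsupp.lhom_ext'
  intro l
  ext
  simpa using h l

lemma bd_cone {V : Type*} (v : V) (c : Ch V) : bd (cone v c) = c + cone v (bd c) := by
  have : (bd ∘ₗ cone v : Ch V →ₗ[ZMod 2] Ch V) = LinearMap.id + cone v ∘ₗ bd := by
    apply ch_ext; intro l; simp [bdl]
  exact LinearMap.congr_fun this c

lemma bd_bd {V : Type*} (c : Ch V) : bd (bd c) = 0 := by
  have : (bd ∘ₗ bd : Ch V →ₗ[ZMod 2] Ch V) = 0 := by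
    apply ch_ext; intro l
    simp only [LinearMap.comp_apply, bd_single, LinearMap.zero_apply]
    induction l with
    | nil => simp [bdl]
    | cons v l ih => simp [bdl, bd_cone, ih, zm2_self]
  exact LinearMap.congr_fun this c

def chmap {V W : Type*} (f : V → W) : Ch V →ₗ[ZMod 2] Ch W := Finsupp.lmapDomain _ _ (List.map f)

@[simp] lemma chmap_single {V W : Type*} (f : V → W) (l : List V) (a : ZMod 2) :
    chmap f (Finsupp.single l a) = Finsupp.single (l.map f) a := by simp [chmap]

lemma chmap_cone {V W : Type*} (f : V → W) (v : V) (c : Ch V) :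
    chmap f (cone v c) = cone (f v) (chmap f c) := by
  have : (chmap f ∘ₗ cone v) = cone (f v) ∘ₗ chmap f := by
    apply ch_ext; intro l; simp
  exact LinearMap.congr_fun this c

lemma bdl_map {V W : Type*} (f : V → W) (l : List V) : bdl (l.map f) = chmap f (bdl l) := by
  induction l with
  | nil => simp [bdl]
  | cons v l ih => simp [bdl, ih, chmap_cone]

lemma chmap_bd {V W : Type*} (f : V → W) (c : Ch V) : chmap f (bd c) = bd (chmap f c) := by
  have : (chmap f ∘ₗ bd) = bd ∘ₗ chmap f := by
    apply ch_ext; intro l; simp [bdl_map]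
  exact LinearMap.congr_fun this c


section supp
variable {V : Type*}

/-- chains supported on a set of lists -/
abbrev Sup (P : Set (List V)) : Submodule (ZMod 2) (Ch V) := Finsupp.supported (ZMod 2) (ZMod 2) P



lemma sup_bind {M : Type*} [AddCommGroup M] [Module (ZMod 2) M] {P : Set (List V)}
    (T : Ch V →ₗ[ZMod 2] M) (Q : Submodule (ZMod 2) M)
    (h : ∀ l ∈ P, T (Finsupp.single l 1) ∈ Q) {c : Ch V} (hc : c ∈ Sup P) : T c ∈ Q := by
  rw [Sup, Finsupp.supported_eq_span_single] at hc
  have : (Submodule.span (ZMod 2) ((fun i => Finsupp.single i (1 : ZMod 2)) '' P)) ≤ Q.comap T := by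
    rw [Submodule.span_le]
    rintro _ ⟨l, hl, rfl⟩
    exact h l hl
  exact this hc

lemma single_sup {P : Set (List V)} {l : List V} (h : l ∈ P) :
    Finsupp.single l (1 : ZMod 2) ∈ Sup P := Finsupp.single_mem_supported _ _ h

lemma bdl_sup (l : List V) : ∀ k, l.length = k + 1 →
    bdl l ∈ Sup {l' : List V | l'.length = k ∧ l' ⊆ l} := by
  induction l with
  | nil => simp
  | cons v l ih =>
    intro k hk
    simp only [bdl]
    refine add_mem (single_sup ?_) ?_
    · refine ⟨by simpa using hk, by simp⟩
    · rcases l with _ | ⟨w, l⟩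
      · simp [bdl]
      · rcases k with _ | k
        · simp at hk
        · refine sup_bind (cone v) _ ?_ (ih k (by simpa using hk))
          rintro l' ⟨h1, h2⟩
          rw [cone_single]
          refine single_sup ⟨by simp [h1], ?_⟩
          exact List.cons_subset_cons v h2

end supp

section sdiv
variable {V : Type*} [NormedAddCommGroup V] [NormedSpace ℝ V]

def bary (l : List V) : V := (l.length : ℝ)⁻¹ • l.sum

def sdk : ℕ → (Ch V →ₗ[ZMod 2] Ch V)
  | 0 => LinearMap.id
  | k + 1 => Finsupp.linearCombination (ZMod 2) (fun l => cone (bary l) (sdk k (bdl l)))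

lemma sdk_succ_single (k : ℕ) (l : List V) :
    sdk (k + 1) (Finsupp.single l 1) = cone (bary l) (sdk k (bdl l)) := by simp [sdk]

lemma bd_sdk (k : ℕ) (c : Ch V) : bd (sdk (k + 1) c) = sdk k (bd c) := by
  induction k generalizing c with
  | zero =>
    have : (bd ∘ₗ sdk 1 : Ch V →ₗ[ZMod 2] Ch V) = sdk 0 ∘ₗ bd := by
      apply ch_ext; intro l
      simp only [LinearMap.comp_apply, bd_single, sdk_succ_single, bd_cone]
      simp only [sdk, LinearMap.id_apply]
      rw [← bd_single, bd_bd]; simp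
    exact LinearMap.congr_fun this c
  | succ k ih =>
    have : (bd ∘ₗ sdk (k+2) : Ch V →ₗ[ZMod 2] Ch V) = sdk (k+1) ∘ₗ bd := by
      apply ch_ext; intro l
      simp only [LinearMap.comp_apply, bd_single, sdk_succ_single, bd_cone]
      rw [ih, ← bd_single, bd_bd]; simp
    exact LinearMap.congr_fun this c

lemma bary_neg (l : List V) : bary (l.map (fun x => -x)) = - bary l := by
  have : (l.map (fun x => -x)).sum = - l.sum := by
    induction l with
    | nil => simp
    | cons a l ih => simp only [List.map_cons, List.sum_cons, ih]; abel
  simp [bary, this]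

lemma sdk_neg (k : ℕ) (c : Ch V) :
    chmap (fun x : V => -x) (sdk k c) = sdk k (chmap (fun x : V => -x) c) := by
  induction k generalizing c with
  | zero => simp [sdk]
  | succ k ih =>
    have : (chmap (fun x : V => -x) ∘ₗ sdk (k+1)) = sdk (k+1) ∘ₗ chmap (fun x : V => -x) := by
      apply ch_ext; intro l
      simp only [LinearMap.comp_apply, sdk_succ_single, chmap_single, chmap_cone, ih, bdl_map,
        bary_neg]
    exact LinearMap.congr_fun this c

lemma bary_mem {l : List V} (hl : l ≠ []) {K : Set V} (hK : Convex ℝ K) (h : ∀ x ∈ l, x ∈ K) :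
    bary l ∈ K := by
  have hpos : 0 < l.length := List.length_pos_iff.mpr hl
  have h1 : bary l = ∑ i : Fin l.length, ((l.length : ℝ)⁻¹) • l[i] := by
    rw [bary, ← Finset.smul_sum]
    congr 1
    rw [← Fin.sum_univ_getElem]
    rfl
  rw [h1]
  refine hK.sum_mem (fun _ _ => by positivity) ?_ (fun i _ => h _ (List.getElem_mem _))
  simp [Finset.sum_const]
  field_simp

lemma bary_dist {l : List V} {d : ℝ} (hd : ∀ x ∈ l, ∀ y ∈ l, dist x y ≤ d) {v : V} (hv : v ∈ l)
    {m : ℕ} (hm : l.length ≤ m + 1) (hd0 : 0 ≤ d) : dist v (bary l) ≤ (m : ℝ) / (m + 1) * d := by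
  have hpos : 0 < l.length := List.length_pos_of_mem hv
  have key : ∀ l' : List V, l' ⊆ l → ‖l'.sum - (l'.length : ℝ) • v‖ ≤ l'.length * d := by
    intro l' hl'
    induction l' with
    | nil => simp
    | cons a t ih =>
      have h1 := ih (fun x hx => hl' (List.mem_cons_of_mem _ hx))
      have h2 : dist a v ≤ d := hd a (hl' (by simp)) v hv
      rw [dist_eq_norm] at h2
      have : (a :: t).sum - ((a :: t).length : ℝ) • v = (a - v) + (t.sum - (t.length : ℝ) • v) := by
        simp [add_smul]; abel
      rw [this]
      calc _ ≤ _ := norm_add_le _ _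
        _ ≤ d + t.length * d := add_le_add h2 h1
        _ = _ := by push_cast [List.length_cons]; ring
  obtain ⟨l1, l2, rfl⟩ := List.append_of_mem hv
  have h := key (l1 ++ l2) (by intro x hx; simp at hx ⊢; tauto)
  set n := (l1 ++ l2).length with hn
  have hlen : (l1 ++ v :: l2).length = n + 1 := by simp [hn]; omega
  have hb : bary (l1 ++ v :: l2) - v = ((n : ℝ) + 1)⁻¹ • ((l1 ++ l2).sum - (n : ℝ) • v) := by
    rw [bary, hlen]
    have h0 : ((n : ℝ) + 1) ≠ 0 := by positivity
    have h1 : (l1 ++ v :: l2).sum = (l1 ++ l2).sum + v := by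
      simp only [List.sum_append, List.sum_cons]; abel
    rw [h1]
    push_cast
    have h2 : (l1 ++ l2).sum + v = ((l1 ++ l2).sum - (n : ℝ) • v) + ((n : ℝ) + 1) • v := by
      rw [add_smul, one_smul]; abel
    rw [h2, smul_add, smul_smul ((n : ℝ) + 1)⁻¹ ((n : ℝ) + 1), inv_mul_cancel₀ h0, one_smul]; abel
  rw [dist_comm, dist_eq_norm, hb, norm_smul, Real.norm_of_nonneg (by positivity)]
  have hnm : n ≤ m := by omega
  have : ((n : ℝ) + 1)⁻¹ * ((n : ℝ) * d) ≤ (m : ℝ) / (m + 1) * d := by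
    have : ((n : ℝ) + 1)⁻¹ * n ≤ (m : ℝ) / (m + 1) := by
      rw [inv_mul_eq_div, div_le_div_iff₀ (by positivity) (by positivity)]
      have : (n : ℝ) ≤ m := by exact_mod_cast hnm
      nlinarith
    calc _ = ((n : ℝ) + 1)⁻¹ * (n : ℝ) * d := by ring
      _ ≤ _ := by gcongr
  refine le_trans ?_ this
  gcongr

lemma sdk_sup (m : ℕ) {d : ℝ} (hd0 : 0 ≤ d) (k : ℕ) : k ≤ m + 1 → ∀ l : List V, l.length = k →
    (∀ x ∈ l, ∀ y ∈ l, dist x y ≤ d) → ∀ K : Set V, Convex ℝ K → (∀ x ∈ l, x ∈ K) →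
    sdk k (Finsupp.single l 1) ∈ Sup {l' : List V | l'.length = k ∧ (∀ x ∈ l', x ∈ K) ∧
      ∀ x ∈ l', ∀ y ∈ l', dist x y ≤ (m : ℝ) / (m + 1) * d} := by
  induction k with
  | zero =>
    intro _ l hl _ K _ _
    have : l = [] := List.length_eq_zero_iff.mp hl
    subst this
    exact single_sup (by simp)
  | succ k ih =>
    intro hk l hl hd K hK hlK
    rw [sdk_succ_single]
    have hne : l ≠ [] := by rintro rfl; simp at hl
    set r := (m : ℝ) / (m + 1) * d
    have hr : 0 ≤ r := by positivity
    set K' : Set V := K ∩ Metric.closedBall (bary l) r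
    have hK' : Convex ℝ K' := hK.inter (convex_closedBall _ _)
    have h1 : sdk k (bdl l) ∈ Sup {l' : List V | l'.length = k ∧ (∀ x ∈ l', x ∈ K') ∧
      ∀ x ∈ l', ∀ y ∈ l', dist x y ≤ r} := by
      refine sup_bind (sdk k) _ ?_ (bdl_sup l k hl)
      rintro l' ⟨h1, h2⟩
      refine ih (by omega) l' h1 (fun x hx y hy => hd x (h2 hx) y (h2 hy)) K' hK' ?_
      intro x hx
      exact ⟨hlK x (h2 hx), bary_dist hd (h2 hx) (by omega) hd0⟩
    refine sup_bind (cone _) _ ?_ h1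
    rintro l' ⟨h1, h2, h3⟩
    rw [cone_single]
    refine single_sup ⟨by simp [h1], ?_, ?_⟩
    · simp only [List.mem_cons, forall_eq_or_imp]
      exact ⟨bary_mem hne hK hlK, fun x hx => (h2 x hx).1⟩
    · simp only [List.mem_cons, forall_eq_or_imp]
      refine ⟨⟨by simpa using hr, fun y hy => ?_⟩, fun x hx => ⟨(h2 x hx).2, h3 x hx⟩⟩
      rw [dist_comm]; exact (h2 y hy).2

/-- `F` is a family of convex sets; iterate the subdivision. -/
lemma sdk_iter_sup (m : ℕ) (F : Set (Set V)) (hF : ∀ K ∈ F, Convex ℝ K) {d : ℝ} (hd0 : 0 ≤ d)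
    (k : ℕ) (hk : k ≤ m + 1) (c : Ch V)
    (hc : c ∈ Sup {l : List V | l.length = k ∧ (∃ K ∈ F, ∀ x ∈ l, x ∈ K) ∧
      ∀ x ∈ l, ∀ y ∈ l, dist x y ≤ d}) (t : ℕ) :
    ((sdk k)^[t] c) ∈ Sup {l : List V | l.length = k ∧ (∃ K ∈ F, ∀ x ∈ l, x ∈ K) ∧
      ∀ x ∈ l, ∀ y ∈ l, dist x y ≤ ((m : ℝ) / (m + 1)) ^ t * d} := by
  induction t with
  | zero => simpa using hc
  | succ t ih =>
    rw [Function.iterate_succ_apply']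
    refine sup_bind (sdk k) _ ?_ ih
    rintro l ⟨h1, ⟨K, hKF, hK⟩, h3⟩
    have := sdk_sup m (d := ((m : ℝ) / (m + 1)) ^ t * d) (by positivity) k hk l h1 h3 K (hF K hKF) hK
    refine Finsupp.supported_mono ?_ this
    rintro l' ⟨a, b, c⟩
    refine ⟨a, ⟨K, hKF, b⟩, ?_⟩
    intro x hx y hy
    rw [pow_succ', mul_assoc]
    exact c x hx y hy

end sdiv


def AB (M : ℕ) : Bool → List ℕ → ZMod 2
  | _, [] => 0
  | b, a :: s => if a < 2 * M then (if (decide (a % 2 = 1)) = b then AB M (!b) s else 0)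
      else if a = 2 * M ∧ s = [] then 1 else 0

def lF {V : Type*} (F : List V → ZMod 2) : Ch V →ₗ[ZMod 2] ZMod 2 :=
  Finsupp.linearCombination (ZMod 2) F

@[simp] lemma lF_single {V : Type*} (F : List V → ZMod 2) (l : List V) :
    lF F (Finsupp.single l 1) = F l := by simp [lF]

lemma lF_cone {V : Type*} (F : List V → ZMod 2) (v : V) (c : Ch V) :
    lF F (cone v c) = lF (fun l => F (v :: l)) c := by
  have : lF F ∘ₗ cone v = lF (fun l => F (v :: l)) := by
    apply ch_ext; intro l; simp
  exact LinearMap.congr_fun this c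

lemma lF_map {V W : Type*} (F : List W → ZMod 2) (f : V → W) (c : Ch V) :
    lF F (chmap f c) = lF (fun l => F (l.map f)) c := by
  have : lF F ∘ₗ chmap f = lF (fun l => F (l.map f)) := by
    apply ch_ext; intro l; simp
  exact LinearMap.congr_fun this c

lemma lF_zero {V : Type*} (c : Ch V) : lF (fun _ => 0) c = 0 := by
  have : lF (fun _ : List V => 0) = 0 := by
    apply ch_ext; intro l; simp
  exact LinearMap.congr_fun this c

lemma lF_congr {V : Type*} {F G : List V → ZMod 2} {P : Set (List V)} (h : ∀ l ∈ P, F l = G l)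
    {c : Ch V} (hc : c ∈ Sup P) : lF F c = lF G c := by
  have := sup_bind (lF F - lF G) ⊥ (P := P) (by intro l hl; simp [h l hl]) hc
  simpa [sub_eq_zero] using this

lemma lF_perm {V : Type*} {l l' : List V} (hl : l.Perm l') : ∀ F : List V → ZMod 2,
    (∀ a b, List.Perm a b → F a = F b) → lF F (bdl l) = lF F (bdl l') := by
  induction hl with
  | nil => intros; rfl
  | cons x h ih =>
    intro F hF
    simp only [bdl, map_add, lF_single, lF_cone]
    rw [hF _ _ h, ih _ (fun a b hab => hF _ _ (hab.cons x))]
  | swap x y l =>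
    intro F hF
    simp only [bdl, map_add, lF_single, lF_cone]
    have : (fun l => F (y :: x :: l)) = (fun l => F (x :: y :: l)) := by
      funext l; exact hF _ _ (List.Perm.swap x y l)
    rw [this]; abel
  | trans _ _ h1 h2 => intro F hF; rw [h1 F hF, h2 F hF]

lemma bdl_sublist {V : Type*} (l : List V) : bdl l ∈ Sup {l' : List V | l'.Sublist l} := by
  induction l with
  | nil => simp [bdl]
  | cons v l ih =>
    simp only [bdl]
    refine add_mem (single_sup (List.sublist_cons_self v l)) ?_
    refine sup_bind (cone v) _ ?_ ih
    intro l' hl'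
    rw [cone_single]
    exact single_sup (List.Sublist.cons_cons v hl')

def goodL (M : ℕ) (l : List ℕ) : Prop :=
  (∀ x ∈ l, x ≤ 2 * M + 1) ∧ ∀ x ∈ l, ∀ y ∈ l, x / 2 = y / 2 → x = y

lemma goodL.tail {M a l} (h : goodL M (a :: l)) : goodL M l :=
  ⟨fun x hx => h.1 x (by simp [hx]), fun x hx y hy => h.2 x (by simp [hx]) y (by simp [hy])⟩

lemma AB_bd (M : ℕ) (l : List ℕ) : l.Pairwise (· ≤ ·) → goodL M l → ∀ b,
    lF (AB M b) (bdl l) = AB M b l + AB M (!b) l := by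
  induction l with
  | nil => intros; simp [bdl, AB]
  | cons a s ih =>
    intro hs hg b
    have hs' := List.pairwise_cons.1 hs
    simp only [bdl, map_add, lF_single, lF_cone]
    by_cases ha : a < 2 * M
    · have e1 : ∀ b, (fun l => AB M b (a :: l)) = if (decide (a % 2 = 1)) = b then AB M (!b) else fun _ => 0 := by
        intro b; funext l; simp only [AB, ha, if_true]; split_ifs <;> rfl
      rw [e1]
      have e2 : ∀ b, AB M b (a :: s) = if (decide (a % 2 = 1)) = b then AB M (!b) s else 0 := by
        intro b; simp only [AB, ha, if_true]
      rw [e2, e2]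
      have := ih hs'.2 hg.tail (!b)
      rw [Bool.not_not] at this
      by_cases h : decide (a % 2 = 1) = b
      · rw [if_pos h, if_pos h, if_neg (by rw [h]; simp), this]
        rw [add_zero, add_comm (AB M (!b) s), ← add_assoc, zm2_self, zero_add]
      · rw [if_neg h, if_neg h, if_pos (by cases b <;> simp_all), lF_zero]
        simp
    · have e2 : ∀ b, AB M b (a :: s) = if a = 2 * M ∧ s = [] then 1 else 0 := by
        intro b; simp only [AB, ha, if_false]
      rw [e2, e2, zm2_self]
      have h1 : ∀ x ∈ s, x = a := by
        intro x hx
        have := hs'.1 x hx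
        have h3 := hg.1 x (by simp [hx])
        exact hg.2 x (by simp [hx]) a (by simp) (by omega)
      have e3 : (fun l => AB M b (a :: l)) = fun l => if a = 2 * M ∧ l = [] then 1 else 0 := by
        funext l; simp only [AB, ha, if_false]
      rw [e3]
      rcases s with _ | ⟨x, s⟩
      · simp [bdl, AB]
      · have hx : x = a := h1 x (by simp)
        subst hx
        simp only [bdl, map_add, lF_single, lF_cone, AB, ha, if_false]
        simp [lF_zero, zm2_self]

lemma AB_len (M : ℕ) (a : ℕ) (s : List ℕ) : (a :: s).Pairwise (· ≤ ·) → goodL M (a :: s) → ∀ b,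
    AB M b (a :: s) ≠ 0 → (a :: s).length + a / 2 ≤ M + 1 := by
  induction s generalizing a with
  | nil =>
    intro _ _ b h
    simp only [AB] at h
    split_ifs at h with h1 h2 h3
    · simp at h
    · simp at h
    · simp; omega
    · simp at h
  | cons a' s ih =>
    intro hs hg b h
    have hs' := List.pairwise_cons.1 hs
    rw [AB] at h
    split_ifs at h with h1 h2 h3
    · have := ih a' hs'.2 hg.tail _ h
      have h4 := hs'.1 a' (by simp)
      have h5 : a / 2 < a' / 2 := by
        by_contra hc
        have : a / 2 = a' / 2 := by omega
        have e := hg.2 a (by simp) a' (by simp) this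
        subst e
        rw [AB] at h
        simp [h1, h2] at h
      simp only [List.length_cons] at this ⊢
      omega
    · simp at h
    · simp at h3
    · simp at h

def srt (l : List ℕ) : List ℕ := l.mergeSort (· ≤ ·)

lemma srt_perm (l : List ℕ) : (srt l).Perm l := List.mergeSort_perm _ _
lemma srt_sorted (l : List ℕ) : (srt l).Pairwise (· ≤ ·) := by
  have := List.pairwise_mergeSort (le := fun a b : ℕ => decide (a ≤ b)) (by simp; omega) (by simp; omega) l
  simpa [srt] using this
lemma srt_unique {l l' : List ℕ} (hp : l.Perm l') (h : l'.Pairwise (· ≤ ·)) : srt l = l' :=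
  List.Perm.eq_of_pairwise (by intros; omega) (srt_sorted l) h ((srt_perm l).trans hp)

lemma goodL.perm {M} {l l' : List ℕ} (h : goodL M l) (hp : l.Perm l') : goodL M l' :=
  ⟨fun x hx => h.1 x (hp.mem_iff.2 hx), fun x hx y hy => h.2 x (hp.mem_iff.2 hx) y (hp.mem_iff.2 hy)⟩

def At (M : ℕ) (b : Bool) (l : List ℕ) : ZMod 2 := AB M b (srt l)

lemma At_perm (M b) (l l' : List ℕ) (h : l.Perm l') : At M b l = At M b l' := by
  rw [At, At, srt_unique (h.trans (srt_perm l').symm) (srt_sorted _)]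

lemma At_bd (M : ℕ) (b : Bool) {l : List ℕ} (hg : goodL M l) :
    lF (At M b) (bdl l) = At M b l + At M (!b) l := by
  rw [lF_perm (srt_perm l).symm _ (At_perm M b)]
  rw [lF_congr (G := AB M b) ?_ (bdl_sublist (srt l))]
  · exact AB_bd M _ (srt_sorted l) (hg.perm (srt_perm l).symm) b
  · intro l' hl'
    rw [At, srt_unique (List.Perm.refl _) ((srt_sorted l).sublist hl')]

lemma At_len (M : ℕ) (b : Bool) {l : List ℕ} (hg : goodL M l) (h : At M b l ≠ 0) :
    l.length ≤ M + 1 := by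
  have h1 := (srt_perm l).length_eq
  rw [At] at h
  rw [← h1]
  have h2 := hg.perm (srt_perm l).symm
  have h3 := srt_sorted l
  rcases hh : srt l with _ | ⟨a, s⟩
  · simp
  · rw [hh] at h h2 h3
    have := AB_len M a s h3 h2 b h
    omega

def flp (M : ℕ) (a : ℕ) : ℕ := if a < 2 * M then (if a % 2 = 1 then a - 1 else a + 1) else a

lemma AB_flp (M : ℕ) (l : List ℕ) : ∀ b, AB M b (l.map (flp M)) = AB M (!b) l := by
  induction l with
  | nil => intro b; simp [AB]
  | cons a s ih =>
    intro b
    simp only [List.map_cons, AB]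
    by_cases ha : a < 2 * M
    · have h1 : flp M a < 2 * M := by simp only [flp, ha, if_true]; split_ifs <;> omega
      have h2 : decide (flp M a % 2 = 1) = !decide (a % 2 = 1) := by
        rw [Bool.eq_iff_iff]; simp only [flp, ha, if_true, decide_eq_true_eq, Bool.not_eq_true', decide_eq_false_iff_not]; split_ifs with h <;> omega
      simp only [ha, h1, if_true, h2, ih]
      cases b <;> cases decide (a % 2 = 1) <;> simp
    · have h1 : flp M a = a := by simp [flp, ha]
      simp only [h1, ha, if_false]
      simp

lemma At_flp (M : ℕ) (b : Bool) {l : List ℕ} (hg : goodL M l) :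
    At M b (l.map (flp M)) = At M (!b) l := by
  have : srt (l.map (flp M)) = (srt l).map (flp M) := by
    refine srt_unique ((srt_perm l).symm.map _) ?_
    rw [List.pairwise_map]
    refine (srt_sorted l).imp_of_mem ?_
    intro x y hx hy hxy
    have h2 := (hg.perm (srt_perm l).symm).2 x hx y hy
    unfold flp
    split_ifs <;> omega
  rw [At, this, AB_flp, At]

lemma Ev_bd (M : ℕ) {c : Ch ℕ} (hc : c ∈ Sup {l | goodL M l}) :
    lF (At M true) (bd c) = lF (At M true) c + lF (At M true) (chmap (flp M) c) := by
  have := sup_bind (lF (At M true) ∘ₗ bd - lF (At M true) - lF (At M true) ∘ₗ chmap (flp M)) ⊥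
    (P := {l | goodL M l}) (by
      intro l hl
      have h1 := At_bd M true hl
      have h2 := At_flp M true hl
      simp only [LinearMap.sub_apply, LinearMap.comp_apply, bd_single, lF_single, chmap_single, h1, h2]
      simp) hc
  simp only [LinearMap.sub_apply, LinearMap.comp_apply, Submodule.mem_bot] at this
  rw [sub_sub, sub_eq_zero] at this
  exact this


set_option linter.unusedSimpArgs false
section geo
variable {V : Type*} [NormedAddCommGroup V] [NormedSpace ℝ V]

def tau : Ch V →ₗ[ZMod 2] Ch V := chmap (fun x : V => -x)

lemma tau_tau (c : Ch V) : tau (tau c) = c := by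
  have : (tau ∘ₗ tau : Ch V →ₗ[ZMod 2] Ch V) = LinearMap.id := by
    apply ch_ext; intro l; simp [tau]
  exact LinearMap.congr_fun this c

def hch (e : ℕ → V) : ℕ → Ch V
  | 0 => Finsupp.single [e 0] 1
  | i + 1 => cone (e (i + 1)) (hch e i + tau (hch e i))

lemma hch_bd_tau (e : ℕ → V) (i : ℕ) : bd (hch e i) + tau (bd (hch e i)) = 0 ∧
    bd (hch e (i+1)) = hch e i + tau (hch e i) := by
  have key : ∀ i, bd (hch e i) + tau (bd (hch e i)) = 0 → bd (hch e (i+1)) = hch e i + tau (hch e i) := by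
    intro i h
    rw [hch, bd_cone, map_add, tau, ← chmap_bd, ← tau, h]; simp
  induction i with
  | zero =>
    have : bd (hch e 0) + tau (bd (hch e 0)) = 0 := by
      simp [hch, bdl, tau, zm2_self]
    exact ⟨this, key 0 this⟩
  | succ i ih =>
    have : bd (hch e (i+1)) + tau (bd (hch e (i+1))) = 0 := by
      rw [ih.2, map_add, tau_tau, add_comm (tau _), zm2_self]
    exact ⟨this, key _ this⟩

def bch (e : ℕ → V) (i : ℕ) : Ch V := cone 0 (hch e i)

lemma bch_bd (e : ℕ → V) (i : ℕ) : bd (bch e (i+1)) = hch e (i+1) + (bch e i + tau (bch e i)) := by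
  rw [bch, bd_cone, (hch_bd_tau e i).2, map_add, bch, tau, chmap_cone]; simp

lemma bch_bd0 (e : ℕ → V) : bd (bch e 0) = Finsupp.single [e 0] 1 + Finsupp.single [0] 1 := by
  simp [bch, bd_cone, hch, bdl]

lemma bd_sdk_iter (k t : ℕ) (c : Ch V) : bd ((sdk (k+1))^[t] c) = (sdk k)^[t] (bd c) := by
  induction t generalizing c with
  | zero => rfl
  | succ t ih => rw [Function.iterate_succ_apply, ih, bd_sdk, Function.iterate_succ_apply]

lemma tau_sdk_iter (k t : ℕ) (c : Ch V) : tau ((sdk k)^[t] c) = (sdk k)^[t] (tau c) := by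
  induction t generalizing c with
  | zero => rfl
  | succ t ih => rw [Function.iterate_succ_apply, ih, tau, sdk_neg, Function.iterate_succ_apply]

lemma sdk_iter_add (k t : ℕ) (c d : Ch V) :
    (sdk k)^[t] (c + d) = (sdk k)^[t] c + (sdk k)^[t] d := by
  induction t generalizing c d with
  | zero => rfl
  | succ t ih => simp only [Function.iterate_succ_apply, map_add, ih]

lemma sdk_iter_one (t : ℕ) (v : V) :
    (sdk 1)^[t] (Finsupp.single [v] (1 : ZMod 2)) = Finsupp.single [v] 1 := by
  induction t with
  | zero => rfl
  | succ t ih => rw [Function.iterate_succ_apply, sdk_succ_single]; simpa [bdl, sdk, bary] using ih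

def Bch (e : ℕ → V) (t i : ℕ) : Ch V := (sdk (i+2))^[t] (bch e i)
def Hch (e : ℕ → V) (t i : ℕ) : Ch V := (sdk (i+1))^[t] (hch e i)

lemma Bch_bd (e : ℕ → V) (t i : ℕ) :
    bd (Bch e t (i+1)) = Hch e t (i+1) + (Bch e t i + tau (Bch e t i)) := by
  rw [Bch, bd_sdk_iter, bch_bd, sdk_iter_add, sdk_iter_add, Hch, Bch, tau_sdk_iter]

lemma Bch_bd0 (e : ℕ → V) (t : ℕ) :
    bd (Bch e t 0) = Finsupp.single [e 0] 1 + Finsupp.single [0] 1 := by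
  rw [Bch, bd_sdk_iter, bch_bd0, sdk_iter_add, sdk_iter_one, sdk_iter_one]

/-- abstract contradiction -/
lemma no_labelling (M D : ℕ) (hMD : M < D + 1) (e : ℕ → V) (t : ℕ) (lab : V → ℕ)
    (X : Set V) (hneg : ∀ x, lab (-x) = flp M (lab x))
    (hB : ∀ i ≤ D, Bch e t i ∈ Sup {l : List V | l.length = i + 2 ∧ goodL M (l.map lab)})
    (hH : ∀ i ≤ D, Hch e t i ∈ Sup {l : List V | ∀ x ∈ l, lab x ≠ 2 * M})
    (h0 : lab 0 = 2 * M) (he : lab (e 0) ≠ 2 * M) : False := by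
  set E : Ch V →ₗ[ZMod 2] ZMod 2 := lF (At M true) ∘ₗ chmap lab with hE
  have e1 : ∀ i ≤ D, E (bd (Bch e t i)) = E (Bch e t i + tau (Bch e t i)) := by
    intro i hi
    have hc : chmap lab (Bch e t i) ∈ Sup {l | goodL M l} := by
      refine sup_bind (chmap lab) _ ?_ (hB i hi)
      rintro l ⟨_, h⟩
      rw [chmap_single]
      exact single_sup h
    have h1 : chmap (flp M) (chmap lab (Bch e t i)) = chmap lab (tau (Bch e t i)) := by
      have : chmap (flp M) ∘ₗ chmap lab = chmap lab ∘ₗ (tau : Ch V →ₗ[ZMod 2] Ch V) := by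
        apply ch_ext; intro l; simp [tau, Function.comp_def, hneg]
      exact LinearMap.congr_fun this _
    rw [hE, LinearMap.comp_apply, chmap_bd, Ev_bd M hc, h1, map_add, LinearMap.comp_apply,
      LinearMap.comp_apply]
  have hA0 : ∀ l : List ℕ, (∀ x ∈ l, x ≠ 2 * M) → ∀ b, AB M b l = 0 := by
    intro l
    induction l with
    | nil => intros; rfl
    | cons a s ih =>
      intro h b
      rw [AB]
      split_ifs with h1 h2 h3
      · exact ih (fun x hx => h x (by simp [hx])) _
      · rfl
      · exact absurd h3.1 (h a (by simp))
      · rfl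
  have e2 : ∀ i ≤ D, E (Hch e t i) = 0 := by
    intro i hi
    have := sup_bind E ⊥ ?_ (hH i hi)
    · simpa using this
    · intro l hl
      simp only [hE, LinearMap.comp_apply, chmap_single, lF_single, At, Submodule.mem_bot]
      apply hA0
      intro x hx
      have := (srt_perm _).mem_iff.1 hx
      obtain ⟨y, hy, rfl⟩ := List.mem_map.1 this
      exact hl y hy
  have e3 : ∀ i ≤ D, E (bd (Bch e t i)) = 1 := by
    intro i
    induction i with
    | zero =>
      intro _
      have hs : ∀ a : ℕ, srt [a] = [a] := fun a => srt_unique (List.Perm.refl _) (by simp)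
      have h2 := hA0 [lab (e 0)] (by simpa using he) true
      rw [Bch_bd0]
      simp only [hE, LinearMap.comp_apply, map_add, chmap_single, lF_single, At, List.map_cons,
        List.map_nil, hs, h2, h0]
      simp [AB]
    | succ i ih =>
      intro hi
      rw [Bch_bd, map_add, e2 _ hi, zero_add, ← e1 i (by omega), ih (by omega)]
  have e4 : ∀ c : Ch V, c ∈ Sup {l : List V | l.length = D + 2 ∧ goodL M (l.map lab)} → E c = 0 := by
    intro c hc
    have := sup_bind E ⊥ ?_ hc
    · simpa using this
    · rintro l ⟨h1, h2⟩
      simp only [hE, LinearMap.comp_apply, chmap_single, lF_single, Submodule.mem_bot]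
      by_contra hne
      have := At_len M true h2 hne
      simp at this
      omega
  have h5 := e3 D le_rfl
  rw [e1 D le_rfl, map_add, e4 _ (hB D le_rfl), e4] at h5
  · simp at h5
  · refine sup_bind tau _ ?_ (hB D le_rfl)
    rintro l ⟨h1, h2⟩
    rw [tau, chmap_single]
    refine single_sup ⟨by simpa using h1, ?_⟩
    have : (l.map (fun x => -x)).map lab = (l.map lab).map (flp M) := by simp [hneg]
    rw [this]
    constructor
    · intro x hx
      obtain ⟨y, hy, rfl⟩ := List.mem_map.1 hx
      have := h2.1 y hy
      unfold flp; split_ifs <;> omega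
    · intro x hx x' hx'
      obtain ⟨y, hy, rfl⟩ := List.mem_map.1 hx
      obtain ⟨y', hy', rfl⟩ := List.mem_map.1 hx'
      have := h2.2 y hy y' hy'
      unfold flp; split_ifs <;> omega
end geo

def eb (n : ℕ) (R : ℝ) (i : ℕ) : Fin n → ℝ := fun j => if (j : ℕ) = i then R else 0

lemma hch_sup (n : ℕ) {R : ℝ} (hR : 0 ≤ R) (i : ℕ) (hi : i < n) :
    hch (eb n R) i ∈ Sup {l : List (Fin n → ℝ) | l.length = i + 1 ∧ (∀ x ∈ l, ‖x‖ ≤ R ∧ ∀ j : Fin n, i < j → x j = 0) ∧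
      ∃ σ : Fin n → ℝ, (∀ j, |σ j| ≤ 1) ∧ ∀ x ∈ l, ∑ j, σ j * x j = R} := by
  have heb : ∀ i, ‖eb n R i‖ ≤ R := by
    intro i
    rw [pi_norm_le_iff_of_nonneg hR]
    intro j
    simp only [eb]; split_ifs
    · rw [Real.norm_of_nonneg hR]
    · simpa using hR
  have heb2 : ∀ i (hi : i < n) (σ : Fin n → ℝ), ∑ j, σ j * eb n R i j = σ ⟨i, hi⟩ * R := by
    intro i hi σ
    rw [Finset.sum_eq_single ⟨i, hi⟩]
    · simp [eb]
    · intro b _ hb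
      have : (b : ℕ) ≠ i := fun h => hb (Fin.ext h)
      simp [eb, this]
    · simp
  induction i with
  | zero =>
    refine single_sup ⟨rfl, ?_, fun _ => 1, by simp, ?_⟩
    · intro x hx
      rw [List.mem_singleton] at hx
      subst hx
      refine ⟨heb 0, fun j hj => ?_⟩
      simp [eb]; omega
    · intro x hx
      rw [List.mem_singleton] at hx
      subst hx
      rw [heb2 0 hi]; simp
  | succ i ih =>
    have ih := ih (by omega)
    have h2 : tau (hch (eb n R) i) ∈ Sup {l : List (Fin n → ℝ) | l.length = i + 1 ∧ (∀ x ∈ l, ‖x‖ ≤ R ∧ ∀ j : Fin n, i < j → x j = 0) ∧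
      ∃ σ : Fin n → ℝ, (∀ j, |σ j| ≤ 1) ∧ ∀ x ∈ l, ∑ j, σ j * x j = R} := by
      refine sup_bind tau _ ?_ ih
      rintro l ⟨h1, h2, σ, h3, h4⟩
      rw [tau, chmap_single]
      refine single_sup ⟨by simpa using h1, ?_, fun j => - σ j, by simpa using h3, ?_⟩
      · intro x hx
        obtain ⟨y, hy, rfl⟩ := List.mem_map.1 hx
        exact ⟨by simpa using (h2 y hy).1, fun j hj => by simpa using (h2 y hy).2 j hj⟩
      · intro x hx
        obtain ⟨y, hy, rfl⟩ := List.mem_map.1 hx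
        simpa using h4 y hy
    rw [hch]
    refine sup_bind (cone _) _ ?_ (add_mem ih h2)
    rintro l ⟨h1, h2, σ, h3, h4⟩
    rw [cone_single]
    refine single_sup ⟨by simp [h1], ?_, Function.update σ ⟨i+1, hi⟩ 1, ?_, ?_⟩
    · simp only [List.mem_cons, forall_eq_or_imp]
      refine ⟨⟨heb _, fun j hj => ?_⟩, fun x hx => ⟨(h2 x hx).1, fun j hj => (h2 x hx).2 j (by omega)⟩⟩
      simp [eb]; omega
    · intro j
      by_cases hj : j = ⟨i+1, hi⟩
      · subst hj; simp
      · rw [Function.update_of_ne hj]; exact h3 j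
    · simp only [List.mem_cons, forall_eq_or_imp]
      refine ⟨by rw [heb2 _ hi]; simp, fun x hx => ?_⟩
      rw [← h4 x hx]
      refine Finset.sum_congr rfl fun j _ => ?_
      by_cases hj : j = ⟨i+1, hi⟩
      · subst hj; rw [(h2 x hx).2 _ (by simp)]; simp
      · rw [Function.update_of_ne hj]

open Classical in
def labS {M : ℕ} (S : Set (Fin M)) (y : Fin M → ℝ) (gy : ℝ) : ℕ :=
  if h : S.Nonempty then 2 * (h.some : ℕ) + (if 0 < y h.some then 1 else 0)
  else if gy < 0 then 2 * M else 2 * M + 1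

lemma labS_le {M : ℕ} (S : Set (Fin M)) (y : Fin M → ℝ) (gy : ℝ) : labS S y gy ≤ 2 * M + 1 := by
  unfold labS
  split_ifs with h1 h2 h3
  · have := h1.some.2; omega
  · have := h1.some.2; omega
  · omega
  · omega

lemma labS_eq {M : ℕ} {S S' : Set (Fin M)} {y y' : Fin M → ℝ} {gy gy' δ : ℝ} (hδ : 0 < δ)
    (hS : ∀ j ∈ S, δ ≤ |y j|) (hS' : ∀ j ∈ S', δ ≤ |y' j|)
    (hg : ¬ S.Nonempty → δ ≤ |gy|) (hg' : ¬ S'.Nonempty → δ ≤ |gy'|)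
    (hy : ∀ j, |y j - y' j| < δ) (hgy : |gy - gy'| < δ)
    (h : labS S y gy / 2 = labS S' y' gy' / 2) : labS S y gy = labS S' y' gy' := by
  unfold labS at *
  by_cases h1 : S.Nonempty <;> by_cases h2 : S'.Nonempty
  · rw [dif_pos h1, dif_pos h2] at *
    have e : (h1.some : ℕ) = h2.some := by split_ifs at h <;> omega
    have e' : h1.some = h2.some := Fin.ext e
    have a1 := hS _ h1.some_mem
    have a2 := hS' _ h2.some_mem
    have a3 := hy h1.some
    rw [e'] at a1 a3 ⊢
    have : (0 < y h2.some) ↔ (0 < y' h2.some) := by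
      constructor
      · intro h
        by_contra hc
        rw [abs_of_pos h] at a1
        rw [abs_of_nonpos (not_lt.1 hc)] at a2
        rw [abs_lt] at a3
        linarith
      · intro h
        by_contra hc
        rw [abs_of_pos h] at a2
        rw [abs_of_nonpos (not_lt.1 hc)] at a1
        rw [abs_lt] at a3
        linarith
    simp only [this]
  · rw [dif_pos h1, dif_neg h2] at *
    have := h1.some.2
    split_ifs at h <;> omega
  · rw [dif_neg h1, dif_pos h2] at *
    have := h2.some.2
    split_ifs at h <;> omega
  · rw [dif_neg h1, dif_neg h2] at *
    have a1 := hg h1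
    have a2 := hg' h2
    have : gy < 0 ↔ gy' < 0 := by
      constructor
      · intro h
        by_contra hc
        rw [abs_of_neg h] at a1
        rw [abs_of_nonneg (not_lt.1 hc)] at a2
        rw [abs_lt] at hgy
        linarith
      · intro h
        by_contra hc
        rw [abs_of_neg h] at a2
        rw [abs_of_nonneg (not_lt.1 hc)] at a1
        rw [abs_lt] at hgy
        linarith
    simp only [this]

lemma lemmaL {n M : ℕ} (hMn : M < n) (φ : (Fin n → ℝ) → (Fin M → ℝ)) (g : (Fin n → ℝ) → ℝ)
    (hφ : Continuous φ) (hg : Continuous g) (hφo : ∀ v, φ (-v) = - φ v) (hge : ∀ v, g (-v) = g v)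
    (hg0 : g 0 < 0) {R : ℝ} (hR : 0 < R) (hgR : ∀ v, R ≤ ∑ i, |v i| → 0 < g v) :
    ∃ v, φ v = 0 ∧ g v = 0 := by
  by_contra! hno
  set X : Set (Fin n → ℝ) := Metric.closedBall 0 R with hX
  have hXc : IsCompact X := isCompact_closedBall _ _
  have hXconv : Convex ℝ X := convex_closedBall _ _
  have h0X : (0 : Fin n → ℝ) ∈ X := by simp [hX, hR.le]
  obtain ⟨δ, hδ, hδX⟩ : ∃ δ > 0, ∀ x ∈ X, δ ≤ max ‖φ x‖ |g x| := by
    obtain ⟨x, hx, hmin⟩ := hXc.exists_isMinOn ⟨0, h0X⟩ (f := fun x => max ‖φ x‖ |g x|) (by fun_prop)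
    refine ⟨_, ?_, fun y hy => hmin hy⟩
    by_cases h : φ x = 0
    · exact lt_max_of_lt_right (abs_pos.2 (hno x h))
    · exact lt_max_of_lt_left (norm_pos_iff.2 h)
  have huc : UniformContinuousOn (fun x => (φ x, g x)) X :=
    hXc.uniformContinuousOn_of_continuous (by fun_prop)
  obtain ⟨η, hη, hηX⟩ := Metric.uniformContinuousOn_iff.1 huc δ hδ
  set S : (Fin n → ℝ) → Set (Fin M) := fun x => {j | δ ≤ |φ x j|} with hS
  set lab : (Fin n → ℝ) → ℕ := fun x => labS (S x) (φ x) (g x) with hlab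
  have hSg : ∀ x ∈ X, ¬ (S x).Nonempty → δ ≤ |g x| := by
    intro x hx h
    have h1 := hδX x hx
    rcases le_max_iff.1 h1 with h2 | h2
    · exfalso
      have : ‖φ x‖ < δ := by
        rw [pi_norm_lt_iff hδ]
        intro j
        by_contra hc
        exact h ⟨j, not_lt.1 hc⟩
      linarith
    · exact h2
  have hneg : ∀ x, lab (-x) = flp M (lab x) := by
    intro x
    have hSn : S (-x) = S x := by simp [hS, hφo]
    simp only [hlab, hSn, hφo, hge]
    unfold labS
    by_cases h1 : (S x).Nonempty
    · rw [dif_pos h1, dif_pos h1]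
      have a1 : δ ≤ |φ x h1.some| := h1.some_mem
      have a2 := h1.some.2
      have : φ x h1.some ≠ 0 := by intro h; rw [h, abs_zero] at a1; linarith
      rcases lt_or_gt_of_ne this with h | h
      · rw [if_neg (not_lt.2 h.le), if_pos (by simpa using h)]
        unfold flp; split_ifs <;> omega
      · rw [if_pos h, if_neg (by simpa using h.le)]
        unfold flp; split_ifs <;> omega
    · rw [dif_neg h1, dif_neg h1]
      unfold flp; split_ifs <;> omega
  have hlabN : ∀ x, 0 < g x → lab x ≠ 2 * M := by
    intro x hx
    simp only [hlab, labS]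
    split_ifs with h1 h2 h3
    · have := h1.some.2; omega
    · have := h1.some.2; omega
    · linarith
    · omega
  -- the dimension
  obtain ⟨D, rfl⟩ : ∃ D, n = D + 1 := ⟨n - 1, by omega⟩
  -- number of subdivisions
  obtain ⟨t, ht⟩ : ∃ t : ℕ, (((D + 1 : ℕ) : ℝ) / ((D + 1 : ℕ) + 1)) ^ t * (2 * R) < η := by
    have h1 : (((D + 1 : ℕ) : ℝ) / ((D + 1 : ℕ) + 1)) < 1 := by
      rw [div_lt_one (by positivity)]; linarith
    have h2 := (tendsto_pow_atTop_nhds_zero_of_lt_one (by positivity) h1).mul_const (2 * R)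
    rw [zero_mul] at h2
    exact (h2.eventually (gt_mem_nhds hη)).exists
  set e := eb (D + 1) R with he
  have hcl : ∀ l : List (Fin (D+1) → ℝ), (∀ x ∈ l, x ∈ X) → ∀ x ∈ l, ∀ y ∈ l, dist x y ≤ 2 * R := by
    intro l hl x hx y hy
    have h1 := hl x hx
    have h2 := hl y hy
    rw [hX, mem_closedBall_zero_iff] at h1 h2
    calc dist x y ≤ ‖x‖ + ‖y‖ := dist_le_norm_add_norm x y
      _ ≤ _ := by linarith
  have hgoodl : ∀ l : List (Fin (D+1) → ℝ), (∀ x ∈ l, x ∈ X) →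
      (∀ x ∈ l, ∀ y ∈ l, dist x y ≤ (((D + 1 : ℕ) : ℝ) / ((D + 1 : ℕ) + 1)) ^ t * (2 * R)) → goodL M (l.map lab) := by
    intro l hl hd
    constructor
    · intro x hx
      obtain ⟨y, hy, rfl⟩ := List.mem_map.1 hx
      exact labS_le _ _ _
    · intro x hx x' hx'
      obtain ⟨y, hy, rfl⟩ := List.mem_map.1 hx
      obtain ⟨y', hy', rfl⟩ := List.mem_map.1 hx'
      have h1 := hηX y (hl y hy) y' (hl y' hy') (lt_of_le_of_lt (hd y hy y' hy') ht)
      rw [Prod.dist_eq, max_lt_iff] at h1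
      refine labS_eq hδ (fun j hj => hj) (fun j hj => hj) (hSg y (hl y hy)) (hSg y' (hl y' hy')) ?_ h1.2
      intro j
      exact lt_of_le_of_lt (dist_le_pi_dist (φ y) (φ y') j) h1.1
  refine no_labelling M D hMn e t lab X hneg ?_ ?_ ?_ ?_
  · intro i hi
    have h1 : bch e i ∈ Sup {l : List (Fin (D+1) → ℝ) | l.length = i + 2 ∧ (∃ K ∈ ({X} : Set (Set (Fin (D+1) → ℝ))), ∀ x ∈ l, x ∈ K) ∧
      ∀ x ∈ l, ∀ y ∈ l, dist x y ≤ 2 * R} := by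
      refine sup_bind (cone 0) _ ?_ (hch_sup (D+1) hR.le i (by omega))
      rintro l ⟨h1, h2, -⟩
      rw [cone_single]
      have : ∀ x ∈ 0 :: l, x ∈ X := by
        simp only [List.mem_cons, forall_eq_or_imp]
        exact ⟨h0X, fun x hx => by rw [hX, mem_closedBall_zero_iff]; exact (h2 x hx).1⟩
      exact single_sup ⟨by simp [h1], ⟨X, rfl, this⟩, hcl _ this⟩
    have h2 := sdk_iter_sup (D + 1) {X} (by rintro K rfl; exact hXconv) (by positivity) (i+2) (by omega) _ h1 t
    refine Finsupp.supported_mono ?_ h2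
    rintro l ⟨a, ⟨K, rfl, b⟩, c⟩
    exact ⟨a, hgoodl l b c⟩
  · intro i hi
    set F : Set (Set (Fin (D+1) → ℝ)) := {K | Convex ℝ K ∧ ∀ x ∈ K, R ≤ ∑ i, |x i|} with hF
    have h1 : hch e i ∈ Sup {l : List (Fin (D+1) → ℝ) | l.length = i + 1 ∧ (∃ K ∈ F, ∀ x ∈ l, x ∈ K) ∧
      ∀ x ∈ l, ∀ y ∈ l, dist x y ≤ 2 * R} := by
      refine Finsupp.supported_mono ?_ (hch_sup (D+1) hR.le i (by omega))
      rintro l ⟨h1, h2, σ, h3, h4⟩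
      refine ⟨h1, ⟨{x | ∑ j, σ j * x j = R}, ⟨?_, ?_⟩, h4⟩, hcl l (fun x hx => by rw [hX, mem_closedBall_zero_iff]; exact (h2 x hx).1)⟩
      · intro x hx y hy a b ha hb hab
        have hx' : ∑ j, σ j * x j = R := hx
        have hy' : ∑ j, σ j * y j = R := hy
        have : ∑ j, σ j * (a • x + b • y) j = a * ∑ j, σ j * x j + b * ∑ j, σ j * y j := by
          rw [Finset.mul_sum, Finset.mul_sum, ← Finset.sum_add_distrib]
          refine Finset.sum_congr rfl fun j _ => ?_
          simp only [Pi.add_apply, Pi.smul_apply, smul_eq_mul]; ring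
        change ∑ j, σ j * (a • x + b • y) j = R
        rw [this, hx', hy', ← add_mul, hab, one_mul]
      · intro x hx
        rw [← show ∑ j, σ j * x j = R from hx]
        refine Finset.sum_le_sum fun j _ => ?_
        calc σ j * x j ≤ |σ j * x j| := le_abs_self _
          _ = |σ j| * |x j| := abs_mul _ _
          _ ≤ 1 * |x j| := by gcongr; exact h3 j
          _ = _ := one_mul _
    have h2 := sdk_iter_sup (D + 1) F (fun K hK => hK.1) (by positivity) (i+1) (by omega) _ h1 t
    refine Finsupp.supported_mono ?_ h2
    rintro l ⟨a, ⟨K, hK, b⟩, c⟩ x hx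
    exact hlabN x (hgR x (hK.2 x (b x hx)))
  · have hφ0 : φ 0 = 0 := by
      have := hφo 0
      rw [neg_zero, eq_neg_iff_add_eq_zero, ← two_smul ℝ, smul_eq_zero] at this
      simpa using this
    have : ¬ (S 0).Nonempty := by
      rintro ⟨j, hj⟩
      simp [hS, hφ0] at hj
      linarith
    simp [hlab, labS, this, hg0]
  · apply hlabN
    apply hgR
    have : ∑ i, |e 0 i| = R := by
      rw [Finset.sum_eq_single 0]
      · simp [he, eb, abs_of_pos hR]
      · intro b _ hb
        have : (b : ℕ) ≠ 0 := fun h => hb (Fin.ext h)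
        simp [he, eb, this]
      · simp
    exact this.ge

set_option linter.unusedVariables false

section mm
variable {E : Type*} [SeminormedAddCommGroup E] [NormedSpace ℝ E]

/-- Regularity assumptions on an even functional. -/
structure RegF (J : E → ℝ) (dJ : E → E →ₗ[ℝ] ℝ) : Prop where
  U1 : ∀ R : ℝ, ∃ C : ℝ, ∀ u w : E, ‖u‖ ≤ R → ‖w‖ ≤ 1 → |dJ u w| ≤ C
  U2 : ∀ R ε : ℝ, 0 < ε → ∃ τ₀ > 0, ∀ u w : E, ‖u‖ ≤ R → ‖w‖ ≤ 1 → ∀ τ : ℝ, 0 ≤ τ → τ ≤ τ₀ →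
    |J (u + τ • w) - J u - τ * dJ u w| ≤ ε * τ

variable {J : E → ℝ} {dJ : E → E →ₗ[ℝ] ℝ}

lemma RegF.U2n (h : RegF J dJ) (R ε : ℝ) (hε : 0 < ε) : ∃ τ₀ > 0, ∀ u w : E, ‖u‖ ≤ R → ‖w‖ ≤ τ₀ →
    |J (u + w) - J u - dJ u w| ≤ ε * ‖w‖ := by
  obtain ⟨τ₀, h0, h1⟩ := h.U2 R ε hε
  refine ⟨τ₀ / 2, by positivity, fun u w hu hw => ?_⟩
  have key : ∀ τ, ‖w‖ < τ → τ ≤ τ₀ → |J (u + w) - J u - dJ u w| ≤ ε * τ := by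
    intro τ h2 h3
    have hτ : 0 < τ := lt_of_le_of_lt (norm_nonneg _) h2
    have h4 := h1 u (τ⁻¹ • w) hu ?_ τ hτ.le h3
    · rw [smul_smul, mul_inv_cancel₀ hτ.ne', one_smul, map_smul, smul_eq_mul, ← mul_assoc,
        mul_inv_cancel₀ hτ.ne', one_mul] at h4
      exact h4
    · rw [norm_smul, norm_inv, Real.norm_of_nonneg hτ.le, inv_mul_le_iff₀ hτ]; linarith
  have h5 : Tendsto (fun τ => ε * τ) (𝓝[>] ‖w‖) (𝓝 (ε * ‖w‖)) :=
    (tendsto_nhdsWithin_of_tendsto_nhds (tendsto_const_nhds.mul tendsto_id))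
  refine ge_of_tendsto h5 ?_
  have : Ioc ‖w‖ τ₀ ∈ 𝓝[>] ‖w‖ := Ioc_mem_nhdsGT (by linarith)
  filter_upwards [this] with τ hτ
  exact key τ hτ.1 hτ.2

lemma RegF.U1n (h : RegF J dJ) (R : ℝ) : ∃ C : ℝ, 0 ≤ C ∧ ∀ u w : E, ‖u‖ ≤ R → |dJ u w| ≤ C * ‖w‖ := by
  obtain ⟨C, h1⟩ := h.U1 R
  refine ⟨max C 0, le_max_right _ _, fun u w hu => ?_⟩
  have key : ∀ τ, ‖w‖ < τ → |dJ u w| ≤ (max C 0) * τ := by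
    intro τ h2
    have hτ : 0 < τ := lt_of_le_of_lt (norm_nonneg _) h2
    have h4 := h1 u (τ⁻¹ • w) hu ?_
    · rw [map_smul, smul_eq_mul, abs_mul, abs_inv, abs_of_pos hτ, inv_mul_le_iff₀ hτ] at h4
      calc _ ≤ _ := h4
        _ ≤ τ * max C 0 := by gcongr; exact le_max_left _ _
        _ = _ := mul_comm _ _
    · rw [norm_smul, norm_inv, Real.norm_of_nonneg hτ.le, inv_mul_le_iff₀ hτ]; linarith
  have h5 : Tendsto (fun τ => (max C 0) * τ) (𝓝[>] ‖w‖) (𝓝 ((max C 0) * ‖w‖)) :=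
    (tendsto_nhdsWithin_of_tendsto_nhds (tendsto_const_nhds.mul tendsto_id))
  refine ge_of_tendsto h5 ?_
  filter_upwards [self_mem_nhdsWithin] with τ hτ
  exact key τ hτ

lemma RegF.cont (h : RegF J dJ) : Continuous J := by
  rw [continuous_iff_continuousAt]
  intro u
  obtain ⟨τ₀, h0, h1⟩ := h.U2n ‖u‖ 1 one_pos
  obtain ⟨C, hC, h2⟩ := h.U1n ‖u‖
  rw [ContinuousAt, tendsto_iff_dist_tendsto_zero]
  have h3 : Tendsto (fun v => (1 + C) * ‖v - u‖) (𝓝 u) (𝓝 0) := by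
    have : Continuous (fun v : E => (1 + C) * ‖v - u‖) := by fun_prop
    simpa using this.tendsto u
  refine squeeze_zero' (Eventually.of_forall fun _ => dist_nonneg) ?_ h3
  filter_upwards [Metric.ball_mem_nhds u h0] with v hv
  rw [Metric.mem_ball, dist_eq_norm] at hv
  have h4 := h1 u (v - u) le_rfl hv.le
  have h5 := h2 u (v - u) le_rfl
  rw [add_sub_cancel] at h4
  rw [Real.dist_eq]
  calc |J v - J u| = |(J v - J u - dJ u (v - u)) + dJ u (v - u)| := by ring_nf
    _ ≤ _ := abs_add_le _ _
    _ ≤ (1 + C) * ‖v - u‖ := by linarith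

lemma RegF.contd (h : RegF J dJ) (w : E) : Continuous (fun u => dJ u w) := by
  rw [continuous_iff_continuousAt]
  intro u
  rw [Metric.continuousAt_iff']
  intro e he
  have hw : 0 < ‖w‖ + 1 := by positivity
  obtain ⟨τ₀, h0, h1⟩ := h.U2n (‖u‖ + 1) (e / (4 * (‖w‖ + 1))) (by positivity)
  set τ := τ₀ / (‖w‖ + 1) with hτ
  have hτ0 : 0 < τ := by positivity
  have hτw : ‖τ • w‖ ≤ τ₀ := by
    rw [norm_smul, Real.norm_of_nonneg hτ0.le, hτ, div_mul_eq_mul_div, div_le_iff₀ hw]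
    nlinarith [norm_nonneg w]
  have hc : Continuous (fun v => J (v + τ • w) - J v) := by
    have := h.cont
    fun_prop
  have hc' := (Metric.continuousAt_iff'.1 (hc.continuousAt (x := u))) (τ * e / 4) (by positivity)
  filter_upwards [hc', Metric.ball_mem_nhds u one_pos] with v hv hv1
  have hvn : ‖v‖ ≤ ‖u‖ + 1 := by
    rw [Metric.mem_ball, dist_eq_norm] at hv1
    have := norm_add_le u (v - u)
    rw [add_sub_cancel] at this
    linarith
  have a1 := h1 v (τ • w) hvn hτw
  have a2 := h1 u (τ • w) (by linarith) hτw
  have a3 : e / (4 * (‖w‖ + 1)) * ‖τ • w‖ ≤ τ * e / 4 := by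
    rw [norm_smul, Real.norm_of_nonneg hτ0.le, div_mul_eq_mul_div, div_le_div_iff₀ (by positivity) (by positivity)]
    have : 0 ≤ e * τ := by positivity
    nlinarith
  rw [Real.dist_eq] at hv ⊢
  rw [map_smul, smul_eq_mul] at a1 a2
  rw [abs_le] at a1 a2
  rw [abs_lt] at hv
  have h5 : |τ * (dJ v w - dJ u w)| < τ * e := by
    rw [abs_lt]; constructor <;> nlinarith
  rw [abs_mul, abs_of_pos hτ0] at h5
  exact lt_of_mul_lt_mul_left h5 hτ0.le

/-- Palais-Smale on a band of levels. -/
def PSband (J : E → ℝ) (dJ : E → E →ₗ[ℝ] ℝ) (b L : ℝ) : Prop :=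
  ∀ (u : ℕ → E) (η : ℕ → ℝ), (∀ n, b ≤ J (u n) ∧ J (u n) ≤ L) → Tendsto η atTop (𝓝 0) →
    (∀ n w, |dJ (u n) w| ≤ η n * ‖w‖) →
    ∃ (v : E) (φ : ℕ → ℕ), StrictMono φ ∧ Tendsto (u ∘ φ) atTop (𝓝 v)

lemma grad_bound (h : RegF J dJ) {b L : ℝ} (hPS : PSband J dJ b L) (A : Set E)
    (hA : IsClosed A) (hAb : ∀ u ∈ A, b ≤ J u ∧ J u ≤ L)
    (hcrit : ∀ u ∈ A, ∃ w, dJ u w ≠ 0) :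
    ∃ δ > 0, ∀ u ∈ A, ∃ w, ‖w‖ ≤ 1 ∧ dJ u w < -δ := by
  by_contra! hc
  have hn : ∀ n : ℕ, (0 : ℝ) < 1 / ((n : ℝ) + 1) := fun n => by positivity
  choose u huA hu using fun n : ℕ => hc (1 / ((n : ℝ) + 1)) (hn n)
  have hb : ∀ n w, |dJ (u n) w| ≤ 1 / ((n : ℝ) + 1) * ‖w‖ := by
    intro n w
    have key : ∀ τ, ‖w‖ < τ → |dJ (u n) w| ≤ 1 / ((n : ℝ) + 1) * τ := by
      intro τ h2
      have hτ : 0 < τ := lt_of_le_of_lt (norm_nonneg _) h2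
      have hw1 : ‖τ⁻¹ • w‖ ≤ 1 := by
        rw [norm_smul, norm_inv, Real.norm_of_nonneg hτ.le, inv_mul_le_iff₀ hτ]; linarith
      have a1 := hu n (τ⁻¹ • w) hw1
      have a2 := hu n (-(τ⁻¹ • w)) (by rwa [norm_neg])
      rw [map_neg] at a2
      rw [map_smul, smul_eq_mul] at a1 a2
      have : dJ (u n) w = τ * (τ⁻¹ * dJ (u n) w) := by field_simp
      rw [this, abs_mul, abs_of_pos hτ, mul_comm]
      gcongr
      rw [abs_le]; constructor <;> linarith
    have h5 : Tendsto (fun τ => 1 / ((n : ℝ) + 1) * τ) (𝓝[>] ‖w‖) (𝓝 (1 / ((n : ℝ) + 1) * ‖w‖)) :=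
      (tendsto_nhdsWithin_of_tendsto_nhds (tendsto_const_nhds.mul tendsto_id))
    refine ge_of_tendsto h5 ?_
    filter_upwards [self_mem_nhdsWithin] with τ hτ
    exact key τ hτ
  obtain ⟨v, φ, hφ, hv⟩ := hPS u _ (fun n => hAb _ (huA n)) tendsto_one_div_add_atTop_nhds_zero_nat hb
  have hvA : v ∈ A := hA.mem_of_tendsto hv (Eventually.of_forall fun n => huA _)
  obtain ⟨w, hw⟩ := hcrit v hvA
  have h1 : Tendsto (fun n => dJ (u (φ n)) w) atTop (𝓝 (dJ v w)) := ((h.contd w).tendsto v).comp hv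
  have h2 : Tendsto (fun n => dJ (u (φ n)) w) atTop (𝓝 0) := by
    have h3 : Tendsto (fun n : ℕ => 1 / ((n : ℝ) + 1) * ‖w‖) atTop (𝓝 0) := by
      simpa using (tendsto_one_div_add_atTop_nhds_zero_nat (𝕜 := ℝ)).mul_const ‖w‖
    refine squeeze_zero_norm (fun n => ?_) (h3.comp hφ.tendsto_atTop)
    exact hb (φ n) w
  exact hw (tendsto_nhds_unique h1 h2)

lemma field_exists (h : RegF J dJ) (hdo : ∀ u w, dJ (-u) w = - dJ u w) {A0 A1 : Set E}
    (hA0 : IsClosed A0) (hA1 : IsClosed A1) (hs0 : ∀ u, u ∈ A0 → -u ∈ A0) (hs1 : ∀ u, u ∈ A1 → -u ∈ A1)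
    {δ0 δ1 : ℝ} (h01 : δ1 ≤ δ0)
    (hg0 : ∀ u ∈ A0, ∃ w, ‖w‖ ≤ 1 ∧ dJ u w < -δ0) (hg1 : ∀ u ∈ A1, ∃ w, ‖w‖ ≤ 1 ∧ dJ u w < -δ1) :
    ∃ W : E → E, Continuous W ∧ (∀ u, W (-u) = - W u) ∧ (∀ u, ‖W u‖ ≤ 1) ∧
      (∀ u ∈ A0, dJ u (W u) ≤ -δ0) ∧ (∀ u ∈ A1, dJ u (W u) ≤ -δ1) := by
  obtain ⟨W, hW⟩ := exists_continuous_forall_mem_convex_of_local_const (X := E) (E := E)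
    (t := fun u => {w | ‖w‖ ≤ 1 ∧ (u ∈ A0 → dJ u w ≤ -δ0) ∧ (u ∈ A1 → dJ u w ≤ -δ1)}) (by
      intro u x hx y hy a b ha hb hab
      refine ⟨?_, fun hu => ?_, fun hu => ?_⟩
      · calc ‖a • x + b • y‖ ≤ ‖a • x‖ + ‖b • y‖ := norm_add_le _ _
          _ = a * ‖x‖ + b * ‖y‖ := by rw [norm_smul, norm_smul, Real.norm_of_nonneg ha, Real.norm_of_nonneg hb]
          _ ≤ a * 1 + b * 1 := by gcongr; exact hx.1; exact hy.1
          _ = 1 := by linarith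
      · rw [map_add, map_smul, map_smul, smul_eq_mul, smul_eq_mul]
        have := hx.2.1 hu
        have := hy.2.1 hu
        have e : -δ0 = a * (-δ0) + b * (-δ0) := by rw [← add_mul, hab, one_mul]
        rw [e]; gcongr
      · rw [map_add, map_smul, map_smul, smul_eq_mul, smul_eq_mul]
        have := hx.2.2 hu
        have := hy.2.2 hu
        have e : -δ1 = a * (-δ1) + b * (-δ1) := by rw [← add_mul, hab, one_mul]
        rw [e]; gcongr) (by
      intro u
      by_cases hu0 : u ∈ A0
      · obtain ⟨w, hw1, hw2⟩ := hg0 u hu0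
        refine ⟨w, ?_⟩
        filter_upwards [(h.contd w).continuousAt.eventually (gt_mem_nhds hw2)] with v hv
        exact ⟨hw1, fun _ => hv.le, fun _ => by linarith⟩
      · have ev0 : ∀ᶠ v in 𝓝 u, v ∉ A0 := hA0.isOpen_compl.mem_nhds hu0
        by_cases hu1 : u ∈ A1
        · obtain ⟨w, hw1, hw2⟩ := hg1 u hu1
          refine ⟨w, ?_⟩
          filter_upwards [(h.contd w).continuousAt.eventually (gt_mem_nhds hw2), ev0] with v hv hv0
          exact ⟨hw1, fun h => absurd h hv0, fun _ => hv.le⟩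
        · have ev1 : ∀ᶠ v in 𝓝 u, v ∉ A1 := hA1.isOpen_compl.mem_nhds hu1
          refine ⟨0, ?_⟩
          filter_upwards [ev0, ev1] with v hv0 hv1
          exact ⟨by simp, fun h => absurd h hv0, fun h => absurd h hv1⟩)
  have hodd : ∀ u w, dJ (-u) (-w) = dJ u w := by intro u w; rw [hdo, map_neg, neg_neg]
  refine ⟨fun u => (1/2 : ℝ) • (W u - W (-u)), by have := W.continuous; fun_prop, ?_, ?_, ?_, ?_⟩
  · intro u; beta_reduce; rw [neg_neg, ← smul_neg, neg_sub]
  · intro u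
    rw [norm_smul, Real.norm_of_nonneg (by norm_num)]
    have := norm_sub_le (W u) (W (-u))
    have := (hW u).1
    have := (hW (-u)).1
    linarith
  · intro u hu
    have a1 := (hW u).2.1 hu
    have a2 := (hW (-u)).2.1 (hs0 u hu)
    rw [hdo] at a2
    rw [map_smul, map_sub, smul_eq_mul]; linarith
  · intro u hu
    have a1 := (hW u).2.2 hu
    have a2 := (hW (-u)).2.2 (hs1 u hu)
    rw [hdo] at a2
    rw [map_smul, map_sub, smul_eq_mul]; linarith

end mm

set_option linter.unusedVariables false

section mm
variable {E : Type*} [SeminormedAddCommGroup E] [NormedSpace ℝ E]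
variable {J : E → ℝ} {dJ : E → E →ₗ[ℝ] ℝ}

def zet (J : E → ℝ) (r ε : ℝ) (s u : E) : ℝ := max 0 (2 * r - ‖u - s‖) * max 0 (2 * ε - |J u - J s|)

lemma zet_nonneg (J : E → ℝ) (r ε : ℝ) (s u : E) : 0 ≤ zet J r ε s u :=
  mul_nonneg (le_max_left _ _) (le_max_left _ _)

lemma zet_neg (hJe : ∀ u, J (-u) = J u) (r ε : ℝ) (s u : E) : zet J r ε s (-u) = zet J r ε (-s) u := by
  unfold zet
  rw [hJe, hJe, show -u - s = -(u - -s) by abel, norm_neg]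

lemma zet_pos {r ε : ℝ} {s u : E} (h : zet J r ε s u ≠ 0) : ‖u - s‖ < 2 * r ∧ |J u - J s| < 2 * ε := by
  unfold zet at h
  constructor
  · by_contra hc
    rw [max_eq_left (by linarith), zero_mul] at h; exact h rfl
  · by_contra hc
    rw [max_eq_left (a := (0:ℝ)) (b := 2 * ε - |J u - J s|) (by linarith), mul_zero] at h; exact h rfl

lemma zet_ge {r ε : ℝ} (hr : 0 < r) (hε : 0 < ε) {s u : E} (h1 : ‖u - s‖ ≤ r) (h2 : |J u - J s| ≤ ε) :
    r * ε ≤ zet J r ε s u := by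
  unfold zet
  gcongr
  · exact le_max_of_le_right (by linarith)
  · exact le_max_of_le_right (by linarith)

def clampk (r x : ℝ) : ℝ := max (2 * r) (min x (3 * r))

lemma clampk_lip (r x y : ℝ) : |clampk r x - clampk r y| ≤ |x - y| := by
  unfold clampk
  rw [abs_le]
  rcases le_total x y with h | h
  · rw [abs_of_nonpos (by linarith)]
    simp only [max_def, min_def]
    constructor <;> split_ifs <;> linarith
  · rw [abs_of_nonneg (by linarith)]
    simp only [max_def, min_def]
    constructor <;> split_ifs <;> linarith

/-- a deformation step with all its quantitative properties -/
lemma deform_core {k d m : ℕ} (hmk : m < k)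
    (h : RegF J dJ) (hJe : ∀ u, J (-u) = J u) (hJ0 : J 0 = 0) (hdo : ∀ u w, dJ (-u) w = - dJ u w)
    {b' b β L ρ R : ℝ} (hb' : 0 < b') (hbb : b' < b) (hbβ : b < β) (hbL : b' ≤ L) (hρ : 0 < ρ) (hR : 0 < R)
    (hPS : PSband J dJ b' L)
    (ψ : E →ₗ[ℝ] (Fin d → ℝ)) (hψ : Continuous ψ)
    (hψJ : ∀ u, ψ u = 0 → ‖u‖ = ρ → β ≤ J u)
    (ι : (Fin (d + k) → ℝ) →ₗ[ℝ] E) (hιL : ∀ t, J (ι t) ≤ L)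
    (hιR : ∀ t, R ≤ ∑ i, |t i| → J (ι t) ≤ b' ∧ ρ < ‖ι t‖)
    (c : Fin m → E) (hc : ∀ i, ∀ w, dJ (c i) w = 0) (hcb : ∀ i, b' ≤ J (c i) ∧ J (c i) ≤ L)
    (hsep : ∀ i j, i ≠ j → ‖c i - c j‖ ≠ 0 ∧ ‖c i + c j‖ ≠ 0)
    (hall : ∀ u, (∀ w, dJ u w = 0) → b' ≤ J u → J u ≤ L → ∃ i, ‖u - c i‖ = 0 ∨ ‖u + c i‖ = 0) :
    False := by
  have hJc := h.cont
  -- equality of J at inseparable points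
  have hJeq : ∀ u v : E, ‖u - v‖ = 0 → J u = J v := by
    intro u v huv
    have : Inseparable u v := by rw [Metric.inseparable_iff, dist_eq_norm]; exact huv
    exact (this.map hJc).eq
  have hself : ∀ i, ‖c i + c i‖ ≠ 0 := by
    intro i h0
    rw [← two_smul ℝ, norm_smul] at h0
    have : ‖c i - 0‖ = 0 := by rw [sub_zero]; simpa using h0
    have := hJeq _ _ this
    rw [hJ0] at this
    have := (hcb i).1
    linarith
  -- separation radius
  obtain ⟨r, hr, hrs, hrp⟩ : ∃ r > 0, (∀ i j, i ≠ j → 6 * r ≤ ‖c i - c j‖) ∧ (∀ i j, 6 * r ≤ ‖c i + c j‖) := by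
    have h1 : ∀ i j, ∀ᶠ r in 𝓝[>] (0 : ℝ), (i ≠ j → 6 * r ≤ ‖c i - c j‖) ∧ 6 * r ≤ ‖c i + c j‖ := by
      intro i j
      have hp : ∀ x : ℝ, 0 < x → ∀ᶠ r in 𝓝[>] (0 : ℝ), 6 * r ≤ x := by
        intro x hx
        have : Ioc 0 (x / 6) ∈ 𝓝[>] (0:ℝ) := Ioc_mem_nhdsGT (by positivity)
        filter_upwards [this] with r hr
        have := hr.2; linarith
      by_cases hij : i = j
      · subst hij
        filter_upwards [hp _ (lt_of_le_of_ne (norm_nonneg _) (hself i).symm)] with r hr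
        exact ⟨fun h => absurd rfl h, hr⟩
      · filter_upwards [hp _ (lt_of_le_of_ne (norm_nonneg _) (hsep i j hij).1.symm),
          hp _ (lt_of_le_of_ne (norm_nonneg _) (hsep i j hij).2.symm)] with r h1 h2
        exact ⟨fun _ => h1, h2⟩
    have h2 : ∀ᶠ r in 𝓝[>] (0 : ℝ), ∀ i j, (i ≠ j → 6 * r ≤ ‖c i - c j‖) ∧ 6 * r ≤ ‖c i + c j‖ := by
      rw [eventually_all]; intro i; rw [eventually_all]; intro j; exact h1 i j
    obtain ⟨r, hr1, hr2⟩ := (h2.and self_mem_nhdsWithin).exists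
    exact ⟨r, hr2, fun i j => (hr1 i j).1, fun i j => (hr1 i j).2⟩
  -- signed points
  set S : Fin m → Bool → E := fun i σ => if σ then c i else - c i with hSdef
  have hSsep : ∀ i σ j σ', (i, σ) ≠ (j, σ') → 6 * r ≤ ‖S i σ - S j σ'‖ := by
    intro i σ j σ' hne
    cases σ <;> cases σ' <;> simp only [hSdef] <;> simp only [if_true, if_false, Bool.false_eq_true]
    · rw [show -c i - -c j = -(c i - c j) by abel, norm_neg]
      exact hrs i j (by rintro rfl; exact hne rfl)
    · rw [show -c i - c j = -(c i + c j) by abel, norm_neg]; exact hrp i j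
    · rw [sub_neg_eq_add]; exact hrp i j
    · exact hrs i j (by rintro rfl; exact hne rfl)
  have hSneg : ∀ i σ, - S i σ = S i (!σ) := by
    intro i σ; cases σ <;> simp [hSdef]
  have hSJ : ∀ i σ, J (S i σ) = J (c i) := by
    intro i σ; cases σ <;> simp [hSdef, hJe]
  have hallS : ∀ u, (∀ w, dJ u w = 0) → b' ≤ J u → J u ≤ L → ∃ i σ, ‖u - S i σ‖ = 0 := by
    intro u h1 h2 h3
    obtain ⟨i, hi | hi⟩ := hall u h1 h2 h3
    · exact ⟨i, true, by simpa [hSdef] using hi⟩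
    · exact ⟨i, false, by simpa [hSdef] using hi⟩
  -- set A0
  set A0 : Set E := {u | (b' ≤ J u ∧ J u ≤ L) ∧ ∀ i σ, r ≤ ‖u - S i σ‖} with hA0
  have hA0c : IsClosed A0 := by
    have : A0 = ({u | b' ≤ J u} ∩ {u | J u ≤ L}) ∩ ⋂ i, ⋂ σ, {u | r ≤ ‖u - S i σ‖} := by
      ext u; simp [hA0]
    rw [this]
    refine ((isClosed_le (by fun_prop) (by fun_prop)).inter (isClosed_le (by fun_prop) (by fun_prop))).inter ?_
    exact isClosed_iInter fun i => isClosed_iInter fun σ => isClosed_le (by fun_prop) (by fun_prop)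
  obtain ⟨δ0, hδ0, hg0⟩ := grad_bound h hPS A0 hA0c (fun u hu => hu.1) (by
    intro u hu
    by_contra! hno
    obtain ⟨i, σ, hi⟩ := hallS u hno hu.1.1 hu.1.2
    have := hu.2 i σ
    linarith)
  set ε := δ0 * r / 8 with hε
  have hε0 : 0 < ε := by positivity
  set A1 : Set E := {u | (b' ≤ J u ∧ J u ≤ L) ∧ ∀ i σ, r ≤ ‖u - S i σ‖ ∨ ε ≤ |J u - J (S i σ)|} with hA1
  have hA1c : IsClosed A1 := by
    have : A1 = ({u | b' ≤ J u} ∩ {u | J u ≤ L}) ∩ ⋂ i, ⋂ σ, ({u | r ≤ ‖u - S i σ‖} ∪ {u | ε ≤ |J u - J (S i σ)|}) := by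
      ext u; simp [hA1]
    rw [this]
    refine ((isClosed_le (by fun_prop) (by fun_prop)).inter (isClosed_le (by fun_prop) (by fun_prop))).inter ?_
    exact isClosed_iInter fun i => isClosed_iInter fun σ => (isClosed_le (by fun_prop) (by fun_prop)).union (isClosed_le (by fun_prop) (by fun_prop))
  obtain ⟨δ1', hδ1', hg1'⟩ := grad_bound h hPS A1 hA1c (fun u hu => hu.1) (by
    intro u hu
    by_contra! hno
    obtain ⟨i, σ, hi⟩ := hallS u hno hu.1.1 hu.1.2
    rcases hu.2 i σ with h1 | h1
    · linarith
    · rw [hJeq _ _ hi, sub_self, abs_zero] at h1; linarith)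
  set δ1 := min δ1' δ0 with hδ1d
  have hδ1 : 0 < δ1 := lt_min hδ1' hδ0
  have h01 : δ1 ≤ δ0 := min_le_right _ _
  have hsymS : ∀ u i σ, ‖-u - S i σ‖ = ‖u - S i (!σ)‖ := by
    intro u i σ
    rw [← hSneg, show -u - S i σ = -(u - -S i σ) by abel, norm_neg]
  obtain ⟨W, hWc, hWo, hW1, hWA0, hWA1⟩ := field_exists h hdo hA0c hA1c
    (fun u hu => ⟨by rw [hJe]; exact hu.1, fun i σ => by rw [hsymS]; exact hu.2 i _⟩)
    (fun u hu => ⟨by rw [hJe]; exact hu.1, fun i σ => by rw [hsymS, hJe, hSJ, ← hSJ i (!σ)]; exact hu.2 i _⟩)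
    h01 hg0 (fun u hu => by
      obtain ⟨w, hw1, hw2⟩ := hg1' u hu
      exact ⟨w, hw1, by have := min_le_left δ1' δ0; linarith⟩)
  -- cutoffs
  set Z : E → ℝ := fun u => ∑ i, ∑ σ, zet J r ε (S i σ) u with hZ
  have hZ0 : ∀ u, 0 ≤ Z u := fun u => Finset.sum_nonneg fun i _ => Finset.sum_nonneg fun σ _ => zet_nonneg _ _ _ _ _
  have hzc : ∀ s, Continuous (zet J r ε s) := by
    intro s; unfold zet; fun_prop
  have hZc : Continuous Z := continuous_finset_sum _ fun i _ => continuous_finset_sum _ fun σ _ => hzc _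
  set cut : E → ℝ := fun u => max 0 (min 1 ((J u - b') / (b - b'))) with hcut
  set χ : E → ℝ := fun u => cut u * max 0 (1 - Z u / (r * ε)) with hχ
  have hχc : Continuous χ := by
    have : b - b' ≠ 0 := by linarith
    simp only [hχ, hcut]
    fun_prop
  have hcut0 : ∀ u, 0 ≤ cut u := fun u => le_max_left _ _
  have hcut1 : ∀ u, cut u ≤ 1 := fun u => max_le zero_le_one (min_le_left _ _)
  have hχ0 : ∀ u, 0 ≤ χ u := fun u => mul_nonneg (hcut0 u) (le_max_left _ _)
  have hχ1 : ∀ u, χ u ≤ 1 := by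
    intro u
    refine mul_le_one₀ (hcut1 u) (le_max_left _ _) (max_le zero_le_one ?_)
    have : 0 ≤ Z u / (r * ε) := div_nonneg (hZ0 u) (by positivity)
    linarith
  have hχlow : ∀ u, J u ≤ b' → χ u = 0 := by
    intro u hu
    have : (J u - b') / (b - b') ≤ 0 := div_nonpos_of_nonpos_of_nonneg (by linarith) (by linarith)
    have : cut u = 0 := by
      simp only [hcut]
      exact max_eq_left ((min_le_right _ _).trans this)
    simp [hχ, this]
  have hχhigh : ∀ u, b ≤ J u → Z u = 0 → χ u = 1 := by
    intro u hu hz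
    have : 1 ≤ (J u - b') / (b - b') := by rw [le_div_iff₀ (by linarith)]; linarith
    simp only [hχ, hcut, hz, min_eq_left this]
    simp
  have hχA1 : ∀ u, J u ≤ L → χ u ≠ 0 → b' < J u ∧ u ∈ A1 := by
    intro u huL hne
    have h1 : b' < J u := by
      by_contra hcc
      exact hne (hχlow u (not_lt.1 hcc))
    refine ⟨h1, ⟨h1.le, huL⟩, fun i σ => ?_⟩
    by_contra! hcc
    apply hne
    have a1 := zet_ge hr hε0 hcc.1.le hcc.2.le
    have a2 : zet J r ε (S i σ) u ≤ Z u := by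
      refine le_trans ?_ (Finset.single_le_sum (f := fun i => ∑ σ, zet J r ε (S i σ) u)
        (fun j _ => Finset.sum_nonneg fun σ _ => zet_nonneg _ _ _ _ _) (Finset.mem_univ i))
      exact Finset.single_le_sum (f := fun σ => zet J r ε (S i σ) u)
        (fun j _ => zet_nonneg _ _ _ _ _) (Finset.mem_univ σ)
    have a3 : 1 ≤ Z u / (r * ε) := by rw [le_div_iff₀ (by positivity)]; linarith
    simp only [hχ]
    rw [max_eq_left (a := (0:ℝ)) (b := 1 - Z u / (r * ε)) (by linarith), mul_zero]
  have hZe : ∀ u, Z (-u) = Z u := by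
    intro u
    refine Finset.sum_congr rfl fun i _ => ?_
    simp only [Fintype.sum_bool, zet_neg hJe, hSneg]
    simp [add_comm]
  have hχe : ∀ u, χ (-u) = χ u := by
    intro u; simp only [hχ, hcut, hZe, hJe]
  -- bounds
  have hιc : Continuous ι := LinearMap.continuous_of_finiteDimensional ι
  obtain ⟨R0, hR0⟩ : ∃ R0, ∀ t, ∑ i, |t i| ≤ R → ‖ι t‖ ≤ R0 := by
    have hcp : IsCompact (Metric.closedBall (0 : Fin (d + k) → ℝ) R) := isCompact_closedBall _ _
    obtain ⟨B, hB⟩ := (hcp.image hιc).isBounded.exists_norm_le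
    refine ⟨B, fun t ht => hB _ ⟨t, ?_, rfl⟩⟩
    rw [mem_closedBall_zero_iff, pi_norm_le_iff_of_nonneg hR.le]
    intro i
    refine le_trans ?_ ht
    exact Finset.single_le_sum (f := fun i => |t i|) (fun _ _ => abs_nonneg _) (Finset.mem_univ i)
  set D := 2 / δ1 * (L - b') + 1 with hD
  obtain ⟨τ0, hτ0, hstep0⟩ := h.U2n (R0 + D) (δ1 / 2) (by positivity)
  set τ := min τ0 (min 1 r) with hτd
  have hτ : 0 < τ := lt_min hτ0 (lt_min one_pos hr)
  have hττ0 : τ ≤ τ0 := min_le_left _ _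
  have hτ1 : τ ≤ 1 := (min_le_right _ _).trans (min_le_left _ _)
  have hτr : τ ≤ r := (min_le_right _ _).trans (min_le_right _ _)
  set T : E → E := fun u => u + (τ * χ u) • W u with hT
  have hTc : Continuous T := by fun_prop
  have hTo : ∀ u, T (-u) = - T u := by
    intro u; simp only [hT, hχe, hWo, smul_neg]; abel
  have hTfix : ∀ u, χ u = 0 → T u = u := by intro u hu; simp [hT, hu]
  have hTd : ∀ u, ‖T u - u‖ ≤ τ * χ u := by
    intro u
    simp only [hT, add_sub_cancel_left]
    rw [norm_smul, Real.norm_of_nonneg (mul_nonneg hτ.le (hχ0 u))]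
    exact mul_le_of_le_one_right (mul_nonneg hτ.le (hχ0 u)) (hW1 u)
  have hTJ : ∀ u, ‖u‖ ≤ R0 + D → ∀ δ, δ1 ≤ δ → dJ u (W u) ≤ -δ → J (T u) ≤ J u - δ / 2 * (τ * χ u) := by
    intro u hu δ hδ hdW
    have hnn : 0 ≤ τ * χ u := mul_nonneg hτ.le (hχ0 u)
    have hn : ‖(τ * χ u) • W u‖ ≤ τ * χ u := by simpa [hT] using hTd u
    have a1 := hstep0 u ((τ * χ u) • W u) hu (by
      refine hn.trans ?_
      calc τ * χ u ≤ τ * 1 := by gcongr; exact hχ1 u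
        _ ≤ τ0 := by linarith)
    rw [map_smul, smul_eq_mul] at a1
    have a2 := (abs_le.1 a1).2
    have hδp : 0 ≤ δ / 2 := by linarith
    have a3 : δ1 / 2 * ‖(τ * χ u) • W u‖ ≤ δ / 2 * (τ * χ u) := by gcongr
    have a4 : τ * χ u * dJ u (W u) ≤ τ * χ u * (-δ) := by gcongr
    simp only [hT]
    linarith
  -- iterates
  obtain ⟨Mi, hMi⟩ := exists_nat_gt ((L - b) / (δ1 / 2 * τ))
  have hinv : ∀ t : Fin (d + k) → ℝ, ∀ j : ℕ,
      ‖T^[j] (ι t) - ι t‖ ≤ 2 / δ1 * (J (ι t) - J (T^[j] (ι t))) ∧ ‖T^[j] (ι t) - ι t‖ ≤ D ∧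
      (R ≤ ∑ i, |t i| → T^[j] (ι t) = ι t) ∧ J (T^[j] (ι t)) ≤ L := by
    intro t j
    induction j with
    | zero => simp [hD]; exact ⟨by have : 0 ≤ L - b' := by linarith
                                   positivity, hιL t⟩
    | succ j ih =>
      obtain ⟨i1, i2, i3, i4⟩ := ih
      rw [Function.iterate_succ_apply']
      set v := T^[j] (ι t) with hv
      by_cases hχv : χ v = 0
      · rw [hTfix v hχv]; exact ⟨i1, i2, i3, i4⟩
      · obtain ⟨a1, a2⟩ := hχA1 v i4 hχv
        have hnR : ¬ R ≤ ∑ i, |t i| := by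
          intro hR'
          have := (hιR t hR').1
          rw [← i3 hR'] at this
          linarith
        have hvn : ‖v‖ ≤ R0 + D := by
          have := norm_add_le (ι t) (v - ι t)
          rw [add_sub_cancel] at this
          have := hR0 t (not_le.1 hnR).le
          linarith
        have hdrop := hTJ v hvn δ1 le_rfl (hWA1 v a2)
        have hdd := hTd v
        have htri : ‖T v - ι t‖ ≤ ‖v - ι t‖ + τ * χ v := by
          have := norm_add_le (v - ι t) (T v - v)
          rw [sub_add_sub_cancel'] at this
          linarith
        have hδ1i : 2 / δ1 * (δ1 / 2 * (τ * χ v)) = τ * χ v := by field_simp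
        refine ⟨?_, ?_, fun hR' => absurd hR' hnR, ?_⟩
        · refine htri.trans ?_
          have : 2 / δ1 * (J (ι t) - (J v - δ1 / 2 * (τ * χ v))) ≤ 2 / δ1 * (J (ι t) - J (T v)) := by gcongr
          have e : 2 / δ1 * (J (ι t) - (J v - δ1 / 2 * (τ * χ v))) = 2 / δ1 * (J (ι t) - J v) + 2 / δ1 * (δ1 / 2 * (τ * χ v)) := by ring
          linarith
        · refine htri.trans ?_
          have : 2 / δ1 * (J (ι t) - J v) ≤ 2 / δ1 * (L - b') := by
            gcongr
            exact hιL t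
          have : τ * χ v ≤ 1 * 1 := mul_le_mul hτ1 (hχ1 v) (hχ0 v) zero_le_one
          rw [hD]; linarith
        · have : 0 ≤ δ1 / 2 * (τ * χ v) := mul_nonneg (by positivity) (mul_nonneg hτ.le (hχ0 v))
          linarith
  have hdropA : ∀ t : Fin (d + k) → ℝ, ∀ j : ℕ, ∀ δ, δ1 ≤ δ → dJ (T^[j] (ι t)) (W (T^[j] (ι t))) ≤ -δ →
      J (T^[j+1] (ι t)) ≤ J (T^[j] (ι t)) - δ / 2 * (τ * χ (T^[j] (ι t))) := by
    intro t j δ hδ hd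
    obtain ⟨i1, i2, i3, i4⟩ := hinv t j
    rw [Function.iterate_succ_apply']
    set v := T^[j] (ι t) with hv
    by_cases hχv : χ v = 0
    · rw [hTfix v hχv, hχv]; simp
    · refine hTJ v ?_ δ hδ hd
      have hnR : ¬ R ≤ ∑ i, |t i| := by
        intro hR'
        have := (hιR t hR').1
        rw [← i3 hR'] at this
        exact hχv (hχlow v this)
      have := norm_add_le (ι t) (v - ι t)
      rw [add_sub_cancel] at this
      have := hR0 t (not_le.1 hnR).le
      linarith
  -- monotone
  have hmono1 : ∀ t : Fin (d + k) → ℝ, ∀ j : ℕ, ∀ i σ,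
      δ0 / 2 * |clampk r ‖T^[j+1] (ι t) - S i σ‖ - clampk r ‖T^[j] (ι t) - S i σ‖| ≤ J (T^[j] (ι t)) - J (T^[j+1] (ι t)) := by
    intro t j i σ
    have hI := hinv t j
    have hdr := hdropA t j
    set v := T^[j] (ι t) with hv
    have hs : T^[j+1] (ι t) = T v := Function.iterate_succ_apply' T j (ι t)
    rw [hs] at hdr ⊢
    by_cases hχv : χ v = 0
    · rw [hTfix v hχv]; simp
    obtain ⟨a1, a2⟩ := hχA1 v hI.2.2.2 hχv
    have hd1 := hdr δ1 le_rfl (hWA1 v a2)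
    have hnn : 0 ≤ τ * χ v := mul_nonneg hτ.le (hχ0 v)
    have hτχ : τ * χ v ≤ r := by
      calc τ * χ v ≤ τ * 1 := by gcongr; exact hχ1 v
        _ ≤ r := by linarith
    have hdd := hTd v
    have hdiff : |‖T v - S i σ‖ - ‖v - S i σ‖| ≤ τ * χ v := by
      refine (abs_norm_sub_norm_le _ _).trans ?_
      rw [sub_sub_sub_cancel_right]; exact hdd
    by_cases hA : v ∈ A0
    · have := hdr δ0 h01 (hWA0 v hA)
      have h2 := (clampk_lip r ‖T v - S i σ‖ ‖v - S i σ‖).trans hdiff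
      have : δ0 / 2 * |clampk r ‖T v - S i σ‖ - clampk r ‖v - S i σ‖| ≤ δ0 / 2 * (τ * χ v) := by gcongr
      linarith
    · have h3 : ∃ i' σ', ‖v - S i' σ'‖ < r := by
        by_contra! hcc
        exact hA ⟨a2.1, hcc⟩
      obtain ⟨i', σ', h3⟩ := h3
      have h0 : clampk r ‖T v - S i σ‖ = clampk r ‖v - S i σ‖ := by
        rw [abs_le] at hdiff
        by_cases heq : (i, σ) = (i', σ')
        · obtain ⟨rfl, rfl⟩ := Prod.mk.inj heq
          unfold clampk
          rw [max_eq_left, max_eq_left]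
          · exact (min_le_left _ _).trans (by linarith)
          · exact (min_le_left _ _).trans (by linarith)
        · have h4 := hSsep i σ i' σ' heq
          have h5 : ‖S i σ - S i' σ'‖ ≤ ‖v - S i' σ'‖ + ‖v - S i σ‖ := by
            have := norm_sub_le (v - S i' σ') (v - S i σ)
            rw [sub_sub_sub_cancel_left] at this
            exact this
          unfold clampk
          rw [min_eq_right, min_eq_right]
          · linarith
          · linarith
      rw [h0]
      have : 0 ≤ δ1 / 2 * (τ * χ v) := mul_nonneg (by positivity) hnn
      simp only [sub_self, abs_zero, mul_zero]
      linarith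
  have hmono : ∀ t : Fin (d + k) → ℝ, ∀ j n : ℕ, ∀ i σ,
      δ0 / 2 * |clampk r ‖T^[j+n] (ι t) - S i σ‖ - clampk r ‖T^[j] (ι t) - S i σ‖| ≤ J (T^[j] (ι t)) - J (T^[j+n] (ι t)) := by
    intro t j n i σ
    induction n with
    | zero => simp
    | succ n ih =>
      have h1 := hmono1 t (j + n) i σ
      rw [← add_assoc]
      have h2 := abs_sub_le (clampk r ‖T^[j+n+1] (ι t) - S i σ‖) (clampk r ‖T^[j+n] (ι t) - S i σ‖) (clampk r ‖T^[j] (ι t) - S i σ‖)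
      have h3 := mul_le_mul_of_nonneg_left h2 (show 0 ≤ δ0 / 2 by positivity)
      rw [mul_add] at h3
      linarith
  -- no cancellation
  have hnc : ∀ t : Fin (d + k) → ℝ, ∀ i, ∀ j j' : ℕ, ∀ σ, zet J r ε (S i σ) (T^[j] (ι t)) ≠ 0 →
      zet J r ε (S i (!σ)) (T^[j'] (ι t)) ≠ 0 → False := by
    have key : ∀ t : Fin (d + k) → ℝ, ∀ i, ∀ j n : ℕ, ∀ σ, zet J r ε (S i σ) (T^[j] (ι t)) ≠ 0 →
      zet J r ε (S i (!σ)) (T^[j+n] (ι t)) ≠ 0 → False := by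
      intro t i j n σ h1 h2
      have h3 := zet_pos h1
      have h4 := zet_pos h2
      have h5 := hmono t j n i σ
      have e1 : clampk r ‖T^[j] (ι t) - S i σ‖ = 2 * r := by
        unfold clampk; exact max_eq_left ((min_le_left _ _).trans (by linarith))
      have h6 := hSsep i σ i (!σ) (by cases σ <;> simp)
      have h7 : ‖S i σ - S i (!σ)‖ ≤ ‖T^[j+n] (ι t) - S i (!σ)‖ + ‖T^[j+n] (ι t) - S i σ‖ := by
        have := norm_sub_le (T^[j+n] (ι t) - S i (!σ)) (T^[j+n] (ι t) - S i σ)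
        rw [sub_sub_sub_cancel_left] at this
        exact this
      have e2 : clampk r ‖T^[j+n] (ι t) - S i σ‖ = 3 * r := by
        unfold clampk
        rw [min_eq_right (by linarith), max_eq_right (by linarith)]
      rw [e1, e2, show 3 * r - 2 * r = r by ring, abs_of_pos hr] at h5
      have h8 := h3.2
      have h9 := h4.2
      rw [hSJ, abs_lt] at h8 h9
      have : ε * 4 = δ0 / 2 * r := by rw [hε]; ring
      linarith
    intro t i j j' σ h1 h2
    rcases le_total j j' with hj | hj
    · obtain ⟨n, rfl⟩ := Nat.exists_eq_add_of_le hj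
      exact key t i j n σ h1 h2
    · obtain ⟨n, rfl⟩ := Nat.exists_eq_add_of_le hj
      exact key t i j' n (!σ) h2 (by rwa [Bool.not_not])
  -- the map
  set θ : (Fin (d + k) → ℝ) → Fin m → ℝ := fun t i =>
    ∑ j ∈ Finset.range Mi, (zet J r ε (S i true) (T^[j] (ι t)) - zet J r ε (S i false) (T^[j] (ι t))) with hθ
  have hTi : ∀ j, Continuous T^[j] := fun j => hTc.iterate j
  have hTio : ∀ j u, T^[j] (-u) = - T^[j] u := by
    intro j
    induction j with
    | zero => intro u; rfl
    | succ j ih => intro u; rw [Function.iterate_succ_apply, Function.iterate_succ_apply, hTo, ih]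
  set φ : (Fin (d + k) → ℝ) → Fin (m + d) → ℝ := fun t => Fin.append (θ t) (ψ (T^[Mi] (ι t))) with hφ
  obtain ⟨t, ht1, ht2⟩ := lemmaL (n := d + k) (M := m + d) (by omega) φ (fun t => ‖T^[Mi] (ι t)‖ - ρ)
    (by
      refine continuous_pi fun i => ?_
      refine Fin.addCases (fun i => ?_) (fun i => ?_) i
      · simp only [hφ, Fin.append_left, hθ]
        refine continuous_finset_sum _ fun j _ => ?_
        exact ((hzc _).comp ((hTi j).comp hιc)).sub ((hzc _).comp ((hTi j).comp hιc))
      · simp only [hφ, Fin.append_right]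
        exact (continuous_apply i).comp (hψ.comp ((hTi Mi).comp hιc)))
    (((hTi Mi).comp hιc).norm.sub continuous_const)
    (by
      intro t
      funext i
      refine Fin.addCases (fun i => ?_) (fun i => ?_) i
      · simp only [hφ, Fin.append_left, hθ, Pi.neg_apply, map_neg, hTio, zet_neg hJe, hSneg, ← Finset.sum_neg_distrib]
        refine Finset.sum_congr rfl fun j _ => ?_
        simp
      · simp only [hφ, Fin.append_right, Pi.neg_apply, map_neg, hTio])
    (by intro t; simp only [map_neg, hTio, norm_neg])
    (by
      have : ∀ j, T^[j] (0 : E) = 0 := by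
        intro j
        induction j with
        | zero => rfl
        | succ j ih => rw [Function.iterate_succ_apply, hTfix 0 (hχlow 0 (by rw [hJ0]; exact hb'.le)), ih]
      simp [this, hρ]) hR
    (by
      intro t ht
      simp only [(hinv t Mi).2.2.1 ht]
      have := (hιR t ht).2
      linarith)
  have hθ0 : ∀ i, θ t i = 0 := by
    intro i
    have := congrFun ht1 (Fin.castAdd d i)
    simpa [hφ] using this
  have hψ0 : ψ (T^[Mi] (ι t)) = 0 := by
    funext i
    have := congrFun ht1 (Fin.natAdd m i)
    simpa [hφ] using this
  have hβJ := hψJ _ hψ0 (by linarith)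
  -- all zeta vanish
  have hz : ∀ j < Mi, ∀ i σ, zet J r ε (S i σ) (T^[j] (ι t)) = 0 := by
    intro j hj i σ
    by_contra hne
    have hother : ∀ j', zet J r ε (S i (!σ)) (T^[j'] (ι t)) = 0 := by
      intro j'
      by_contra h2
      exact hnc t i j j' σ hne h2
    have h0 := hθ0 i
    have hpos : 0 < ∑ j ∈ Finset.range Mi, zet J r ε (S i σ) (T^[j] (ι t)) := by
      refine Finset.sum_pos' (fun _ _ => zet_nonneg _ _ _ _ _) ⟨j, Finset.mem_range.2 hj, ?_⟩
      exact lt_of_le_of_ne (zet_nonneg _ _ _ _ _) (Ne.symm hne)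
    simp only [hθ] at h0
    cases σ
    · simp only [Bool.not_false] at hother
      simp only [hother, zero_sub, Finset.sum_neg_distrib] at h0
      linarith
    · simp only [Bool.not_true] at hother
      simp only [hother, sub_zero] at h0
      linarith
  -- descent
  have hdesc : ∀ j ≤ Mi, J (T^[j] (ι t)) < b ∨ J (T^[j] (ι t)) ≤ L - j * (δ1 / 2 * τ) := by
    intro j
    induction j with
    | zero => intro _; right; simpa using hιL t
    | succ j ih =>
      intro hj
      have hmn : J (T^[j+1] (ι t)) ≤ J (T^[j] (ι t)) := by
        by_cases hχv : χ (T^[j] (ι t)) = 0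
        · rw [Function.iterate_succ_apply', hTfix _ hχv]
        · obtain ⟨a1, a2⟩ := hχA1 _ (hinv t j).2.2.2 hχv
          have := hdropA t j δ1 le_rfl (hWA1 _ a2)
          have h2 : 0 ≤ δ1 / 2 * (τ * χ (T^[j] (ι t))) := mul_nonneg (by positivity) (mul_nonneg hτ.le (hχ0 _))
          linarith
      by_cases hb : J (T^[j] (ι t)) < b
      · left; linarith
      · right
        have h1 := (ih (by omega)).resolve_left hb
        have hZz : Z (T^[j] (ι t)) = 0 :=
          Finset.sum_eq_zero fun i _ => Finset.sum_eq_zero fun σ _ => hz j (by omega) i σ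
        have hχ1' := hχhigh _ (not_lt.1 hb) hZz
        obtain ⟨a1, a2⟩ := hχA1 _ (hinv t j).2.2.2 (by rw [hχ1']; exact one_ne_zero)
        have := hdropA t j δ1 le_rfl (hWA1 _ a2)
        rw [hχ1'] at this
        push_cast
        linarith
  rcases hdesc Mi le_rfl with h1 | h1
  · linarith
  · rw [div_lt_iff₀ (by positivity)] at hMi
    linarith

theorem minimax {k d : ℕ}
    (h : RegF J dJ) (hJe : ∀ u, J (-u) = J u) (hJ0 : J 0 = 0) (hdo : ∀ u w, dJ (-u) w = - dJ u w)
    {b' b β L ρ R : ℝ} (hb' : 0 < b') (hbb : b' < b) (hbβ : b < β) (hbL : b' ≤ L) (hρ : 0 < ρ) (hR : 0 < R)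
    (hPS : PSband J dJ b' L)
    (ψ : E →ₗ[ℝ] (Fin d → ℝ)) (hψ : Continuous ψ)
    (hψJ : ∀ u, ψ u = 0 → ‖u‖ = ρ → β ≤ J u)
    (ι : (Fin (d + k) → ℝ) →ₗ[ℝ] E) (hιL : ∀ t, J (ι t) ≤ L)
    (hιR : ∀ t, R ≤ ∑ i, |t i| → J (ι t) ≤ b' ∧ ρ < ‖ι t‖) :
    ∃ c : Fin k → E, (∀ i w, dJ (c i) w = 0) ∧ (∀ i, b' ≤ J (c i)) ∧
      ∀ i j, i ≠ j → ‖c i - c j‖ ≠ 0 ∧ ‖c i + c j‖ ≠ 0 := by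
  suffices H : ∀ m ≤ k, ∃ c : Fin m → E, (∀ i w, dJ (c i) w = 0) ∧ (∀ i, b' ≤ J (c i) ∧ J (c i) ≤ L) ∧
      ∀ i j, i ≠ j → ‖c i - c j‖ ≠ 0 ∧ ‖c i + c j‖ ≠ 0 by
    obtain ⟨c, h1, h2, h3⟩ := H k le_rfl
    exact ⟨c, h1, fun i => (h2 i).1, h3⟩
  intro m
  induction m with
  | zero => intro _; exact ⟨fun i => i.elim0, fun i => i.elim0, fun i => i.elim0, fun i => i.elim0⟩
  | succ m ih =>
    intro hm
    obtain ⟨c, h1, h2, h3⟩ := ih (by omega)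
    have hnew : ∃ u, (∀ w, dJ u w = 0) ∧ (b' ≤ J u ∧ J u ≤ L) ∧ ∀ i, ‖u - c i‖ ≠ 0 ∧ ‖u + c i‖ ≠ 0 := by
      by_contra! hcc
      refine deform_core (m := m) (by omega) h hJe hJ0 hdo hb' hbb hbβ hbL hρ hR hPS ψ hψ hψJ ι hιL hιR c h1 h2 h3 ?_
      intro u hu hub huL
      obtain ⟨i, hi⟩ := hcc u hu ⟨hub, huL⟩
      refine ⟨i, ?_⟩
      by_cases h0 : ‖u - c i‖ = 0
      · exact Or.inl h0
      · exact Or.inr (hi h0)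
    obtain ⟨u, hu1, hu2, hu3⟩ := hnew
    refine ⟨Fin.cons u c, fun i => ?_, fun i => ?_, fun i j hij => ?_⟩
    · refine Fin.cases ?_ (fun i => ?_) i
      · simpa using hu1
      · simpa using h1 i
    · refine Fin.cases ?_ (fun i => ?_) i
      · simpa using hu2
      · simpa using h2 i
    · revert hij
      refine Fin.cases ?_ (fun i => ?_) i <;> refine Fin.cases ?_ (fun j => ?_) j
      · intro h; exact absurd rfl h
      · intro _; simpa using hu3 j
      · intro _
        have := hu3 i
        rw [Fin.cons_succ, Fin.cons_zero, norm_sub_rev, add_comm]; exact this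
      · intro hij
        rw [Fin.cons_succ, Fin.cons_succ]
        exact h3 i j (fun h => hij (by rw [h]))
end mm


/-- generalized dominated convergence -/
lemma gdc {Z : Type*} [MeasurableSpace Z] {m : Measure Z} {h k : ℕ → Z → ℝ} {K : ℝ}
    (hm : ∀ n, AEStronglyMeasurable (h n) m) (h0 : ∀ n z, 0 ≤ h n z)
    (hlim : ∀ᵐ z ∂m, Tendsto (fun n => h n z) atTop (𝓝 0))
    (hk : ∀ n, Integrable (k n) m) (hk0 : ∀ n z, 0 ≤ k n z) (hK : ∀ n, ∫ z, k n z ∂m ≤ K)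
    (hG : ∀ ε > 0, ∃ G : Z → ℝ, Integrable G m ∧ ∀ n, ∀ᵐ z ∂m, h n z ≤ G z + ε * k n z) :
    Tendsto (fun n => ∫ z, h n z ∂m) atTop (𝓝 0) := by
  have hK0 : 0 ≤ K := (integral_nonneg (hk0 0)).trans (hK 0)
  have hint : ∀ n, Integrable (h n) m := by
    intro n
    obtain ⟨G, hGi, hGb⟩ := hG 1 one_pos
    refine Integrable.mono' (hGi.add ((hk n).const_mul 1)) (hm n) ?_
    filter_upwards [hGb n] with z hz
    rw [Real.norm_of_nonneg (h0 n z)]; exact hz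
  rw [Metric.tendsto_atTop]
  intro ε hε
  obtain ⟨G, hGi, hGb⟩ := hG (ε / (2 * (K + 1))) (by positivity)
  set e := ε / (2 * (K + 1)) with he
  have he0 : 0 < e := by positivity
  have hKe : e * K < ε / 2 := by
    rw [he, div_mul_eq_mul_div, div_lt_div_iff₀ (by positivity) (by positivity)]
    nlinarith
  have hd : Tendsto (fun n => ∫ z, max (h n z - e * k n z) 0 ∂m) atTop (𝓝 (∫ _, (0:ℝ) ∂m)) := by
    refine tendsto_integral_of_dominated_convergence (fun z => |G z|) ?_ hGi.abs ?_ ?_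
    · intro n
      exact ((hint n).sub ((hk n).const_mul e)).aestronglyMeasurable.sup aestronglyMeasurable_const
    · intro n
      filter_upwards [hGb n] with z hz
      rw [Real.norm_of_nonneg (le_max_right _ _)]
      exact max_le ((by linarith : _ ≤ G z).trans (le_abs_self _)) (abs_nonneg _)
    · filter_upwards [hlim] with z hz
      refine squeeze_zero (fun n => le_max_right _ _) (fun n => max_le ?_ (h0 n z)) hz
      have := mul_nonneg he0.le (hk0 n z)
      linarith
  rw [integral_zero, Metric.tendsto_atTop] at hd
  obtain ⟨n0, hn0⟩ := hd (ε / 2) (by positivity)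
  refine ⟨n0, fun n hn => ?_⟩
  have a1 := hn0 n hn
  rw [Real.dist_eq, sub_zero, abs_of_nonneg (integral_nonneg fun z => le_max_right _ _)] at a1
  rw [Real.dist_eq, sub_zero, abs_of_nonneg (integral_nonneg (h0 n))]
  have i1 : Integrable (fun z => max (h n z - e * k n z) 0) m :=
    ((hint n).sub ((hk n).const_mul e)).pos_part
  have a2 : ∫ z, h n z ∂m ≤ ∫ z, (max (h n z - e * k n z) 0 + e * k n z) ∂m := by
    refine integral_mono (hint n) (i1.add ((hk n).const_mul e)) fun z => ?_
    have := le_max_left (h n z - e * k n z) 0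
    simp only
    linarith
  rw [integral_add i1 ((hk n).const_mul e), integral_const_mul] at a2
  have := mul_le_mul_of_nonneg_left (hK n) he0.le
  linarith

def jp (P t : ℝ) : ℝ := |t| ^ (P - 2) * t

lemma abs_jp {P : ℝ} (hP : 1 < P) (t : ℝ) : |jp P t| = |t| ^ (P - 1) := by
  unfold jp
  rcases eq_or_ne t 0 with rfl | ht
  · rw [mul_zero, abs_zero, Real.zero_rpow (by linarith)]
  · have : 0 < |t| := abs_pos.2 ht
    rw [abs_mul, abs_of_nonneg (Real.rpow_nonneg (abs_nonneg t) _)]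
    nth_rewrite 2 [← Real.rpow_one |t|]
    rw [← Real.rpow_add this]; congr 1; ring

lemma jp_neg (P t : ℝ) : jp P (-t) = - jp P t := by simp [jp]

lemma jp_mul_self {P : ℝ} (hP : 1 < P) (t : ℝ) : jp P t * t = |t| ^ P := by
  unfold jp
  rcases eq_or_ne t 0 with rfl | ht
  · rw [mul_zero, abs_zero, Real.zero_rpow (by linarith)]
  · have : 0 < |t| := abs_pos.2 ht
    rw [mul_assoc, ← abs_mul_abs_self, ← sq, ← Real.rpow_natCast, ← Real.rpow_add this]
    congr 1; push_cast; ring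

lemma jp_smul {P c : ℝ} (hc : 0 < c) (t : ℝ) : jp P (c * t) = c ^ (P - 1) * jp P t := by
  unfold jp
  rw [abs_mul, abs_of_pos hc, Real.mul_rpow hc.le (abs_nonneg _)]
  have : c ^ (P - 1) = c ^ (P - 2) * c := by
    nth_rewrite 3 [← Real.rpow_one c]
    rw [← Real.rpow_add hc]; congr 1; ring
  rw [this]; ring

lemma jp_continuous {P : ℝ} (hP : 1 < P) : Continuous (jp P) := by
  rw [continuous_iff_continuousAt]
  intro t
  rcases eq_or_ne t 0 with rfl | ht
  · unfold ContinuousAt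
    have h0 : jp P 0 = 0 := by simp [jp]
    rw [h0, tendsto_zero_iff_abs_tendsto_zero]
    have : (abs ∘ jp P) = fun t => |t| ^ (P - 1) := by ext t; exact abs_jp hP t
    rw [this]
    have h1 : Continuous fun t : ℝ => |t| ^ (P - 1) :=
      continuous_abs.rpow_const fun _ => Or.inr (by linarith)
    simpa [Real.zero_rpow (by linarith : P - 1 ≠ 0)] using h1.tendsto 0
  · exact (continuous_abs.continuousAt.rpow_const (Or.inl (abs_ne_zero.2 ht))).mul continuousAt_id

lemma jp_cont_joint {P1 P2 : ℝ} (h1 : 1 < P1) :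
    ContinuousOn (fun z : ℝ × ℝ => jp z.1 z.2) (Icc P1 P2 ×ˢ univ) := by
  intro z hz
  rcases eq_or_ne z.2 0 with h0 | ht
  · have hz1 : P1 ≤ z.1 := hz.1.1
    unfold ContinuousWithinAt
    have h00 : jp z.1 z.2 = 0 := by simp [jp, h0]
    simp only [h00]
    rw [tendsto_zero_iff_abs_tendsto_zero]
    have h2 : ContinuousAt (fun z : ℝ × ℝ => |z.2| ^ (z.1 - 1)) z := by
      refine ContinuousAt.rpow (by fun_prop) (by fun_prop) (Or.inr (by linarith))
    have h3 := h2.continuousWithinAt (s := Icc P1 P2 ×ˢ univ)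
    unfold ContinuousWithinAt at h3
    simp only [h0] at h3
    rw [abs_zero, Real.zero_rpow (by linarith)] at h3
    refine h3.congr' ?_
    filter_upwards [self_mem_nhdsWithin] with y hy
    exact (abs_jp (h1.trans_le hy.1.1) y.2).symm
  · refine ContinuousAt.continuousWithinAt ?_
    have e1 : ContinuousAt (fun z : ℝ × ℝ => |z.2| ^ (z.1 - 2)) z :=
      ContinuousAt.rpow (by fun_prop) (by fun_prop) (Or.inl (abs_ne_zero.2 ht))
    exact e1.mul continuousAt_snd

lemma abs_rpow_joint {P1 P2 : ℝ} (h1 : 0 < P1) :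
    ContinuousOn (fun z : ℝ × ℝ => |z.2| ^ z.1) (Icc P1 P2 ×ˢ univ) := by
  intro z hz
  refine ContinuousAt.continuousWithinAt ?_
  exact ContinuousAt.rpow (by fun_prop) (by fun_prop) (Or.inr (h1.trans_le hz.1.1))

/-- homogeneous modulus of continuity -/
lemma homog_mod {φ : ℝ → ℝ → ℝ} {e : ℝ → ℝ} {P1 P2 D : ℝ}
    (hc : ContinuousOn (fun z : ℝ × ℝ => φ z.1 z.2) (Icc P1 P2 ×ˢ univ))
    (he : ∀ P ∈ Icc P1 P2, 0 ≤ e P ∧ e P ≤ D)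
    (hh : ∀ P ∈ Icc P1 P2, ∀ c t, 0 < c → φ P (c * t) = c ^ e P * φ P t)
    {ε : ℝ} (hε : 0 < ε) :
    ∃ C, 0 ≤ C ∧ ∀ P ∈ Icc P1 P2, ∀ a c,
      |φ P c - φ P a| ≤ ε * (|a| + |c|) ^ e P + C * |c - a| ^ e P := by
  have hcomp : IsCompact (Icc P1 P2 ×ˢ Icc (-1 : ℝ) 1) := isCompact_Icc.prod isCompact_Icc
  have hc' := hc.mono (prod_mono_right (subset_univ (Icc (-1 : ℝ) 1)))
  have huc := hcomp.uniformContinuousOn_of_continuous hc'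
  obtain ⟨B, hB⟩ := hcomp.exists_bound_of_continuousOn hc'
  rw [Metric.uniformContinuousOn_iff] at huc
  obtain ⟨η0, hη0, hη⟩ := huc ε hε
  set η := min η0 1 / 2 with hηd
  have hη1 : 0 < η := by positivity
  have hηle : η ≤ 1 := by have := min_le_right η0 1; linarith
  have hηlt : η < η0 := by have := min_le_left η0 1; have : 0 < min η0 1 := by positivity
                           linarith
  refine ⟨2 * |B| * (η⁻¹) ^ D, by positivity, fun P hP a c => ?_⟩
  obtain ⟨e0, eD⟩ := he P hP
  rcases eq_or_ne (|a| + |c|) 0 with h0 | h0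
  · have ha : a = 0 := by
      rw [← abs_eq_zero]; have := abs_nonneg a; have := abs_nonneg c; linarith
    have hcz : c = 0 := by
      rw [← abs_eq_zero]; have := abs_nonneg a; have := abs_nonneg c; linarith
    subst ha hcz
    simp only [sub_self, abs_zero]
    have : 0 ≤ (0:ℝ) ^ e P := Real.rpow_nonneg le_rfl _
    positivity
  set M := |a| + |c| with hM
  have hMp : 0 < M := lt_of_le_of_ne (by positivity) (Ne.symm h0)
  have ha1 : a / M ∈ Icc (-1 : ℝ) 1 := by
    rw [mem_Icc, ← abs_le, abs_div, abs_of_pos hMp, div_le_one hMp]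
    have := abs_nonneg c; linarith
  have hc1 : c / M ∈ Icc (-1 : ℝ) 1 := by
    rw [mem_Icc, ← abs_le, abs_div, abs_of_pos hMp, div_le_one hMp]
    have := abs_nonneg a; linarith
  have ea : φ P a = M ^ e P * φ P (a / M) := by
    rw [← hh P hP M _ hMp, mul_div_cancel₀ _ h0]
  have ec : φ P c = M ^ e P * φ P (c / M) := by
    rw [← hh P hP M _ hMp, mul_div_cancel₀ _ h0]
  have hMe : 0 ≤ M ^ e P := by positivity
  rw [ea, ec, ← mul_sub, abs_mul, abs_of_nonneg hMe]
  by_cases hd : |c - a| ≤ η * M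
  · have := hη (P, a / M) ⟨hP, ha1⟩ (P, c / M) ⟨hP, hc1⟩ (by
      rw [Prod.dist_eq, dist_self, Real.dist_eq, max_lt_iff]
      refine ⟨hη0, ?_⟩
      rw [← sub_div, abs_div, abs_of_pos hMp, abs_sub_comm, div_lt_iff₀ hMp]
      exact hd.trans_lt (by gcongr))
    rw [Real.dist_eq, abs_sub_comm] at this
    have h2 : 0 ≤ 2 * |B| * η⁻¹ ^ D * |c - a| ^ e P := by positivity
    have h3 := mul_le_mul_of_nonneg_left this.le hMe
    simp only at h3
    linarith
  · push Not at hd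
    have h1 := hB (P, a / M) ⟨hP, ha1⟩
    have h2 := hB (P, c / M) ⟨hP, hc1⟩
    rw [Real.norm_eq_abs] at h1 h2
    simp only at h1 h2
    have h3 : |φ P (c / M) - φ P (a / M)| ≤ 2 * |B| := by
      have := abs_sub (φ P (c / M)) (φ P (a / M))
      have := le_abs_self B
      linarith
    have h4 : M ^ e P ≤ η⁻¹ ^ D * |c - a| ^ e P := by
      have h5 : M ≤ η⁻¹ * |c - a| := by
        rw [← div_eq_inv_mul, le_div_iff₀ hη1]; linarith
      calc M ^ e P ≤ (η⁻¹ * |c - a|) ^ e P := Real.rpow_le_rpow hMp.le h5 e0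
        _ = η⁻¹ ^ e P * |c - a| ^ e P := Real.mul_rpow (by positivity) (abs_nonneg _)
        _ ≤ η⁻¹ ^ D * |c - a| ^ e P := by
            gcongr
            exact (one_le_inv₀ hη1).2 hηle
    have h5 : 0 ≤ ε * M ^ e P := by positivity
    calc M ^ e P * |φ P (c / M) - φ P (a / M)| ≤ (η⁻¹ ^ D * |c - a| ^ e P) * (2 * |B|) := by
          gcongr
      _ = 2 * |B| * η⁻¹ ^ D * |c - a| ^ e P := by ring
      _ ≤ _ := by linarith

lemma pw0 {P1 P2 : ℝ} (h1 : 1 < P1) {ε : ℝ} (hε : 0 < ε) :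
    ∃ C, 0 ≤ C ∧ ∀ P ∈ Icc P1 P2, ∀ a c,
      |jp P c - jp P a| ≤ ε * (|a| + |c|) ^ (P - 1) + C * |c - a| ^ (P - 1) :=
  homog_mod (φ := jp) (e := fun P => P - 1) (D := P2 - 1) (jp_cont_joint h1)
    (fun P hP => ⟨by linarith [hP.1], by linarith [hP.2]⟩) (fun P _ c t hc => jp_smul hc t) hε

lemma pw2 {P1 P2 : ℝ} (h1 : 1 < P1) {ε : ℝ} (hε : 0 < ε) :
    ∃ C, 0 ≤ C ∧ ∀ P ∈ Icc P1 P2, ∀ a c : ℝ,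
      |(|c| ^ P - |a| ^ P)| ≤ ε * (|a| + |c|) ^ P + C * |c - a| ^ P :=
  homog_mod (φ := fun P t => |t| ^ P) (e := fun P => P) (D := P2) (abs_rpow_joint (by linarith))
    (fun P hP => ⟨by linarith [hP.1], hP.2⟩)
    (fun P _ c t hc => by rw [abs_mul, abs_of_pos hc, Real.mul_rpow hc.le (abs_nonneg _)]) hε

lemma young0 {P2 ε : ℝ} (hε : 0 < ε) (hε1 : ε ≤ 1) {P : ℝ} (hP : 1 < P) (hP2 : P ≤ P2)
    {x y : ℝ} (hx : 0 ≤ x) (hy : 0 ≤ y) :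
    x ^ (P - 1) * y ≤ ε * x ^ P + ε⁻¹ ^ P2 * y ^ P := by
  have key : ∀ z : ℝ, 0 ≤ z → z ^ P = z ^ (P - 1) * z := by
    intro z hz
    rcases hz.eq_or_lt with h | h
    · rw [← h, mul_zero, Real.zero_rpow (by linarith)]
    · nth_rewrite 3 [← Real.rpow_one z]
      rw [← Real.rpow_add h]; congr 1; ring
  by_cases h : y ≤ ε * x
  · have : x ^ (P - 1) * y ≤ x ^ (P - 1) * (ε * x) := by gcongr
    have h2 : 0 ≤ ε⁻¹ ^ P2 * y ^ P := by positivity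
    rw [key x hx]; linarith
  · push Not at h
    have hx2 : x ≤ ε⁻¹ * y := by
      rw [← div_eq_inv_mul, le_div_iff₀ hε]; linarith
    have h2 : 0 ≤ ε * x ^ P := by positivity
    have h3 : ε⁻¹ ^ (P - 1) ≤ ε⁻¹ ^ P2 :=
      Real.rpow_le_rpow_of_exponent_le ((one_le_inv₀ hε).2 hε1) (by linarith)
    have h4 : x ^ (P - 1) ≤ ε⁻¹ ^ (P - 1) * y ^ (P - 1) := by
      rw [← Real.mul_rpow (by positivity) hy]
      exact Real.rpow_le_rpow hx hx2 (by linarith)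
    calc x ^ (P - 1) * y ≤ ε⁻¹ ^ P2 * y ^ (P - 1) * y := by
          gcongr; exact h4.trans (by gcongr)
      _ = ε⁻¹ ^ P2 * y ^ P := by rw [key y hy]; ring
      _ ≤ _ := by linarith

lemma young1 {P : ℝ} (hP : 1 < P) {x y : ℝ} (hx : 0 ≤ x) (hy : 0 ≤ y) :
    x ^ (P - 1) * y ≤ x ^ P + y ^ P := by
  have := young0 (P2 := P) one_pos le_rfl hP le_rfl hx hy
  simpa using this

lemma add_rpow_le2 {P P2 : ℝ} (hP : 0 ≤ P) (hP2 : P ≤ P2) {x y : ℝ} (hx : 0 ≤ x) (hy : 0 ≤ y) :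
    (x + y) ^ P ≤ 2 ^ P2 * (x ^ P + y ^ P) := by
  have h1 : x + y ≤ 2 * max x y := by
    have := le_max_left x y; have := le_max_right x y; linarith
  have h2 : (max x y) ^ P ≤ x ^ P + y ^ P := by
    have := Real.rpow_nonneg hx P
    have := Real.rpow_nonneg hy P
    rcases max_cases x y with h | h <;> rw [h.1] <;> linarith
  calc (x + y) ^ P ≤ (2 * max x y) ^ P := Real.rpow_le_rpow (by positivity) h1 hP
    _ = 2 ^ P * (max x y) ^ P := Real.mul_rpow (by norm_num) (by positivity)
    _ ≤ 2 ^ P2 * (x ^ P + y ^ P) := by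
      gcongr
      · norm_num

lemma abs_rpow_deriv {P : ℝ} (hP : 1 < P) (t : ℝ) :
    HasDerivAt (fun t : ℝ => |t| ^ P / P) (jp P t) t := by
  have := (hasDerivAt_abs_rpow t hP).div_const P
  have e : jp P t = P * |t| ^ (P - 2) * t / P := by
    unfold jp
    field_simp
  rw [e]; exact this

lemma jp_mvt {P : ℝ} (hP : 1 < P) (a b : ℝ) :
    ∃ ξ, |ξ - a| ≤ |b| ∧ |a + b| ^ P / P - |a| ^ P / P = jp P ξ * b := by
  have hd : ∀ θ : ℝ, HasDerivAt (fun θ : ℝ => |a + θ * b| ^ P / P) (jp P (a + θ * b) * b) θ := by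
    intro θ
    have h1 : HasDerivAt (fun θ : ℝ => a + θ * b) b θ := by
      simpa using ((hasDerivAt_id θ).mul_const b).const_add a
    exact (abs_rpow_deriv hP (a + θ * b)).comp θ h1
  obtain ⟨θ, hθ, h⟩ := exists_hasDerivAt_eq_slope (fun θ : ℝ => |a + θ * b| ^ P / P) _ zero_lt_one
    (fun x _ => (hd x).continuousAt.continuousWithinAt) (fun x _ => hd x)
  refine ⟨a + θ * b, ?_, ?_⟩
  · rw [add_sub_cancel_left, abs_mul, abs_of_pos hθ.1]
    exact mul_le_of_le_one_left (abs_nonneg _) hθ.2.le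
  · rw [h]; simp

lemma pw1 {P1 P2 : ℝ} (h1 : 1 < P1) {ε : ℝ} (hε : 0 < ε) :
    ∃ C, 0 ≤ C ∧ ∀ P ∈ Icc P1 P2, ∀ a b : ℝ,
      |(|a + b| ^ P / P - |a| ^ P / P - jp P a * b)| ≤
        |b| * (ε * (2 * |a| + |b|) ^ (P - 1) + C * |b| ^ (P - 1)) := by
  obtain ⟨C, hC, h⟩ := pw0 (P2 := P2) h1 hε
  refine ⟨C, hC, fun P hP a b => ?_⟩
  have hP1 : 1 < P := h1.trans_le hP.1
  obtain ⟨ξ, hξ, e⟩ := jp_mvt hP1 a b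
  rw [e, ← sub_mul, abs_mul, mul_comm]
  gcongr
  refine (h P hP a ξ).trans ?_
  have h2 : |ξ| ≤ |a| + |b| := by
    have := abs_add_le a (ξ - a); rw [add_sub_cancel] at this; linarith
  have hPe : 0 ≤ P - 1 := by linarith
  have h5 : |a| + |ξ| ≤ 2 * |a| + |b| := by linarith
  gcongr


lemma isub3 {Z : Type*} [MeasurableSpace Z] {m : Measure Z} {f g h : Z → ℝ}
    (hf : Integrable f m) (hg : Integrable g m) (hh : Integrable h m) :
    ∫ z, (f z - g z - h z) ∂m = ∫ z, f z ∂m - ∫ z, g z ∂m - ∫ z, h z ∂m := by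
  have := integral_sub (hf.sub hg) hh
  simp only [Pi.sub_apply] at this
  rw [this, integral_sub hf hg]

section inst
variable {E : Type*} [SeminormedAddCommGroup E] [NormedSpace ℝ E]
variable {Z : Type*} [MeasurableSpace Z]

structure Inst (m : Measure Z) (P : Z → ℝ) (P1 P2 : ℝ) (T : E →ₗ[ℝ] (Z → ℝ)) : Prop where
  h1 : 1 < P1
  mP : Measurable P
  hP : ∀ z, P z ∈ Icc P1 P2
  mT : ∀ u, Measurable (T u)
  int : ∀ u, Integrable (fun z => |T u z| ^ P z) m
  bd : ∀ R, ∃ K, 0 ≤ K ∧ ∀ u : E, ‖u‖ ≤ R → ∫ z, |T u z| ^ P z ∂m ≤ K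

variable {m : Measure Z} {P : Z → ℝ} {P1 P2 : ℝ} {T : E →ₗ[ℝ] (Z → ℝ)}

namespace Inst

lemma P1' (I : Inst m P P1 P2 T) (z : Z) : 1 < P z := I.h1.trans_le (I.hP z).1

lemma mjp (I : Inst m P P1 P2 T) (u : E) : Measurable fun z => jp (P z) (T u z) := by
  unfold jp
  exact ((I.mT u).abs.pow (I.mP.sub_const 2)).mul (I.mT u)

lemma mpow (I : Inst m P P1 P2 T) (u : E) : Measurable fun z => |T u z| ^ P z := (I.mT u).abs.pow I.mP

lemma intd (I : Inst m P P1 P2 T) (u w : E) : Integrable (fun z => jp (P z) (T u z) * T w z) m := by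
  refine Integrable.mono' ((I.int u).add (I.int w))
    ((I.mjp u).mul (I.mT w)).aestronglyMeasurable (ae_of_all _ fun z => ?_)
  rw [Real.norm_eq_abs, abs_mul, abs_jp (I.P1' z)]
  exact young1 (I.P1' z) (abs_nonneg _) (abs_nonneg _)

lemma intP (I : Inst m P P1 P2 T) (u : E) : Integrable (fun z => |T u z| ^ P z / P z) m := by
  refine Integrable.mono' (I.int u) ((I.mpow u).div I.mP).aestronglyMeasurable
    (ae_of_all _ fun z => ?_)
  have h := I.P1' z
  have h0 : 0 ≤ |T u z| ^ P z := Real.rpow_nonneg (abs_nonneg _) _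
  rw [Real.norm_of_nonneg (by positivity)]
  exact div_le_self h0 h.le

end Inst

def Phi (m : Measure Z) (P : Z → ℝ) (T : E →ₗ[ℝ] (Z → ℝ)) (u : E) : ℝ :=
  ∫ z, |T u z| ^ P z / P z ∂m

def dPhi (I : Inst m P P1 P2 T) (u : E) : E →ₗ[ℝ] ℝ where
  toFun w := ∫ z, jp (P z) (T u z) * T w z ∂m
  map_add' v w := by
    rw [← integral_add (I.intd u v) (I.intd u w)]
    congr 1; ext z; simp [mul_add]
  map_smul' c w := by
    simp only [RingHom.id_apply, smul_eq_mul]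
    rw [← integral_const_mul]
    congr 1; ext z; simp; ring

lemma dPhi_apply (I : Inst m P P1 P2 T) (u w : E) :
    dPhi I u w = ∫ z, jp (P z) (T u z) * T w z ∂m := rfl

namespace Inst

lemma reg (I : Inst m P P1 P2 T) : RegF (Phi m P T) (dPhi I) := by
  constructor
  · intro R
    obtain ⟨K, hK0, hK⟩ := I.bd (max R 1)
    refine ⟨2 * K, fun u w hu hw => ?_⟩
    rw [dPhi_apply]
    calc |∫ z, jp (P z) (T u z) * T w z ∂m| ≤ ∫ z, |jp (P z) (T u z) * T w z| ∂m :=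
          abs_integral_le_integral_abs
      _ ≤ ∫ z, (|T u z| ^ P z + |T w z| ^ P z) ∂m := by
          refine integral_mono (I.intd u w).abs ((I.int u).add (I.int w)) fun z => ?_
          simp only
          rw [abs_mul, abs_jp (I.P1' z)]
          exact young1 (I.P1' z) (abs_nonneg _) (abs_nonneg _)
      _ ≤ 2 * K := by
          rw [integral_add (I.int u) (I.int w)]
          have := hK u (hu.trans (le_max_left _ _))
          have := hK w (hw.trans (le_max_right _ _))
          linarith
  · intro R ε hε
    obtain ⟨K, hK0, hK⟩ := I.bd (max R 1)
    set A : ℝ := 2 ^ P2 * (2 ^ P2 * 2) with hA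
    have hP2 : 1 < P2 ∨ IsEmpty Z := by
      rcases isEmpty_or_nonempty Z with h | ⟨⟨z⟩⟩
      · exact Or.inr h
      · exact Or.inl (I.h1.trans_le ((I.hP z).1.trans (I.hP z).2))
    set e1 := ε / (2 * ((2 ^ P2 * 2 ^ P2 + 2 ^ P2 + 1) * K + 1)) with he1
    have he10 : 0 < e1 := by positivity
    obtain ⟨C, hC0, hC⟩ := pw1 (P2 := P2) I.h1 he10
    set e2 := ε / (2 * (C * K + 1)) with he2
    have he20 : 0 < e2 := by positivity
    set τ0 := min 1 (e2 ^ (P1 - 1)⁻¹) with hτ0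
    have hτ0p : 0 < τ0 := by positivity
    refine ⟨τ0, hτ0p, fun u w hu hw τ hτ hττ => ?_⟩
    have hτ1 : τ ≤ 1 := hττ.trans (min_le_left _ _)
    have hτe : τ ^ (P1 - 1) ≤ e2 := by
      have h1 : 0 < P1 - 1 := by linarith [I.h1]
      calc τ ^ (P1 - 1) ≤ (e2 ^ (P1 - 1)⁻¹) ^ (P1 - 1) :=
            Real.rpow_le_rpow hτ (hττ.trans (min_le_right _ _)) h1.le
        _ = e2 := by rw [← Real.rpow_mul he20.le, inv_mul_cancel₀ h1.ne', Real.rpow_one]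
    have ku := hK u (hu.trans (le_max_left _ _))
    have kw := hK w (hw.trans (le_max_right _ _))
    have e : Phi m P T (u + τ • w) - Phi m P T u - τ * dPhi I u w =
        ∫ z, (|T u z + τ * T w z| ^ P z / P z - |T u z| ^ P z / P z
          - jp (P z) (T u z) * (τ * T w z)) ∂m := by
      have i1 := I.intP (u + τ • w)
      simp only [map_add, map_smul, Pi.add_apply, Pi.smul_apply, smul_eq_mul] at i1
      have i3 : Integrable (fun z => jp (P z) (T u z) * (τ * T w z)) m := by
        refine ((I.intd u w).const_mul τ).congr (ae_of_all _ fun z => ?_)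
        simp only; ring
      rw [isub3 i1 (I.intP u) i3, dPhi_apply,
        ← integral_const_mul]
      simp only [Phi, map_add, map_smul, Pi.add_apply, Pi.smul_apply, smul_eq_mul]
      congr 1
      refine integral_congr_ae (ae_of_all _ fun z => ?_)
      simp only; ring
    have pt : ∀ z, |(|T u z + τ * T w z| ^ P z / P z - |T u z| ^ P z / P z
          - jp (P z) (T u z) * (τ * T w z))| ≤ τ * ((e1 * (2 ^ P2 * 2 ^ P2)) * |T u z| ^ P z +
            (e1 * (2 ^ P2 + 1) + C * e2) * |T w z| ^ P z) := by
      intro z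
      have hp1 := I.P1' z
      have hp2 := (I.hP z).2
      refine (hC (P z) (I.hP z) (T u z) (τ * T w z)).trans ?_
      rw [abs_mul, abs_of_nonneg hτ, mul_assoc]
      refine mul_le_mul_of_nonneg_left ?_ hτ
      set x := |T u z|
      set y := |T w z|
      have hx : 0 ≤ x := abs_nonneg _
      have hy : 0 ≤ y := abs_nonneg _
      have g1 : (2 * x + τ * y) ^ (P z - 1) ≤ (2 * x + y) ^ (P z - 1) := by
        refine Real.rpow_le_rpow (by positivity) ?_ (by linarith)
        have := mul_le_of_le_one_left hy hτ1
        linarith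
      have g2 : (τ * y) ^ (P z - 1) ≤ e2 * y ^ (P z - 1) := by
        rw [Real.mul_rpow hτ hy]
        refine mul_le_mul_of_nonneg_right ?_ (by positivity)
        refine le_trans ?_ hτe
        rcases hτ.eq_or_lt with h | h
        · rw [← h, Real.zero_rpow (by linarith), Real.zero_rpow (by linarith [I.h1])]
        · exact Real.rpow_le_rpow_of_exponent_ge h hτ1 (by linarith [(I.hP z).1])
      have g3 : (2 * x + y) ^ (P z - 1) * y ≤ (2 * x + y) ^ P z + y ^ P z :=
        young1 hp1 (by positivity) hy
      have g4 : (2 * x + y) ^ P z ≤ 2 ^ P2 * ((2 * x) ^ P z + y ^ P z) :=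
        add_rpow_le2 (by linarith) hp2 (by positivity) hy
      have g5 : (2 * x) ^ P z ≤ 2 ^ P2 * x ^ P z := by
        rw [Real.mul_rpow (by norm_num) hx]
        gcongr
        norm_num
      have g6 : y ^ (P z - 1) * y = y ^ P z := by
        rcases hy.eq_or_lt with h | h
        · rw [← h, mul_zero, Real.zero_rpow (by linarith)]
        · nth_rewrite 2 [← Real.rpow_one y]
          rw [← Real.rpow_add h]; congr 1; ring
      calc y * (e1 * (2 * x + τ * y) ^ (P z - 1) + C * (τ * y) ^ (P z - 1))
          ≤ y * (e1 * (2 * x + y) ^ (P z - 1) + C * (e2 * y ^ (P z - 1))) := by gcongr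
        _ = e1 * ((2 * x + y) ^ (P z - 1) * y) + C * e2 * (y ^ (P z - 1) * y) := by ring
        _ ≤ e1 * (2 ^ P2 * (2 ^ P2 * x ^ P z + y ^ P z) + y ^ P z) + C * e2 * y ^ P z := by
            rw [g6]
            gcongr
            refine g3.trans ?_
            gcongr
            refine g4.trans ?_
            gcongr
        _ = _ := by ring
    rw [e]
    refine abs_integral_le_integral_abs.trans ?_
    have ib : Integrable (fun z => τ * ((e1 * (2 ^ P2 * 2 ^ P2)) * |T u z| ^ P z +
            (e1 * (2 ^ P2 + 1) + C * e2) * |T w z| ^ P z)) m :=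
      (((I.int u).const_mul _).add ((I.int w).const_mul _)).const_mul _
    refine (integral_mono_of_nonneg (ae_of_all _ fun z => abs_nonneg _) ib
      (ae_of_all _ pt)).trans ?_
    rw [integral_const_mul, integral_add ((I.int u).const_mul _) ((I.int w).const_mul _),
      integral_const_mul, integral_const_mul, mul_comm]
    refine mul_le_mul_of_nonneg_right ?_ hτ
    have f1 : e1 * ((2 ^ P2 * 2 ^ P2 + 2 ^ P2 + 1) * K) ≤ ε / 2 := by
      rw [he1, div_mul_eq_mul_div, div_le_div_iff₀ (by positivity) (by positivity)]
      nlinarith [mul_nonneg hε.le (by positivity : 0 ≤ ((2:ℝ) ^ P2 * 2 ^ P2 + 2 ^ P2 + 1) * K)]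
    have f2 : e2 * (C * K) ≤ ε / 2 := by
      rw [he2, div_mul_eq_mul_div, div_le_div_iff₀ (by positivity) (by positivity)]
      nlinarith [mul_nonneg hε.le (by positivity : 0 ≤ C * K)]
    calc _ ≤ e1 * (2 ^ P2 * 2 ^ P2) * K + (e1 * (2 ^ P2 + 1) + C * e2) * K := by gcongr
      _ = e1 * ((2 ^ P2 * 2 ^ P2 + 2 ^ P2 + 1) * K) + e2 * (C * K) := by ring
      _ ≤ ε := by linarith

lemma wc (I : Inst m P P1 P2 T) {u : ℕ → E} {v : E} {R : ℝ} (hu : ∀ n, ‖u n‖ ≤ R)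
    (hl : ∀ᵐ z ∂m, Tendsto (fun n => T (u n) z) atTop (𝓝 (T v z))) (w : E) :
    Tendsto (fun n => dPhi I (u n) w) atTop (𝓝 (dPhi I v w)) := by
  obtain ⟨K, hK0, hK⟩ := I.bd R
  rw [tendsto_iff_norm_sub_tendsto_zero]
  have hg : Tendsto (fun n => ∫ z, |jp (P z) (T (u n) z) - jp (P z) (T v z)| * |T w z| ∂m)
      atTop (𝓝 0) := by
    refine gdc (k := fun n z => |T (u n) z| ^ P z) (K := K) ?_ ?_ ?_ (fun n => I.int (u n))
      (fun n z => Real.rpow_nonneg (abs_nonneg _) _) (fun n => hK _ (hu n)) ?_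
    · intro n
      exact ((((I.mjp (u n)).sub (I.mjp v)).abs).mul (I.mT w).abs).aestronglyMeasurable
    · intro n z; positivity
    · filter_upwards [hl] with z hz
      have h1 := ((jp_continuous (I.P1' z)).tendsto _).comp hz
      have h2 := ((h1.sub_const (jp (P z) (T v z))).abs).mul_const |T w z|
      simpa using h2
    · intro ε hε
      set e := min ε 1 with he
      have he0 : 0 < e := by positivity
      refine ⟨fun z => e⁻¹ ^ P2 * |T w z| ^ P z + (|T v z| ^ P z + |T w z| ^ P z),
        ((I.int w).const_mul _).add ((I.int v).add (I.int w)), fun n => ae_of_all _ fun z => ?_⟩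
      have hp := I.P1' z
      have h1 := young0 he0 (min_le_right _ _) hp (I.hP z).2 (abs_nonneg (T (u n) z))
        (abs_nonneg (T w z))
      have h2 := young1 hp (abs_nonneg (T v z)) (abs_nonneg (T w z))
      have h3 : |jp (P z) (T (u n) z) - jp (P z) (T v z)| * |T w z| ≤
          |T (u n) z| ^ (P z - 1) * |T w z| + |T v z| ^ (P z - 1) * |T w z| := by
        rw [← add_mul]
        gcongr
        refine (abs_sub _ _).trans ?_
        rw [abs_jp hp, abs_jp hp]
      have h4 : e * |T (u n) z| ^ P z ≤ ε * |T (u n) z| ^ P z := by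
        gcongr; exact min_le_left _ _
      linarith
  refine squeeze_zero (fun n => norm_nonneg _) (fun n => ?_) hg
  rw [dPhi_apply, dPhi_apply, ← integral_sub (I.intd _ _) (I.intd _ _), Real.norm_eq_abs]
  refine abs_integral_le_integral_abs.trans (le_of_eq ?_)
  refine integral_congr_ae (ae_of_all _ fun z => ?_)
  simp only
  rw [← sub_mul, abs_mul]

lemma bl (I : Inst m P P1 P2 T) {u : ℕ → E} {v : E} {R : ℝ} (hu : ∀ n, ‖u n - v‖ ≤ R)
    (hl : ∀ᵐ z ∂m, Tendsto (fun n => T (u n) z) atTop (𝓝 (T v z))) :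
    Tendsto (fun n => dPhi I (u n) (u n) - dPhi I (u n - v) (u n - v)) atTop
      (𝓝 (dPhi I v v)) := by
  obtain ⟨K, hK0, hK⟩ := I.bd R
  have hd : ∀ u, dPhi I u u = ∫ z, |T u z| ^ P z ∂m := fun u =>
    integral_congr_ae (ae_of_all _ fun z => jp_mul_self (I.P1' z) _)
  simp only [hd]
  rw [tendsto_iff_norm_sub_tendsto_zero]
  have hg : Tendsto (fun n => ∫ z, |(|T (u n) z| ^ P z - |T (u n - v) z| ^ P z - |T v z| ^ P z)| ∂m)
      atTop (𝓝 0) := by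
    refine gdc (k := fun n z => |T (u n - v) z| ^ P z) (K := K) ?_ ?_ ?_ (fun n => I.int _)
      (fun n z => Real.rpow_nonneg (abs_nonneg _) _) (fun n => hK _ (hu n)) ?_
    · intro n
      exact (((I.mpow _).sub (I.mpow _)).sub (I.mpow v)).abs.aestronglyMeasurable
    · intro n z; positivity
    · filter_upwards [hl] with z hz
      have hp := I.P1' z
      have hc : Continuous fun t : ℝ => |t| ^ P z :=
        continuous_abs.rpow_const fun _ => Or.inr (by linarith)
      have h1 := (hc.tendsto _).comp hz
      have h2 := (hc.tendsto _).comp (hz.sub_const (T v z))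
      have h3 := ((h1.sub h2).sub_const (|T v z| ^ P z)).abs
      simpa [Function.comp_def, Real.zero_rpow (by linarith : P z ≠ 0)] using h3
    · intro ε hε
      set e := ε / (2 ^ P2 * 2 ^ P2 + 2 ^ P2) with he
      have he0 : 0 < e := by positivity
      obtain ⟨C, hC0, hC⟩ := pw2 (P2 := P2) I.h1 he0
      refine ⟨fun z => (e * 2 ^ P2 + C + 1) * |T v z| ^ P z, (I.int v).const_mul _,
        fun n => ae_of_all _ fun z => ?_⟩
      have hp := I.P1' z
      have h1 := hC (P z) (I.hP z) (T (u n - v) z) (T (u n) z)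
      have e1 : T (u n) z - T (u n - v) z = T v z := by simp
      have e2 : |T (u n) z| ≤ |T (u n - v) z| + |T v z| := by
        have := abs_add_le (T (u n - v) z) (T v z)
        simpa using this
      rw [e1] at h1
      set x := |T (u n - v) z|
      set y := |T v z|
      have hx : 0 ≤ x := abs_nonneg _
      have hy : 0 ≤ y := abs_nonneg _
      have h2 : (x + |T (u n) z|) ^ P z ≤ 2 ^ P2 * (2 ^ P2 * x ^ P z + y ^ P z) + 2 ^ P2 * x ^ P z := by
        calc (x + |T (u n) z|) ^ P z ≤ ((2 * x) + y) ^ P z :=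
              Real.rpow_le_rpow (by positivity) (by linarith) (by linarith)
          _ ≤ 2 ^ P2 * ((2 * x) ^ P z + y ^ P z) :=
              add_rpow_le2 (by linarith) (I.hP z).2 (by positivity) hy
          _ ≤ 2 ^ P2 * (2 ^ P2 * x ^ P z + y ^ P z) := by
              gcongr
              rw [Real.mul_rpow (by norm_num) hx]
              gcongr
              · norm_num
              · exact (I.hP z).2
          _ ≤ _ := by linarith [(by positivity : 0 ≤ (2:ℝ) ^ P2 * x ^ P z)]
      have h3 : |(|T (u n) z| ^ P z - x ^ P z - y ^ P z)| ≤
          |(|T (u n) z| ^ P z - x ^ P z)| + y ^ P z := by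
        refine (abs_sub _ _).trans ?_
        rw [abs_of_nonneg (a := y ^ P z) (by positivity)]
      have h4 : e * (x + |T (u n) z|) ^ P z ≤
          e * (2 ^ P2 * (2 ^ P2 * x ^ P z + y ^ P z) + 2 ^ P2 * x ^ P z) := by gcongr
      have h5 : e * (2 ^ P2 * 2 ^ P2 + 2 ^ P2) = ε := by
        rw [he]; field_simp
      have h6 : e * (2 ^ P2 * (2 ^ P2 * x ^ P z + y ^ P z) + 2 ^ P2 * x ^ P z) =
        ε * x ^ P z + e * 2 ^ P2 * y ^ P z := by rw [← h5]; ring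
      linarith
  refine squeeze_zero (fun n => norm_nonneg _) (fun n => ?_) hg
  rw [← isub3 (I.int _) (I.int _) (I.int _),
    Real.norm_eq_abs]
  exact abs_integral_le_integral_abs

lemma dself (I : Inst m P P1 P2 T) (u : E) : dPhi I u u = ∫ z, |T u z| ^ P z ∂m :=
    integral_congr_ae (ae_of_all _ fun z => jp_mul_self (I.P1' z) _)

lemma dneg (I : Inst m P P1 P2 T) (u w : E) : dPhi I (-u) w = - dPhi I u w := by
  rw [dPhi_apply, dPhi_apply, ← integral_neg]
  refine integral_congr_ae (ae_of_all _ fun z => ?_)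
  simp [jp_neg]

end Inst

lemma Phi_neg (u : E) : Phi m P T (-u) = Phi m P T u := by simp [Phi]

end inst


section sub
variable {E : Type*} [SeminormedAddCommGroup E] [NormedSpace ℝ E]
variable {Z : Type*} [MeasurableSpace Z]

structure SubC (m : Measure Z) (Q : Z → ℝ) (f : Z → ℝ → ℝ) : Prop where
  mf : ∀ t, Measurable fun z => f z t
  cf : ∀ z, Continuous (f z)
  odd : ∀ z t, f z (-t) = - f z t
  bd : ∀ ε > 0, ∃ G : Z → ℝ, Integrable G m ∧ (∀ z, 0 ≤ G z) ∧
    ∀ z t t', |f z t| * |t'| ≤ G z + ε * (|t| ^ Q z + |t'| ^ Q z)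

def FF (f : Z → ℝ → ℝ) (z : Z) (t : ℝ) : ℝ := ∫ τ in (0 : ℝ)..t, f z τ

variable {m : Measure Z} {P : Z → ℝ} {P1 P2 : ℝ} {T : E →ₗ[ℝ] (Z → ℝ)} {f : Z → ℝ → ℝ}

namespace SubC

lemma mcomp (S : SubC m P f) {u : Z → ℝ} (hu : Measurable u) : Measurable fun z => f z (u z) := by
  have h1 : Measurable (Function.uncurry fun (t : ℝ) (z : Z) => f z t) :=
    measurable_uncurry_of_continuous_of_measurable (fun z => S.cf z) (fun t => S.mf t)
  exact h1.comp (hu.prodMk measurable_id)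

lemma hasDeriv (S : SubC m P f) (z : Z) (t : ℝ) : HasDerivAt (FF f z) (f z t) t :=
  intervalIntegral.integral_hasDerivAt_right ((S.cf z).intervalIntegrable _ _)
    ((S.cf z).stronglyMeasurableAtFilter _ _) (S.cf z).continuousAt

lemma mFF (S : SubC m P f) (t : ℝ) : Measurable fun z => FF f z t := by
  have h1 : Measurable (Function.uncurry fun (t : ℝ) (z : Z) => f z t) :=
    measurable_uncurry_of_continuous_of_measurable (fun z => S.cf z) (fun t => S.mf t)
  have h2 : StronglyMeasurable (fun z : Z × ℝ => f z.1 z.2) :=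
    (h1.comp measurable_swap).stronglyMeasurable
  unfold FF
  simp only [intervalIntegral]
  exact (h2.integral_prod_right' (ν := volume.restrict (Ioc 0 t))).measurable.sub
    (h2.integral_prod_right' (ν := volume.restrict (Ioc t 0))).measurable

lemma mFcomp (S : SubC m P f) {u : Z → ℝ} (hu : Measurable u) :
    Measurable fun z => FF f z (u z) := by
  have h1 : Measurable (Function.uncurry fun (t : ℝ) (z : Z) => FF f z t) :=
    measurable_uncurry_of_continuous_of_measurable
      (fun z => continuous_iff_continuousAt.2 fun t => (S.hasDeriv z t).continuousAt)
      (fun t => S.mFF t)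
  exact h1.comp (hu.prodMk measurable_id)

lemma mvt (S : SubC m P f) (z : Z) (a b : ℝ) :
    ∃ ξ, |ξ - a| ≤ |b| ∧ FF f z (a + b) - FF f z a = f z ξ * b := by
  have hd : ∀ θ : ℝ, HasDerivAt (fun θ : ℝ => FF f z (a + θ * b)) (f z (a + θ * b) * b) θ := by
    intro θ
    have h1 : HasDerivAt (fun θ : ℝ => a + θ * b) b θ := by
      simpa using ((hasDerivAt_id θ).mul_const b).const_add a
    exact (S.hasDeriv z (a + θ * b)).comp θ h1
  obtain ⟨θ, hθ, h⟩ := exists_hasDerivAt_eq_slope (fun θ : ℝ => FF f z (a + θ * b)) _ zero_lt_one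
    (fun x _ => (hd x).continuousAt.continuousWithinAt) (fun x _ => hd x)
  refine ⟨a + θ * b, ?_, ?_⟩
  · rw [add_sub_cancel_left, abs_mul, abs_of_pos hθ.1]
    exact mul_le_of_le_one_left (abs_nonneg _) hθ.2.le
  · rw [h]; simp

lemma FF0 (z : Z) : FF f z 0 = 0 := by simp [FF]

lemma FFneg (S : SubC m P f) (z : Z) (t : ℝ) : FF f z (-t) = FF f z t := by
  unfold FF
  have := intervalIntegral.integral_comp_neg (a := 0) (b := t) (fun τ => f z τ)
  simp only [S.odd, neg_zero, intervalIntegral.integral_neg] at this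
  rw [intervalIntegral.integral_symm, ← this, neg_neg]

lemma FFbd (S : SubC m P f) (hP : ∀ z, 0 ≤ P z) {ε : ℝ} (hε : 0 < ε) :
    ∃ G : Z → ℝ, Integrable G m ∧ (∀ z, 0 ≤ G z) ∧
    ∀ z t, |FF f z t| ≤ G z + ε * |t| ^ P z := by
  obtain ⟨G, hG, hG0, h⟩ := S.bd (ε / 2) (by positivity)
  refine ⟨G, hG, hG0, fun z t => ?_⟩
  obtain ⟨ξ, h1, h2⟩ := S.mvt z 0 t
  rw [FF0, sub_zero, zero_add] at h2
  rw [h2, abs_mul]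
  refine (h z ξ t).trans ?_
  rw [sub_zero] at h1
  have := Real.rpow_le_rpow (abs_nonneg _) h1 (hP z)
  have : ε / 2 * (|ξ| ^ P z + |t| ^ P z) ≤ ε / 2 * (|t| ^ P z + |t| ^ P z) := by gcongr
  linarith

lemma intd (S : SubC m P f) (I : Inst m P P1 P2 T) (u w : E) :
    Integrable (fun z => f z (T u z) * T w z) m := by
  obtain ⟨G, hG, hG0, h⟩ := S.bd 1 one_pos
  refine Integrable.mono' (hG.add (((I.int u).add (I.int w)).const_mul 1))
    ((S.mcomp (I.mT u)).mul (I.mT w)).aestronglyMeasurable (ae_of_all _ fun z => ?_)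
  rw [Real.norm_eq_abs, abs_mul]
  exact h z _ _

lemma intF (S : SubC m P f) (I : Inst m P P1 P2 T) (u : E) :
    Integrable (fun z => FF f z (T u z)) m := by
  obtain ⟨G, hG, hG0, h⟩ := S.FFbd (fun z => by linarith [I.P1' z]) one_pos
  refine Integrable.mono' (hG.add ((I.int u).const_mul 1))
    (S.mFcomp (I.mT u)).aestronglyMeasurable (ae_of_all _ fun z => ?_)
  exact h z _

end SubC

def Psi (m : Measure Z) (f : Z → ℝ → ℝ) (T : E →ₗ[ℝ] (Z → ℝ)) (u : E) : ℝ :=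
  ∫ z, FF f z (T u z) ∂m

def dPsi (S : SubC m P f) (I : Inst m P P1 P2 T) (u : E) : E →ₗ[ℝ] ℝ where
  toFun w := ∫ z, f z (T u z) * T w z ∂m
  map_add' v w := by
    rw [← integral_add (S.intd I u v) (S.intd I u w)]
    congr 1; ext z; simp [mul_add]
  map_smul' c w := by
    simp only [RingHom.id_apply, smul_eq_mul]
    rw [← integral_const_mul]
    congr 1; ext z; simp; ring

lemma dPsi_apply (S : SubC m P f) (I : Inst m P P1 P2 T) (u w : E) :
    dPsi S I u w = ∫ z, f z (T u z) * T w z ∂m := rfl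

namespace SubC

lemma wc2 (S : SubC m P f) (I : Inst m P P1 P2 T) {u w : ℕ → E} {v y : E} {R : ℝ}
    (hu : ∀ n, ‖u n‖ ≤ R) (hw : ∀ n, ‖w n‖ ≤ R)
    (hl : ∀ᵐ z ∂m, Tendsto (fun n => T (u n) z) atTop (𝓝 (T v z)))
    (hl' : ∀ᵐ z ∂m, Tendsto (fun n => T (w n) z) atTop (𝓝 (T y z))) :
    Tendsto (fun n => dPsi S I (u n) (w n)) atTop (𝓝 (dPsi S I v y)) := by
  obtain ⟨K, hK0, hK⟩ := I.bd R
  rw [tendsto_iff_norm_sub_tendsto_zero]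
  have hg : Tendsto (fun n => ∫ z, |f z (T (u n) z) * T (w n) z - f z (T v z) * T y z| ∂m)
      atTop (𝓝 0) := by
    refine gdc (k := fun n z => |T (u n) z| ^ P z + |T (w n) z| ^ P z) (K := 2 * K) ?_ ?_ ?_
      (fun n => (I.int (u n)).add (I.int (w n)))
      (fun n z => by positivity) ?_ ?_
    · intro n
      exact ((S.intd I _ _).sub (S.intd I v y)).abs.aestronglyMeasurable
    · intro n z; positivity
    · filter_upwards [hl, hl'] with z hz hz'
      have h1 := (((S.cf z).tendsto _).comp hz).mul hz'
      have h2 := (h1.sub_const (f z (T v z) * T y z)).abs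
      simpa using h2
    · intro n
      rw [integral_add (I.int _) (I.int _)]
      linarith [hK _ (hu n), hK _ (hw n)]
    · intro ε hε
      obtain ⟨G, hG, hG0, h⟩ := S.bd ε hε
      refine ⟨fun z => G z + |f z (T v z) * T y z|, hG.add (S.intd I v y).abs,
        fun n => ae_of_all _ fun z => ?_⟩
      have h1 := h z (T (u n) z) (T (w n) z)
      rw [← abs_mul] at h1
      have := abs_sub (f z (T (u n) z) * T (w n) z) (f z (T v z) * T y z)
      linarith
  refine squeeze_zero (fun n => norm_nonneg _) (fun n => ?_) hg
  rw [dPsi_apply, dPsi_apply, ← integral_sub (S.intd I _ _) (S.intd I _ _), Real.norm_eq_abs]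
  exact abs_integral_le_integral_abs

lemma psi_cont (S : SubC m P f) (I : Inst m P P1 P2 T) {u : ℕ → E} {v : E} {R : ℝ}
    (hu : ∀ n, ‖u n‖ ≤ R)
    (hl : ∀ᵐ z ∂m, Tendsto (fun n => T (u n) z) atTop (𝓝 (T v z))) :
    Tendsto (fun n => Psi m f T (u n)) atTop (𝓝 (Psi m f T v)) := by
  obtain ⟨K, hK0, hK⟩ := I.bd R
  rw [tendsto_iff_norm_sub_tendsto_zero]
  have hg : Tendsto (fun n => ∫ z, |FF f z (T (u n) z) - FF f z (T v z)| ∂m)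
      atTop (𝓝 0) := by
    refine gdc (k := fun n z => |T (u n) z| ^ P z) (K := K) ?_ ?_ ?_
      (fun n => I.int (u n)) (fun n z => by positivity) (fun n => hK _ (hu n)) ?_
    · intro n
      exact ((S.intF I _).sub (S.intF I v)).abs.aestronglyMeasurable
    · intro n z; positivity
    · filter_upwards [hl] with z hz
      have h1 := (S.hasDeriv z (T v z)).continuousAt.tendsto.comp hz
      have h2 := (h1.sub_const (FF f z (T v z))).abs
      simpa using h2
    · intro ε hε
      obtain ⟨G, hG, hG0, h⟩ := S.FFbd (fun z => by linarith [I.P1' z]) hε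
      refine ⟨fun z => G z + |FF f z (T v z)|, hG.add (S.intF I v).abs,
        fun n => ae_of_all _ fun z => ?_⟩
      have h1 := h z (T (u n) z)
      have := abs_sub (FF f z (T (u n) z)) (FF f z (T v z))
      linarith
  refine squeeze_zero (fun n => norm_nonneg _) (fun n => ?_) hg
  unfold Psi
  rw [← integral_sub (S.intF I _) (S.intF I _), Real.norm_eq_abs]
  exact abs_integral_le_integral_abs

lemma reg (S : SubC m P f) (I : Inst m P P1 P2 T)
    (hc : ∀ (u : ℕ → E) (R : ℝ), (∀ n, ‖u n‖ ≤ R) → ∃ φ : ℕ → ℕ, StrictMono φ ∧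
      ∃ a : Z → ℝ, ∀ᵐ z ∂m, Tendsto (fun n => T (u (φ n)) z) atTop (𝓝 (a z))) :
    RegF (Psi m f T) (dPsi S I) := by
  constructor
  · intro R
    obtain ⟨K, hK0, hK⟩ := I.bd (max R 1)
    obtain ⟨G, hG, hG0, h⟩ := S.bd 1 one_pos
    refine ⟨∫ z, G z ∂m + 2 * K, fun u w hu hw => ?_⟩
    rw [dPsi_apply]
    calc |∫ z, f z (T u z) * T w z ∂m| ≤ ∫ z, |f z (T u z) * T w z| ∂m :=
          abs_integral_le_integral_abs
      _ ≤ ∫ z, (G z + (|T u z| ^ P z + |T w z| ^ P z)) ∂m := by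
          refine integral_mono (S.intd I u w).abs (hG.add ((I.int u).add (I.int w))) fun z => ?_
          have := h z (T u z) (T w z)
          simp only
          rw [abs_mul]; linarith
      _ ≤ _ := by
          have i2 : Integrable (fun z => |T u z| ^ P z + |T w z| ^ P z) m := (I.int u).add (I.int w)
          rw [integral_add hG i2, integral_add (I.int u) (I.int w)]
          have := hK u (hu.trans (le_max_left _ _))
          have := hK w (hw.trans (le_max_right _ _))
          linarith
  · intro R ε hε
    by_contra hcon
    push Not at hcon
    have hcon' : ∀ n : ℕ, ∃ (u w : E) (τ : ℝ), ‖u‖ ≤ R ∧ ‖w‖ ≤ 1 ∧ 0 ≤ τ ∧ τ ≤ 1 / ((n : ℝ) + 1) ∧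
        ε * τ < |Psi m f T (u + τ • w) - Psi m f T u - τ * dPsi S I u w| := by
      intro n
      obtain ⟨u, w, h1, h2, τ, h3, h4, h5⟩ := hcon (1 / ((n : ℝ) + 1)) (by positivity)
      exact ⟨u, w, τ, h1, h2, h3, h4, h5⟩
    choose u w τ hu hw hτ0 hτ1 hlt using hcon'
    have hτp : ∀ n, 0 < τ n := by
      intro n
      refine lt_of_le_of_ne (hτ0 n) fun h => ?_
      have := hlt n
      rw [← h] at this
      simp at this
    obtain ⟨φ1, hφ1, a, ha⟩ := hc u R hu
    obtain ⟨φ2, hφ2, b, hb⟩ := hc (w ∘ φ1) 1 (fun n => hw _)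
    have hs : StrictMono (φ1 ∘ φ2) := hφ1.comp hφ2
    set φ := φ1 ∘ φ2 with hφ
    obtain ⟨K, hK0, hK⟩ := I.bd (max R 1)
    have hτt : Tendsto (fun n => τ (φ n)) atTop (𝓝 0) := by
      have h1 : Tendsto τ atTop (𝓝 0) :=
        squeeze_zero hτ0 hτ1 tendsto_one_div_add_atTop_nhds_zero_nat
      exact h1.comp hs.tendsto_atTop
    have hτle : ∀ n, τ n ≤ 1 := fun n => (hτ1 n).trans (by
      rw [div_le_one (by positivity)]; linarith [(Nat.cast_nonneg n : (0:ℝ) ≤ n)])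
    have key : ∀ n z, ∃ ξ, |ξ - T (u n) z| ≤ τ n * |T (w n) z| ∧
        |(FF f z (T (u n) z + τ n * T (w n) z) - FF f z (T (u n) z)
          - τ n * (f z (T (u n) z) * T (w n) z))| / τ n
          = |f z ξ - f z (T (u n) z)| * |T (w n) z| := by
      intro n z
      obtain ⟨ξ, h1, h2⟩ := S.mvt z (T (u n) z) (τ n * T (w n) z)
      refine ⟨ξ, ?_, ?_⟩
      · rwa [abs_mul, abs_of_pos (hτp n)] at h1
      · rw [h2]
        have : f z ξ * (τ n * T (w n) z) - τ n * (f z (T (u n) z) * T (w n) z) =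
          τ n * ((f z ξ - f z (T (u n) z)) * T (w n) z) := by ring
        rw [this, abs_mul, abs_of_pos (hτp n), mul_div_cancel_left₀ _ (hτp n).ne', abs_mul]
    have iR : ∀ n, Integrable (fun z => FF f z (T (u n) z + τ n * T (w n) z) - FF f z (T (u n) z)
          - τ n * (f z (T (u n) z) * T (w n) z)) m ∧
        Psi m f T (u n + τ n • w n) - Psi m f T (u n) - τ n * dPsi S I (u n) (w n) =
        ∫ z, (FF f z (T (u n) z + τ n * T (w n) z) - FF f z (T (u n) z)
          - τ n * (f z (T (u n) z) * T (w n) z)) ∂m := by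
      intro n
      have i1 := S.intF I (u n + τ n • w n)
      simp only [map_add, map_smul, Pi.add_apply, Pi.smul_apply, smul_eq_mul] at i1
      have i3 := (S.intd I (u n) (w n)).const_mul (τ n)
      refine ⟨(i1.sub (S.intF I (u n))).sub i3, ?_⟩
      rw [isub3 i1 (S.intF I (u n)) i3, dPsi_apply, integral_const_mul]
      simp only [Psi, map_add, map_smul, Pi.add_apply, Pi.smul_apply, smul_eq_mul]
    have hg : Tendsto (fun n => ∫ z, |(FF f z (T (u (φ n)) z + τ (φ n) * T (w (φ n)) z)
          - FF f z (T (u (φ n)) z)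
          - τ (φ n) * (f z (T (u (φ n)) z) * T (w (φ n)) z))| / τ (φ n) ∂m) atTop (𝓝 0) := by
      refine gdc (k := fun n z => |T (u (φ n)) z| ^ P z + |T (w (φ n)) z| ^ P z) (K := 2 * K)
        ?_ ?_ ?_ (fun n => (I.int _).add (I.int _)) (fun n z => by positivity) ?_ ?_
      · intro n
        exact ((iR (φ n)).1.abs.div_const _).aestronglyMeasurable
      · intro n z
        exact div_nonneg (abs_nonneg _) (hτ0 _)
      · filter_upwards [ha, hb] with z hz hz'
        choose ξ hξ1 hξ2 using fun n => key n z
        simp only [hξ2]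
        have t1 : Tendsto (fun n => T (u (φ n)) z) atTop (𝓝 (a z)) :=
          hz.comp hφ2.tendsto_atTop
        have t2 : Tendsto (fun n => T (w (φ n)) z) atTop (𝓝 (b z)) := hz'
        have t3 : Tendsto (fun n => ξ (φ n) - T (u (φ n)) z) atTop (𝓝 0) := by
          refine squeeze_zero_norm (fun n => hξ1 (φ n)) ?_
          simpa using hτt.mul t2.abs
        have t4 : Tendsto (fun n => ξ (φ n)) atTop (𝓝 (a z)) := by
          simpa using t3.add t1
        have t5 := (((((S.cf z).tendsto _).comp t4).sub (((S.cf z).tendsto _).comp t1)).abs).mul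
          t2.abs
        simpa using t5
      · intro n
        rw [integral_add (I.int _) (I.int _)]
        have := hK _ ((hu (φ n)).trans (le_max_left _ _))
        have := hK _ ((hw (φ n)).trans (le_max_right _ _))
        linarith
      · intro e he
        obtain ⟨G, hG, hG0, h⟩ := S.bd (e / (2 ^ P2 + 2)) (by positivity)
        refine ⟨fun z => 2 * G z, hG.const_mul 2, fun n => ae_of_all _ fun z => ?_⟩
        obtain ⟨ξ, h1, h2⟩ := key (φ n) z
        simp only
        rw [h2]
        have hp := I.P1' z
        set x := |T (u (φ n)) z|
        set y := |T (w (φ n)) z|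
        have hx : 0 ≤ x := abs_nonneg _
        have hy : 0 ≤ y := abs_nonneg _
        have h3 : |ξ| ≤ x + y := by
          have e1 := abs_add_le (T (u (φ n)) z) (ξ - T (u (φ n)) z)
          rw [add_sub_cancel] at e1
          have e2 := mul_le_of_le_one_left hy (hτle (φ n))
          linarith
        have h4 : |ξ| ^ P z ≤ 2 ^ P2 * (x ^ P z + y ^ P z) :=
          (Real.rpow_le_rpow (abs_nonneg _) h3 (by linarith)).trans
            (add_rpow_le2 (by linarith) (I.hP z).2 hx hy)
        have h5 : |f z ξ - f z (T (u (φ n)) z)| * y ≤ |f z ξ| * y + |f z (T (u (φ n)) z)| * y := by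
          rw [← add_mul]; gcongr; exact abs_sub _ _
        have h6 := h z ξ (T (w (φ n)) z)
        have h7 := h z (T (u (φ n)) z) (T (w (φ n)) z)
        set c := e / (2 ^ P2 + 2) with hcdef
        have hc0 : 0 < c := by positivity
        have h8 : c * (|ξ| ^ P z + y ^ P z) ≤ c * (2 ^ P2 * (x ^ P z + y ^ P z) + (x ^ P z + y ^ P z)) := by
          gcongr
          linarith [Real.rpow_nonneg hx (P z)]
        have h9 : c * (2 ^ P2 + 2) = e := by rw [hcdef]; field_simp
        have h10 : c * (2 ^ P2 * (x ^ P z + y ^ P z) + (x ^ P z + y ^ P z)) + c * (x ^ P z + y ^ P z)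
          = e * (x ^ P z + y ^ P z) := by rw [← h9]; ring
        linarith
    have hge : ∀ n, ε ≤ ∫ z, |(FF f z (T (u (φ n)) z + τ (φ n) * T (w (φ n)) z)
          - FF f z (T (u (φ n)) z)
          - τ (φ n) * (f z (T (u (φ n)) z) * T (w (φ n)) z))| / τ (φ n) ∂m := by
      intro n
      have h1 := hlt (φ n)
      rw [(iR (φ n)).2] at h1
      rw [integral_div, le_div_iff₀ (hτp _)]
      exact h1.le.trans abs_integral_le_integral_abs
    have := ge_of_tendsto' hg hge
    linarith

lemma dneg (S : SubC m P f) (I : Inst m P P1 P2 T) (u w : E) :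
    dPsi S I (-u) w = - dPsi S I u w := by
  rw [dPsi_apply, dPsi_apply, ← integral_neg]
  refine integral_congr_ae (ae_of_all _ fun z => ?_)
  simp [S.odd]

lemma neg (S : SubC m P f) (u : E) : Psi m f T (-u) = Psi m f T u := by
  simp [Psi, S.FFneg]

end SubC
end sub


section reg
variable {E : Type*} [SeminormedAddCommGroup E] [NormedSpace ℝ E]
lemma RegF.add {J K : E → ℝ} {dJ dK : E → E →ₗ[ℝ] ℝ} (h : RegF J dJ) (k : RegF K dK) :
    RegF (fun u => J u + K u) (fun u => dJ u + dK u) := by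
  constructor
  · intro R
    obtain ⟨C, hC⟩ := h.U1 R
    obtain ⟨D, hD⟩ := k.U1 R
    refine ⟨C + D, fun u w hu hw => ?_⟩
    exact (abs_add_le _ _).trans (add_le_add (hC u w hu hw) (hD u w hu hw))
  · intro R ε hε
    obtain ⟨t, ht, h1⟩ := h.U2 R (ε / 2) (by positivity)
    obtain ⟨t', ht', h2⟩ := k.U2 R (ε / 2) (by positivity)
    refine ⟨min t t', by positivity, fun u w hu hw τ hτ hττ => ?_⟩
    have a := h1 u w hu hw τ hτ (hττ.trans (min_le_left _ _))
    have b := h2 u w hu hw τ hτ (hττ.trans (min_le_right _ _))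
    have e : J (u + τ • w) + K (u + τ • w) - (J u + K u) - τ * (dJ u + dK u) w =
      (J (u + τ • w) - J u - τ * dJ u w) + (K (u + τ • w) - K u - τ * dK u w) := by
      rw [LinearMap.add_apply]; ring
    rw [e]
    refine (abs_add_le _ _).trans ?_
    linarith

lemma RegF.smul {J : E → ℝ} {dJ : E → E →ₗ[ℝ] ℝ} (h : RegF J dJ) (c : ℝ) :
    RegF (fun u => c * J u) (fun u => c • dJ u) := by
  constructor
  · intro R
    obtain ⟨C, hC⟩ := h.U1 R
    refine ⟨|c| * C, fun u w hu hw => ?_⟩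
    rw [LinearMap.smul_apply, smul_eq_mul, abs_mul]
    exact mul_le_mul_of_nonneg_left (hC u w hu hw) (abs_nonneg _)
  · intro R ε hε
    obtain ⟨t, ht, h1⟩ := h.U2 R (ε / (|c| + 1)) (by positivity)
    refine ⟨t, ht, fun u w hu hw τ hτ hττ => ?_⟩
    have a := h1 u w hu hw τ hτ hττ
    have e : c * J (u + τ • w) - c * J u - τ * (c • dJ u) w =
      c * (J (u + τ • w) - J u - τ * dJ u w) := by
      rw [LinearMap.smul_apply, smul_eq_mul]; ring
    rw [e, abs_mul]
    calc |c| * |J (u + τ • w) - J u - τ * dJ u w| ≤ (|c| + 1) * (ε / (|c| + 1) * τ) := by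
          gcongr
          linarith
      _ = ε * τ := by field_simp

lemma pow_bound {P c0 c1 : ℝ} (hP : 1 < P) (h0 : 0 ≤ c0) (h1 : 0 ≤ c1) :
    ∃ R, ∀ x : ℝ, 0 ≤ x → x ^ P ≤ c0 + c1 * x → x ≤ R := by
  have ht := tendsto_rpow_atTop (by linarith : 0 < P - 1)
  obtain ⟨R, hR⟩ := (ht.eventually (eventually_gt_atTop (c0 + c1))).exists_forall_of_atTop
  refine ⟨max R 1, fun x hx hle => ?_⟩
  by_contra hlt
  push Not at hlt
  obtain ⟨hxR, hx1⟩ := max_lt_iff.1 hlt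
  have h2 := hR x hxR.le
  have h3 : x ^ P = x ^ (P - 1) * x := by
    nth_rewrite 3 [← Real.rpow_one x]
    rw [← Real.rpow_add (by linarith)]; congr 1; ring
  rw [h3] at hle
  have : (c0 + c1) * x < x ^ (P - 1) * x := by gcongr
  nlinarith
end reg

section JJ
variable {E : Type*} [SeminormedAddCommGroup E] [NormedSpace ℝ E]
variable {Z1 Z : Type*} [MeasurableSpace Z1] [MeasurableSpace Z]
variable {m1 : Measure Z1} {m : Measure Z} {P : Z1 → ℝ} {a1 pb : ℝ} {D : E →ₗ[ℝ] (Z1 → ℝ)}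
  {T : E →ₗ[ℝ] (Z → ℝ)} {q : Z → ℝ} {qm qS : ℝ} {f : Z → ℝ → ℝ}

def JJ (m1 : Measure Z1) (P : Z1 → ℝ) (D : E →ₗ[ℝ] (Z1 → ℝ)) (m : Measure Z) (pb : ℝ) (q : Z → ℝ)
    (f : Z → ℝ → ℝ) (T : E →ₗ[ℝ] (Z → ℝ)) (l : ℝ) (u : E) : ℝ :=
  Phi m1 P D u + Phi m (fun _ => pb) T u + (-1) * Psi m f T u + (-l) * Phi m q T u

def dJJ (I1 : Inst m1 P a1 pb D) (I0 : Inst m (fun _ => pb) pb pb T) (Iq : Inst m q qm qS T)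
    (S : SubC m q f) (l : ℝ) (u : E) : E →ₗ[ℝ] ℝ :=
  dPhi I1 u + dPhi I0 u + (-1 : ℝ) • dPsi S Iq u + (-l) • dPhi Iq u

lemma dJJ_apply (I1 : Inst m1 P a1 pb D) (I0 : Inst m (fun _ => pb) pb pb T)
    (Iq : Inst m q qm qS T) (S : SubC m q f) (l : ℝ) (u w : E) :
    dJJ I1 I0 Iq S l u w = dPhi I1 u w + dPhi I0 u w - dPsi S Iq u w - l * dPhi Iq u w := by
  simp [dJJ]; ring

lemma JJ_reg (I1 : Inst m1 P a1 pb D) (I0 : Inst m (fun _ => pb) pb pb T)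
    (Iq : Inst m q qm qS T) (S : SubC m q f)
    (hc : ∀ (u : ℕ → E) (R : ℝ), (∀ n, ‖u n‖ ≤ R) → ∃ φ : ℕ → ℕ, StrictMono φ ∧
      ∃ a : Z → ℝ, ∀ᵐ z ∂m, Tendsto (fun n => T (u (φ n)) z) atTop (𝓝 (a z))) (l : ℝ) :
    RegF (JJ m1 P D m pb q f T l) (dJJ I1 I0 Iq S l) :=
  ((I1.reg.add I0.reg).add ((S.reg Iq hc).smul (-1))).add (Iq.reg.smul (-l))

lemma JJ_neg (S : SubC m q f) (l : ℝ) (u : E) :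
    JJ m1 P D m pb q f T l (-u) = JJ m1 P D m pb q f T l u := by
  simp only [JJ, Phi_neg, S.neg]

lemma JJ_zero (I1 : Inst m1 P a1 pb D) (I0 : Inst m (fun _ => pb) pb pb T)
    (Iq : Inst m q qm qS T) (l : ℝ) :
    JJ m1 P D m pb q f T l 0 = 0 := by
  have h1 : ∀ z, P z ≠ 0 := fun z => by linarith [I1.P1' z]
  have h2 : ∀ z, q z ≠ 0 := fun z => by linarith [Iq.P1' z]
  have h3 : pb ≠ 0 := by linarith [I0.h1]
  simp [JJ, Phi, Psi, SubC.FF0, Real.zero_rpow, h1, h2, h3]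

lemma dJJ_neg (I1 : Inst m1 P a1 pb D) (I0 : Inst m (fun _ => pb) pb pb T)
    (Iq : Inst m q qm qS T) (S : SubC m q f) (l : ℝ) (u w : E) :
    dJJ I1 I0 Iq S l (-u) w = - dJJ I1 I0 Iq S l u w := by
  rw [dJJ_apply, dJJ_apply, I1.dneg, I0.dneg, Iq.dneg, S.dneg]; ring

/-- comparison of `Phi` and its derivative -/
lemma Inst.phi_ge {P : Z → ℝ} {P1 P2 : ℝ} (I : Inst m P P1 P2 T) {α : ℝ} (hα : P2 ≤ α) (u : E) :
    dPhi I u u / α ≤ Phi m P T u := by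
  rw [I.dself, ← integral_div]
  refine integral_mono ((I.int u).div_const _) (I.intP u) fun z => ?_
  have h := I.P1' z
  have h2 := (I.hP z).2
  have h0 : 0 ≤ |T u z| ^ P z := Real.rpow_nonneg (abs_nonneg _) _
  exact div_le_div_of_nonneg_left h0 (by linarith) (by linarith)

lemma Inst.phi_le {P : Z → ℝ} {P1 P2 : ℝ} (I : Inst m P P1 P2 T) (u : E) :
    Phi m P T u ≤ dPhi I u u / P1 := by
  rw [I.dself, ← integral_div]
  refine integral_mono (I.intP u) ((I.int u).div_const _) fun z => ?_
  have h0 : 0 ≤ |T u z| ^ P z := Real.rpow_nonneg (abs_nonneg _) _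
  exact div_le_div_of_nonneg_left h0 (by linarith [I.h1]) (I.hP z).1

lemma Inst.dself_nonneg {P : Z → ℝ} {P1 P2 : ℝ} (I : Inst m P P1 P2 T) (u : E) :
    0 ≤ dPhi I u u := by
  rw [I.dself]; exact integral_nonneg fun z => Real.rpow_nonneg (abs_nonneg _) _

lemma psi_le (Iq : Inst m q qm qS T) (S : SubC m q f) {ε : ℝ} (hε : 0 < ε) :
    ∃ C, 0 ≤ C ∧ ∀ u : E, |Psi m f T u| ≤ C + ε * dPhi Iq u u := by
  obtain ⟨G, hG, hG0, h⟩ := S.FFbd (fun z => by linarith [Iq.P1' z]) hε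
  refine ⟨∫ z, G z ∂m, integral_nonneg hG0, fun u => ?_⟩
  rw [Iq.dself, ← integral_const_mul, ← integral_add hG ((Iq.int u).const_mul _)]
  refine abs_integral_le_integral_abs.trans ?_
  exact integral_mono (S.intF Iq u).abs (hG.add ((Iq.int u).const_mul _)) fun z => h z _

theorem PS_cond (I1 : Inst m1 P a1 pb D) (I0 : Inst m (fun _ => pb) pb pb T)
    (Iq : Inst m q qm qS T) (S : SubC m q f)
    (hn : ∀ u : E, ‖u‖ ^ pb ≤ dPhi I1 u u + dPhi I0 u u)
    (hB : ∀ B : ℝ, ∃ C, 0 ≤ C ∧ ∀ u : E, ‖u‖ ≤ B → dPhi Iq u u ≤ C * ‖u‖ ^ pb)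
    (hc : ∀ (u : ℕ → E) (R : ℝ), (∀ n, ‖u n‖ ≤ R) → ∃ φ : ℕ → ℕ, StrictMono φ ∧
      ∃ v : E, (∀ᵐ z ∂m, Tendsto (fun n => T (u (φ n)) z) atTop (𝓝 (T v z))) ∧
        ∀ᵐ z ∂m1, Tendsto (fun n => D (u (φ n)) z) atTop (𝓝 (D v z)))
    {α : ℝ} {g : Z → ℝ} (hα : pb ≤ α) (hαq : α < qm) (hg : Integrable g m)
    (hF : ∀ᵐ z ∂m, ∀ t, α * FF f z t - f z t * t ≤ g z) (L : ℝ) :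
    ∃ Λ > 0, ∀ l, 0 < l → l < Λ → ∀ b, PSband (JJ m1 P D m pb q f T l) (dJJ I1 I0 Iq S l) b L := by
  have hpb : 1 < pb := I0.h1
  have hα0 : 0 < α := by linarith
  set κ := 1 / α - 1 / qm with hκ
  have hκ0 : 0 < κ := by
    rw [hκ, sub_pos]; exact one_div_lt_one_div_of_lt hα0 hαq
  set A0 := ∫ z, g z ∂m with hA0
  set B0 := (L + A0 / α) / κ with hB0
  set B := (|B0| + 2) ^ pb⁻¹ with hBdef
  obtain ⟨CB, hCB0, hCB⟩ := hB B
  refine ⟨1 / (2 * (CB + 1)), by positivity, fun l hl hlΛ b u η hb hη hd => ?_⟩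
  have hlCB : l * CB ≤ 1 / 2 := by
    rw [lt_div_iff₀ (by positivity)] at hlΛ
    nlinarith
  have hΨ : ∀ u : E, Psi m f T u ≤ (dPsi S Iq u u + A0) / α := by
    intro u
    rw [dPsi_apply, hA0, ← integral_add (S.intd Iq u u) hg, ← integral_div]
    refine integral_mono_ae (S.intF Iq u) (((S.intd Iq u u).add hg).div_const _) ?_
    filter_upwards [hF] with z hz
    have := hz (T u z)
    rw [le_div_iff₀ hα0]
    linarith
  -- step 1
  have s1 : ∀ n, l * κ * dPhi Iq (u n) (u n) ≤ L + A0 / α + η n * ‖u n‖ / α := by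
    intro n
    have h1 := (hb n).2
    have h2 := (abs_le.1 (hd n (u n))).1
    rw [dJJ_apply] at h2
    have h3 := I1.phi_ge hα (u n)
    have h4 := I0.phi_ge hα (u n)
    have h5 := Iq.phi_le (u n)
    have h6 := hΨ (u n)
    have h7 : l * Phi m q T (u n) ≤ l * (dPhi Iq (u n) (u n) / qm) := by gcongr
    unfold JJ at h1
    have h8 : -(η n * ‖u n‖) / α ≤ (dPhi I1 (u n) (u n) + dPhi I0 (u n) (u n)
      - dPsi S Iq (u n) (u n) - l * dPhi Iq (u n) (u n)) / α := by gcongr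
    have e1 : (dPhi I1 (u n) (u n) + dPhi I0 (u n) (u n)
      - dPsi S Iq (u n) (u n) - l * dPhi Iq (u n) (u n)) / α = dPhi I1 (u n) (u n) / α
      + dPhi I0 (u n) (u n) / α - dPsi S Iq (u n) (u n) / α - l * dPhi Iq (u n) (u n) * (1 / α) := by ring
    have e2 : l * κ * dPhi Iq (u n) (u n) = l * dPhi Iq (u n) (u n) * (1 / α)
      - l * (dPhi Iq (u n) (u n) / qm) := by rw [hκ]; ring
    have e3 : (dPsi S Iq (u n) (u n) + A0) / α = dPsi S Iq (u n) (u n) / α + A0 / α := by ring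
    have e4 : -(η n * ‖u n‖) / α = - (η n * ‖u n‖ / α) := by ring
    rw [e2]; rw [e1, e4] at h8; rw [e3] at h6
    linarith
  -- boundedness
  obtain ⟨H, hH⟩ : ∃ H, ∀ n, η n ≤ H := by
    obtain ⟨H, hH⟩ := hη.bddAbove_range
    exact ⟨H, fun n => hH ⟨n, rfl⟩⟩
  obtain ⟨R, hR⟩ : ∃ R, ∀ n, ‖u n‖ ≤ R := by
    obtain ⟨C1, hC1, hC1b⟩ := psi_le Iq S one_pos
    set c := (1 + l / qm) / (l * κ) with hcdef
    have hqm : 0 < qm := by linarith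
    have hc0 : 0 < c := by positivity
    obtain ⟨R, hR⟩ := pow_bound (P := pb) (c0 := pb * (|L| + C1 + c * (|L| + |A0| / α)))
      (c1 := pb * c * (|H| / α)) hpb (by positivity) (by positivity)
    refine ⟨R, fun n => hR _ (norm_nonneg _) ?_⟩
    have h1 := (hb n).2
    unfold JJ at h1
    have h3 := I1.phi_ge le_rfl (u n)
    have h4 := I0.phi_ge le_rfl (u n)
    have h5 := Iq.phi_le (u n)
    have h6 := (le_abs_self _).trans (hC1b (u n))
    have h7 : l * Phi m q T (u n) ≤ l * (dPhi Iq (u n) (u n) / qm) := by gcongr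
    have h8 : dPhi Iq (u n) (u n) * (1 + l / qm) ≤ c * (|L| + |A0| / α + |H| / α * ‖u n‖) := by
      have e : dPhi Iq (u n) (u n) * (1 + l / qm) = c * (l * κ * dPhi Iq (u n) (u n)) := by
        rw [hcdef]; field_simp
      rw [e]
      refine mul_le_mul_of_nonneg_left ((s1 n).trans ?_) hc0.le
      have t1 : η n * ‖u n‖ / α ≤ |H| / α * ‖u n‖ := by
        rw [div_mul_eq_mul_div]
        gcongr
        exact (hH n).trans (le_abs_self _)
      have t2 : A0 / α ≤ |A0| / α := by gcongr; exact le_abs_self _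
      linarith [le_abs_self L]
    refine (hn (u n)).trans ?_
    have h9 : (dPhi I1 (u n) (u n) + dPhi I0 (u n) (u n)) / pb ≤
        |L| + C1 + c * (|L| + |A0| / α + |H| / α * ‖u n‖) := by
      rw [add_div]
      have e : dPhi Iq (u n) (u n) * (1 + l / qm) =
        dPhi Iq (u n) (u n) + l * (dPhi Iq (u n) (u n) / qm) := by ring
      rw [e] at h8
      linarith [le_abs_self L]
    rw [div_le_iff₀ (by linarith)] at h9
    refine h9.trans (le_of_eq ?_)
    ring
  obtain ⟨φ, hφ, v, hv, hv1⟩ := hc u R hR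
  refine ⟨v, φ, hφ, ?_⟩
  have hηφ : Tendsto (fun n => η (φ n)) atTop (𝓝 0) := hη.comp hφ.tendsto_atTop
  have hdv : ∀ w, dJJ I1 I0 Iq S l v w = 0 := by
    intro w
    have t1 := I1.wc (fun n => hR (φ n)) hv1 w
    have t2 := I0.wc (fun n => hR (φ n)) hv w
    have t3 := Iq.wc (fun n => hR (φ n)) hv w
    have t4 := S.wc2 Iq (R := max R ‖w‖) (w := fun _ => w) (y := w)
      (fun n => (hR (φ n)).trans (le_max_left _ _)) (fun n => le_max_right _ _) hv
      (ae_of_all _ fun z => tendsto_const_nhds)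
    have t5 := ((t1.add t2).sub t4).sub (t3.const_mul l)
    have t6 : Tendsto (fun n => dJJ I1 I0 Iq S l (u (φ n)) w) atTop (𝓝 0) := by
      refine squeeze_zero_norm (fun n => hd (φ n) w) ?_
      simpa using hηφ.mul_const ‖w‖
    simp only [dJJ_apply] at t6 ⊢
    exact tendsto_nhds_unique t5 t6
  have hwR : ∀ n, ‖u (φ n) - v‖ ≤ R + ‖v‖ := fun n =>
    (norm_sub_le _ _).trans (by linarith [hR (φ n)])
  have b1 := I1.bl hwR hv1
  have b2 := I0.bl hwR hv
  have b3 := Iq.bl hwR hv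
  have b4 := S.wc2 Iq (w := fun n => u (φ n)) (y := v) (fun n => hR (φ n))
    (fun n => hR (φ n)) hv hv
  have b5 : Tendsto (fun n => dJJ I1 I0 Iq S l (u (φ n)) (u (φ n))) atTop (𝓝 0) := by
    refine squeeze_zero_norm (a := fun n => |η (φ n)| * R) (fun n => (hd (φ n) _).trans ?_) ?_
    · refine (mul_le_mul_of_nonneg_right (le_abs_self _) (norm_nonneg _)).trans ?_
      gcongr
      exact hR _
    · simpa using hηφ.abs.mul_const R
  set w : ℕ → E := fun n => u (φ n) - v with hw
  have c1 : Tendsto (fun n => dPhi I1 (w n) (w n) + dPhi I0 (w n) (w n) - l * dPhi Iq (w n) (w n))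
      atTop (𝓝 0) := by
    have e := (b5.add b4).sub ((b1.add b2).sub (b3.const_mul l))
    have e2 := hdv v
    rw [dJJ_apply] at e2
    have e3 : 0 + dPsi S Iq v v - (dPhi I1 v v + dPhi I0 v v - l * dPhi Iq v v) = 0 := by linarith
    rw [e3] at e
    refine e.congr fun n => ?_
    simp only [dJJ_apply, hw]
    ring
  have c2 : ∀ᶠ n in atTop, l * dPhi Iq (w n) (w n) ≤ B0 + 1 := by
    have e1 : Tendsto (fun n => B0 + |η (φ n)| * R / α / κ
        - l * (dPhi Iq (u (φ n)) (u (φ n)) - dPhi Iq (w n) (w n))) atTop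
        (𝓝 (B0 + |0| * R / α / κ - l * dPhi Iq v v)) :=
      ((((hηφ.abs.mul_const R).div_const α).div_const κ).const_add B0).sub (b3.const_mul l)
    have e2 : B0 + |0| * R / α / κ - l * dPhi Iq v v < B0 + 1 := by
      have := mul_nonneg hl.le (Iq.dself_nonneg v)
      simp; linarith
    filter_upwards [e1.eventually_lt_const e2] with n hn'
    have e3 := s1 (φ n)
    have e4 : η (φ n) * ‖u (φ n)‖ / α ≤ |η (φ n)| * R / α := by
      gcongr
      · exact le_abs_self _
      · exact hR _
    have e5 : l * dPhi Iq (u (φ n)) (u (φ n)) ≤ B0 + |η (φ n)| * R / α / κ := by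
      rw [hB0, ← add_div, le_div_iff₀ hκ0]
      linarith
    linarith
  have c3 : ∀ᶠ n in atTop, ‖w n‖ ^ pb ≤ 2 *
      |dPhi I1 (w n) (w n) + dPhi I0 (w n) (w n) - l * dPhi Iq (w n) (w n)| := by
    filter_upwards [c2, c1.eventually_lt_const zero_lt_one] with n h1 h2
    have h3 := hn (w n)
    have h4 : ‖w n‖ ^ pb ≤ |B0| + 2 := by linarith [le_abs_self B0]
    have h5 : ‖w n‖ ≤ B := by
      rw [hBdef]
      calc ‖w n‖ = (‖w n‖ ^ pb) ^ pb⁻¹ := by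
            rw [← Real.rpow_mul (norm_nonneg _), mul_inv_cancel₀ (by linarith), Real.rpow_one]
        _ ≤ _ := Real.rpow_le_rpow (by positivity) h4 (by positivity)
    have h6 := hCB (w n) h5
    have h7 : l * dPhi Iq (w n) (w n) ≤ 1 / 2 * ‖w n‖ ^ pb := by
      calc l * dPhi Iq (w n) (w n) ≤ l * (CB * ‖w n‖ ^ pb) := by gcongr
        _ = (l * CB) * ‖w n‖ ^ pb := by ring
        _ ≤ _ := by gcongr
    have h8 := le_abs_self (dPhi I1 (w n) (w n) + dPhi I0 (w n) (w n) - l * dPhi Iq (w n) (w n))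
    linarith
  have c4 : Tendsto (fun n => ‖w n‖ ^ pb) atTop (𝓝 0) := by
    refine squeeze_zero' (Eventually.of_forall fun n => by positivity) c3 ?_
    simpa using c1.abs.const_mul 2
  rw [tendsto_iff_norm_sub_tendsto_zero]
  have c5 := c4.rpow_const (p := pb⁻¹) (Or.inr (by positivity))
  rw [Real.zero_rpow (by positivity)] at c5
  refine c5.congr fun n => ?_
  rw [← Real.rpow_mul (norm_nonneg _), mul_inv_cancel₀ (by linarith), Real.rpow_one]
  simp [hw]

theorem abstract_main (I1 : Inst m1 P a1 pb D) (I0 : Inst m (fun _ => pb) pb pb T)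
    (Iq : Inst m q qm qS T) (S : SubC m q f)
    (hn : ∀ u : E, ‖u‖ ^ pb ≤ dPhi I1 u u + dPhi I0 u u)
    (hB : ∀ B : ℝ, ∃ C, 0 ≤ C ∧ ∀ u : E, ‖u‖ ≤ B → dPhi Iq u u ≤ C * ‖u‖ ^ pb)
    (hc : ∀ (u : ℕ → E) (R : ℝ), (∀ n, ‖u n‖ ≤ R) → ∃ φ : ℕ → ℕ, StrictMono φ ∧
      ∃ v : E, (∀ᵐ z ∂m, Tendsto (fun n => T (u (φ n)) z) atTop (𝓝 (T v z))) ∧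
        ∀ᵐ z ∂m1, Tendsto (fun n => D (u (φ n)) z) atTop (𝓝 (D v z)))
    {α : ℝ} {g : Z → ℝ} (hα : pb ≤ α) (hαq : α < qm) (hg : Integrable g m)
    (hF : ∀ᵐ z ∂m, ∀ t, α * FF f z t - f z t * t ≤ g z)
    (hψ : ∀ η > 0, ∃ d, ∃ ψ : E →ₗ[ℝ] (Fin d → ℝ), Continuous ψ ∧
      ∀ u, ψ u = 0 → ‖u‖ = 1 → |Psi m f T u| ≤ η)
    (hV : ∀ n, ∃ ι : (Fin n → ℝ) →ₗ[ℝ] E, ∃ C, ∀ t,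
      Phi m1 P D (ι t) + Phi m (fun _ => pb) T (ι t) - Psi m f T (ι t) ≤ C - ∑ i, |t i|)
    (k : ℕ) :
    ∃ Λ > 0, ∀ l, 0 < l → l < Λ → ∃ c : Fin k → E, (∀ i w, dJJ I1 I0 Iq S l (c i) w = 0) ∧
      (∀ i, ‖c i‖ ≠ 0) ∧ ∀ i j, i ≠ j → ‖c i - c j‖ ≠ 0 ∧ ‖c i + c j‖ ≠ 0 := by
  have hpb : 1 < pb := I0.h1
  have hqm : 1 < qm := Iq.h1
  obtain ⟨d, ψ, hψc, hψb⟩ := hψ (1 / (4 * pb)) (by positivity)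
  obtain ⟨ι, C, hι⟩ := hV (d + k)
  obtain ⟨C1, hC10, hC1⟩ := hB 1
  obtain ⟨C2, hC20, hC2⟩ := psi_le Iq S one_pos
  set L := max C (1 / (8 * pb)) with hL
  obtain ⟨Λ0, hΛ0, hPS⟩ := PS_cond I1 I0 Iq S hn hB hc hα hαq hg hF L
  have hΦq : ∀ u : E, 0 ≤ Phi m q T u := fun u =>
    integral_nonneg fun z => div_nonneg (Real.rpow_nonneg (abs_nonneg _) _) (by linarith [Iq.P1' z])
  have hΦM : ∀ u : E, ‖u‖ ^ pb / pb ≤ Phi m1 P D u + Phi m (fun _ => pb) T u := by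
    intro u
    have h3 := I1.phi_ge le_rfl u
    have h4 := I0.phi_ge le_rfl u
    have h5 : ‖u‖ ^ pb / pb ≤ (dPhi I1 u u + dPhi I0 u u) / pb := by gcongr; exact hn u
    rw [add_div] at h5; linarith
  have hΦC : ∀ u : E, ‖u‖ ≤ 1 → Phi m q T u ≤ C1 ∧ dPhi Iq u u ≤ C1 := by
    intro u hu
    have h1 := hC1 u hu
    have h2 : ‖u‖ ^ pb ≤ 1 := Real.rpow_le_one (norm_nonneg _) hu (by linarith)
    have h3 : C1 * ‖u‖ ^ pb ≤ C1 := mul_le_of_le_one_right hC10 h2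
    have h4 := Iq.phi_le u
    have h5 : dPhi Iq u u / qm ≤ dPhi Iq u u := div_le_self (Iq.dself_nonneg u) hqm.le
    exact ⟨by linarith, by linarith⟩
  refine ⟨min Λ0 (min 1 (1 / (4 * pb * (C1 + 1)))), by positivity, fun l hl hlt => ?_⟩
  obtain ⟨hl1, hlt⟩ := lt_min_iff.1 hlt
  obtain ⟨hl2, hl3⟩ := lt_min_iff.1 hlt
  have hlC : l * C1 ≤ 1 / (4 * pb) := by
    rw [lt_div_iff₀ (by positivity)] at hl3
    rw [le_div_iff₀ (by positivity)]
    nlinarith [mul_pos hl (by linarith : 0 < pb)]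
  have hιJ : ∀ t, JJ m1 P D m pb q f T l (ι t) ≤ C - ∑ i, |t i| := by
    intro t
    have := hι t
    have h2 := mul_nonneg hl.le (hΦq (ι t))
    unfold JJ
    linarith
  have e8 : 1 / (8 * pb) = pb⁻¹ / 8 := by field_simp
  have e4 : 1 / (4 * pb) = pb⁻¹ / 4 := by field_simp
  have hpi : 0 < pb⁻¹ := by positivity
  have hreg := JJ_reg I1 I0 Iq S (fun u R h => by
    obtain ⟨φ, h1, v, h2, _⟩ := hc u R h
    exact ⟨φ, h1, T v, h2⟩) l
  have G1 : ∀ u, ψ u = 0 → ‖u‖ = 1 → 1 / (2 * pb) ≤ JJ m1 P D m pb q f T l u := by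
    intro u hu hu1
    have a1 := hψb u hu hu1
    have a2 := hΦM u
    have a3 := (hΦC u hu1.le).1
    have a4 := (abs_le.1 a1).2
    rw [hu1, Real.one_rpow] at a2
    have a5 : l * Phi m q T u ≤ l * C1 := by gcongr
    have a6 : 1 / (2 * pb) = pb⁻¹ / 2 := by field_simp
    rw [one_div] at a2
    rw [e4] at a4 hlC
    unfold JJ
    rw [a6]
    linarith
  have G2 : ∀ t, JJ m1 P D m pb q f T l (ι t) ≤ L := by
    intro t
    refine (hιJ t).trans (le_trans ?_ (le_max_left _ _))
    linarith [Finset.sum_nonneg fun i (_ : i ∈ Finset.univ) => abs_nonneg (t i)]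
  have G3 : ∀ t, |C| + C1 + C1 + C2 + 2 ≤ ∑ i, |t i| →
      JJ m1 P D m pb q f T l (ι t) ≤ 1 / (8 * pb) ∧ 1 < ‖ι t‖ := by
    intro t ht
    have a1 := hιJ t
    have a0 := le_abs_self C
    have a2 : JJ m1 P D m pb q f T l (ι t) ≤ -C1 - C1 - C2 - 2 := by linarith
    refine ⟨?_, ?_⟩
    · have : 0 < 1 / (8 * pb) := by positivity
      linarith
    · by_contra hle
      push Not at hle
      obtain ⟨b1, b2⟩ := hΦC _ hle
      have b3 := (abs_le.1 (hC2 (ι t))).2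
      have b4 := hΦM (ι t)
      have b5 : 0 ≤ ‖ι t‖ ^ pb / pb := by positivity
      have b6 : l * Phi m q T (ι t) ≤ 1 * C1 := by
        gcongr
        exact hΦq _
      unfold JJ at a2
      linarith
  obtain ⟨c, h1, h2, h3⟩ := minimax hreg (JJ_neg S l) (JJ_zero I1 I0 Iq l) (dJJ_neg I1 I0 Iq S l)
    (b' := 1 / (8 * pb)) (b := 1 / (4 * pb)) (β := 1 / (2 * pb)) (L := L) (ρ := 1)
    (R := |C| + C1 + C1 + C2 + 2)
    (by positivity) (by rw [e8, e4]; linarith)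
    (by rw [e4, show 1 / (2 * pb) = pb⁻¹ / 2 by field_simp]; linarith) (le_max_right _ _) one_pos
    (by positivity) (hPS l hl hl1 _) ψ hψc G1 ι G2 G3
  refine ⟨c, h1, fun i hi => ?_, h3⟩
  have a1 := h2 i
  have a2 : JJ m1 P D m pb q f T l (c i) = JJ m1 P D m pb q f T l 0 := by
    have := hreg.cont
    exact (Inseparable.map (Metric.inseparable_iff.2 (by rw [dist_zero_right]; exact hi)) this).eq
  rw [a2, JJ_zero I1 I0 Iq] at a1
  have : 0 < 1 / (8 * pb) := by positivity
  linarith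
end JJ


section space
variable (N : ℕ) (s pb e : ℝ)

def kkr (d : ℝ) : ℝ≥0∞ := if d < e then ENNReal.ofReal ((d ^ ((N:ℝ) + s * pb))⁻¹) else 0

def mu1 : Measure (Euc N × Euc N) :=
  (volume.prod volume).withDensity (fun z => kkr N s pb e (dist z.1 z.2))

def Wsub : Submodule ℝ (Euc N → ℝ) where
  carrier := {u | Measurable u ∧ MemLp u (ENNReal.ofReal pb) volume ∧
    MemLp (fun z : Euc N × Euc N => u z.1 - u z.2) (ENNReal.ofReal pb) (mu1 N s pb e)}
  add_mem' := by
    rintro u v ⟨h1, h2, h3⟩ ⟨k1, k2, k3⟩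
    refine ⟨h1.add k1, h2.add k2, ?_⟩
    convert h3.add k3 using 1
    ext z; simp; ring
  zero_mem' := by
    refine ⟨measurable_zero, MemLp.zero, ?_⟩
    simp
  smul_mem' := by
    rintro c u ⟨h1, h2, h3⟩
    refine ⟨h1.const_smul c, h2.const_smul c, ?_⟩
    convert h3.const_smul c using 1
    ext z; simp; ring

def W : Type := Wsub N s pb e

instance : AddCommGroup (W N s pb e) := inferInstanceAs (AddCommGroup (Wsub N s pb e))
instance : Module ℝ (W N s pb e) := inferInstanceAs (Module ℝ (Wsub N s pb e))

def TT : W N s pb e →ₗ[ℝ] (Euc N → ℝ) := (Wsub N s pb e).subtype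

def DD : W N s pb e →ₗ[ℝ] (Euc N × Euc N → ℝ) where
  toFun u := fun z => TT N s pb e u z.1 - TT N s pb e u z.2
  map_add' u v := by ext z; simp; ring
  map_smul' c u := by ext z; simp; ring

theorem TT_mem {N : ℕ} {s pb e : ℝ} (u : W N s pb e) :
    MemLp (TT N s pb e u) (ENNReal.ofReal pb) volume := u.2.2.1

theorem DD_mem {N : ℕ} {s pb e : ℝ} (u : W N s pb e) :
    MemLp (DD N s pb e u) (ENNReal.ofReal pb) (mu1 N s pb e) := u.2.2.2

variable {N s pb e}

theorem lint_pow {Z : Type*} [MeasurableSpace Z] {m : Measure Z} {v : Z → ℝ} (h1 : 1 ≤ pb)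
    (h : MemLp v (ENNReal.ofReal pb) m) :
    ∫⁻ z, ENNReal.ofReal (|v z| ^ pb) ∂m =
      ENNReal.ofReal ((eLpNorm v (ENNReal.ofReal pb) m).toReal ^ pb) := by
  have h0 : 0 < pb := by linarith
  rw [← ENNReal.ofReal_rpow_of_nonneg ENNReal.toReal_nonneg h0.le, ENNReal.ofReal_toReal h.2.ne,
    eLpNorm_eq_lintegral_rpow_enorm_toReal (by simpa using h0) (by simp),
    ENNReal.toReal_ofReal h0.le, ← ENNReal.rpow_mul]
  simp only [one_div, inv_mul_cancel₀ h0.ne', ENNReal.rpow_one]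
  refine lintegral_congr fun z => ?_
  rw [← ENNReal.ofReal_rpow_of_nonneg (abs_nonneg _) h0.le, ← Real.norm_eq_abs, ofReal_norm]

def AA (v : Euc N → ℝ) (pb : ℝ) : ℝ≥0∞ := ∫⁻ x, ENNReal.ofReal (|v x| ^ pb)

variable (N s pb e) in
def gg (v : Euc N → ℝ) (x : Euc N) : ℝ≥0∞ :=
  ∫⁻ y, kkr N s pb e (dist x y) * ENNReal.ofReal (|v x - v y| ^ pb)

theorem kkr_meas : Measurable (kkr N s pb e) := by
  unfold kkr
  exact Measurable.ite measurableSet_Iio (by fun_prop) measurable_const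

theorem gg_meas {v : Euc N → ℝ} (hv : Measurable v) : Measurable (gg N s pb e v) := by
  unfold gg
  refine Measurable.lintegral_prod_right ?_
  exact (kkr_meas.comp (by fun_prop)).mul (by fun_prop)

theorem gg_int {v : Euc N → ℝ} (hv : Measurable v) :
    ∫⁻ z, ENNReal.ofReal (|v z.1 - v z.2| ^ pb) ∂(mu1 N s pb e) = ∫⁻ x, gg N s pb e v x := by
  have h1 : Measurable fun z : Euc N × Euc N => kkr N s pb e (dist z.1 z.2) :=
    kkr_meas.comp (by fun_prop)
  have h2 : Measurable fun z : Euc N × Euc N => ENNReal.ofReal (|v z.1 - v z.2| ^ pb) := by fun_prop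
  unfold mu1
  rw [lintegral_withDensity_eq_lintegral_mul _ h1 h2, lintegral_prod _ (h1.mul h2).aemeasurable]
  rfl

theorem memW_iff (h1 : 1 ≤ pb) {v : Euc N → ℝ} (hv : Measurable v) :
    v ∈ Wsub N s pb e ↔ AA v pb < ⊤ ∧ ∫⁻ x, gg N s pb e v x < ⊤ := by
  have h0 : 0 < pb := by linarith
  rw [← gg_int hv]
  have key : ∀ {Z : Type} [MeasurableSpace Z] (m : Measure Z) (w : Z → ℝ), Measurable w →
      (MemLp w (ENNReal.ofReal pb) m ↔ ∫⁻ z, ENNReal.ofReal (|w z| ^ pb) ∂m < ⊤) := by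
    intro Z _ m w hw
    constructor
    · intro h; rw [lint_pow h1 h]; simp
    · intro h
      refine ⟨hw.aestronglyMeasurable, ?_⟩
      rw [eLpNorm_lt_top_iff_lintegral_rpow_enorm_lt_top (by simpa using h0) (by simp),
        ENNReal.toReal_ofReal h0.le]
      refine lt_of_le_of_lt (lintegral_mono fun z => ?_) h
      rw [← ENNReal.ofReal_rpow_of_nonneg (abs_nonneg _) h0.le, ← Real.norm_eq_abs, ofReal_norm]
  constructor
  · rintro ⟨_, a, b⟩
    exact ⟨(key _ _ hv).1 a, (key _ _ (by fun_prop)).1 b⟩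
  · rintro ⟨a, b⟩
    exact ⟨hv, (key _ _ hv).2 a, (key _ _ (by fun_prop)).2 b⟩

theorem TT_meas (u : W N s pb e) : Measurable (TT N s pb e u) := u.2.1

variable (N s pb e)
variable [Fact (1 ≤ ENNReal.ofReal pb)]

def emb : W N s pb e →ₗ[ℝ] (Lp ℝ (ENNReal.ofReal pb) (volume : Measure (Euc N))) ×
    (Lp ℝ (ENNReal.ofReal pb) (mu1 N s pb e)) where
  toFun u := (MemLp.toLp (TT N s pb e u) u.2.2.1, MemLp.toLp (DD N s pb e u) u.2.2.2)
  map_add' u v := by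
    refine Prod.ext ?_ ?_
    · exact MemLp.toLp_add u.2.2.1 v.2.2.1
    · simp only [map_add]
      exact MemLp.toLp_add u.2.2.2 v.2.2.2
  map_smul' c u := by
    refine Prod.ext ?_ ?_
    · exact MemLp.toLp_const_smul c u.2.2.1
    · simp only [map_smul]
      exact MemLp.toLp_const_smul c u.2.2.2

instance : SeminormedAddCommGroup (W N s pb e) :=
  SeminormedAddCommGroup.induced _ _ (emb N s pb e)
instance : NormedSpace ℝ (W N s pb e) := NormedSpace.induced _ _ _ (emb N s pb e)

variable {N s pb e}

theorem W_norm (u : W N s pb e) : ‖u‖ = max (eLpNorm (TT N s pb e u) (ENNReal.ofReal pb) volume).toReal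
    (eLpNorm (DD N s pb e u) (ENNReal.ofReal pb) (mu1 N s pb e)).toReal := by
  change ‖emb N s pb e u‖ = _
  rw [Prod.norm_def]
  exact congrArg₂ max (Lp.norm_toLp _ (TT_mem u)) (Lp.norm_toLp _ (DD_mem u))

theorem pb1 : 1 ≤ pb := by
  have := (Fact.out : 1 ≤ ENNReal.ofReal pb)
  simpa using this

theorem AA_le (u : W N s pb e) : AA (TT N s pb e u) pb ≤ ENNReal.ofReal (‖u‖ ^ pb) := by
  have := pb1 (pb := pb)
  unfold AA
  rw [lint_pow this (TT_mem u), W_norm]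
  refine ENNReal.ofReal_le_ofReal ?_
  exact Real.rpow_le_rpow ENNReal.toReal_nonneg (le_max_left _ _) (by linarith)

theorem BB_le (u : W N s pb e) : ∫⁻ x, gg N s pb e (TT N s pb e u) x ≤ ENNReal.ofReal (‖u‖ ^ pb) := by
  have := pb1 (pb := pb)
  rw [← gg_int (TT_meas u), W_norm]
  refine (lint_pow this (DD_mem u)).le.trans (ENNReal.ofReal_le_ofReal ?_)
  exact Real.rpow_le_rpow ENNReal.toReal_nonneg (le_max_right _ _) (by linarith)

theorem norm_le (u : W N s pb e) :
    ENNReal.ofReal (‖u‖ ^ pb) ≤ AA (TT N s pb e u) pb + ∫⁻ x, gg N s pb e (TT N s pb e u) x := by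
  have := pb1 (pb := pb)
  rw [W_norm]
  rcases max_choice (eLpNorm (TT N s pb e u) (ENNReal.ofReal pb) volume).toReal
    (eLpNorm (DD N s pb e u) (ENNReal.ofReal pb) (mu1 N s pb e)).toReal with h | h <;> rw [h]
  · rw [← lint_pow this (TT_mem u)]; exact le_self_add
  · rw [← gg_int (TT_meas u), ← lint_pow this (DD_mem u)]; exact le_add_left le_rfl

end space


section sob
variable {N : ℕ} {s pb e : ℝ}

theorem loc_est (hs : 0 < s) (h1 : 1 ≤ pb) {r : ℝ} (hr : 0 < r) (hre : r ≤ e)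
    (v : Euc N → ℝ) (x : Euc N) {S : Set (Euc N)} (hSm : MeasurableSet S)
    (hS : S ⊆ Metric.ball x r) :
    ∫⁻ y in S, ENNReal.ofReal (|v x - v y| ^ pb) ≤
      ENNReal.ofReal (r ^ ((N:ℝ) + s * pb)) * gg N s pb e v x := by
  have hE : 0 < (N:ℝ) + s * pb := by positivity
  unfold gg
  rw [← lintegral_const_mul' _ _ (by simp)]
  refine le_trans (setLIntegral_mono' hSm (g := fun y => ENNReal.ofReal (r ^ ((N:ℝ) + s * pb)) *
    (kkr N s pb e (dist x y) * ENNReal.ofReal (|v x - v y| ^ pb))) ?_) (setLIntegral_le_lintegral _ _)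
  intro y hy
  have hy' : dist x y < r := by rw [dist_comm]; exact hS hy
  by_cases hxy : x = y
  · subst hxy
    simp [Real.zero_rpow (by linarith : pb ≠ 0)]
  have hd : 0 < dist x y := dist_pos.2 hxy
  rw [← mul_assoc, kkr, if_pos (hy'.trans_le hre), ← ENNReal.ofReal_mul (by positivity)]
  refine le_mul_of_one_le_left' ?_
  rw [ENNReal.one_le_ofReal, ← div_eq_mul_inv, one_le_div (by positivity)]
  exact Real.rpow_le_rpow hd.le hy'.le hE.le

def om (N : ℕ) : ℝ := (volume (Metric.ball (0 : Euc N) 1)).toReal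

theorem om_pos : 0 < om N :=
  ENNReal.toReal_pos (Metric.measure_ball_pos _ _ one_pos).ne' measure_ball_lt_top.ne

theorem vol_ball (x : Euc N) {r : ℝ} (hr : 0 < r) :
    volume (Metric.ball x r) = ENNReal.ofReal (r ^ N * om N) := by
  rw [Measure.addHaar_ball_of_pos _ _ hr, ENNReal.ofReal_mul (by positivity), om,
    ENNReal.ofReal_toReal measure_ball_lt_top.ne]
  simp

/-- real-number core of the pointwise Sobolev estimate -/
theorem sob_core {n v K p θ P om : ℝ} (hv : 0 < v) (hK : 0 < K) (hom : 0 < om) (hn : 0 < n)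
    (hθ : 0 < θ) (hP : P * (1 - θ) = p) {e : ℝ} (he : 0 < e) (_ : 0 < P)
    {g : ℝ} (hg : 0 ≤ g) (t : ℝ) (ht : t = 2 * K * (2 / v) ^ P / om)
    (hcase : t ^ (1 / n) ≤ e → (v / 2) ^ p * (om * t / 2) ≤ t ^ (1 + θ) * g) :
    v ^ P ≤ (2 ^ (P + 1) / om * (2 / om) ^ θ + (2 ^ (P + 1) / (om * e ^ n)) ^ θ) * K ^ θ * (g + v ^ p) := by
  have ht0 : 0 < t := by rw [ht]; positivity
  have hvP : v ^ P = v ^ (P * θ) * v ^ p := by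
    rw [← Real.rpow_add hv]; congr 1; rw [← hP]; ring
  by_cases hc : t ^ (1 / n) ≤ e
  · have h := hcase hc
    rw [Real.rpow_add ht0, Real.rpow_one] at h
    have h2 : (v / 2) ^ p * (om / 2) ≤ t ^ θ * g := by
      refine le_of_mul_le_mul_left ?_ ht0
      linarith
    have htθ : t ^ θ = (2 / om) ^ θ * K ^ θ * (2 / v) ^ (P * θ) := by
      rw [Real.rpow_mul (by positivity), ← Real.mul_rpow (by positivity) (by positivity),
        ← Real.mul_rpow (by positivity) (by positivity), ht]
      congr 1; ring
    rw [htθ, Real.div_rpow hv.le (by norm_num), Real.div_rpow (by norm_num) hv.le] at h2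
    have h3 : (2:ℝ) ^ (P + 1) = 2 ^ p * 2 ^ (P * θ) * 2 := by
      rw [← Real.rpow_add (by norm_num), Real.rpow_add (by norm_num), Real.rpow_one]
      congr 2; rw [← hP]; ring
    have h4 : v ^ P ≤ 2 ^ (P + 1) / om * (2 / om) ^ θ * K ^ θ * g := by
      rw [hvP, h3]
      have hA : 0 < v ^ (P * θ) := by positivity
      have hB : (0:ℝ) < 2 ^ p := by positivity
      have := mul_le_mul_of_nonneg_left h2 (by positivity : 0 ≤ v ^ (P * θ) * 2 ^ p * 2 / om)
      refine le_trans (le_of_eq ?_) (this.trans (le_of_eq ?_)) <;> field_simp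
    refine h4.trans ?_
    rw [add_mul, add_mul]
    have : 0 ≤ (2 ^ (P + 1) / (om * e ^ n)) ^ θ * K ^ θ * (g + v ^ p) := by positivity
    have : 0 ≤ 2 ^ (P + 1) / om * (2 / om) ^ θ * K ^ θ * v ^ p := by positivity
    linarith
  · push Not at hc
    have h5 : e ^ n < t := by
      have := Real.rpow_lt_rpow he.le hc hn
      rwa [← Real.rpow_mul ht0.le, one_div, inv_mul_cancel₀ hn.ne', Real.rpow_one] at this
    have h6 : v ^ P ≤ 2 ^ (P + 1) / (om * e ^ n) * K := by
      rw [ht, Real.div_rpow (by norm_num) hv.le, lt_div_iff₀ hom, mul_div_assoc', lt_div_iff₀ (by positivity)] at h5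
      rw [div_mul_eq_mul_div, le_div_iff₀ (by positivity), Real.rpow_add (by norm_num), Real.rpow_one]
      linarith
    have h7 : v ^ (P * θ) ≤ (2 ^ (P + 1) / (om * e ^ n)) ^ θ * K ^ θ := by
      rw [Real.rpow_mul hv.le, ← Real.mul_rpow (by positivity) hK.le]
      exact Real.rpow_le_rpow (by positivity) h6 hθ.le
    rw [hvP]
    refine (mul_le_mul_of_nonneg_right h7 (by positivity)).trans ?_
    rw [add_mul, add_mul]
    have : 0 ≤ (2 ^ (P + 1) / (om * e ^ n)) ^ θ * K ^ θ * g := by positivity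
    have : 0 ≤ 2 ^ (P + 1) / om * (2 / om) ^ θ * K ^ θ * (g + v ^ p) := by positivity
    linarith

/-- Sobolev for bounded truncations -/
theorem sob_trunc (hs : 0 < s) (h1 : 1 < pb) (hN : s * pb < N) (he : 0 < e) :
    ∃ C : ℝ, 0 < C ∧ ∀ u : Euc N → ℝ, Measurable u → AA u pb < ⊤ → ∀ Tr : ℝ, 0 < Tr →
      (∫⁻ x, ENNReal.ofReal (min |u x| Tr ^ (N * pb / (N - s * pb)))) ^ (1 - s * pb / N) ≤
        ENNReal.ofReal C * (AA u pb + ∫⁻ x, gg N s pb e u x) := by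
  have hNN : (0:ℝ) < N := by nlinarith
  have hN0 : N ≠ 0 := by rintro rfl; simp at hNN
  set θ := s * pb / N with hθ
  set P := N * pb / (N - s * pb) with hP
  have hθ0 : 0 < θ := by rw [hθ]; positivity
  have hθ1 : θ < 1 := by rw [hθ, div_lt_one hNN]; exact hN
  have hPθ : P * (1 - θ) = pb := by
    have : (N:ℝ) - s * pb ≠ 0 := by linarith
    rw [hP, hθ, div_mul_eq_mul_div, div_eq_iff this]; field_simp
  have hPpb : pb ≤ P := by
    nlinarith
  have hP0 : 0 < P := by linarith
  have hom := om_pos (N := N)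
  set C := (2 ^ (P + 1) / om N * (2 / om N) ^ θ + (2 ^ (P + 1) / (om N * e ^ (N:ℝ))) ^ θ) with hC
  have hC0 : 0 < C := by positivity
  refine ⟨C, hC0, fun u hu hA Tr hTr => ?_⟩
  set v : Euc N → ℝ := fun x => min |u x| Tr with hv
  have hvm : Measurable v := by fun_prop
  have hv0 : ∀ x, 0 ≤ v x := fun x => le_min (abs_nonneg _) hTr.le
  set KK : ℝ≥0∞ := ∫⁻ x, ENNReal.ofReal (v x ^ P) with hKK
  have hKt : KK < ⊤ := by
    have : KK ≤ ENNReal.ofReal (Tr ^ (P - pb)) * AA u pb := by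
      unfold AA
      rw [← lintegral_const_mul' _ _ (by simp)]
      refine lintegral_mono fun x => ?_
      rw [← ENNReal.ofReal_mul (by positivity)]
      refine ENNReal.ofReal_le_ofReal ?_
      have : v x ^ P = v x ^ (P - pb) * v x ^ pb := by
        rw [← Real.rpow_add' (hv0 x) (by linarith)]; congr 1; ring
      rw [this]
      gcongr
      · exact min_le_right _ _
      · exact min_le_left _ _
    exact this.trans_lt (ENNReal.mul_lt_top (by simp) hA)
  rcases eq_or_ne KK 0 with h0 | h0
  · rw [h0, ENNReal.zero_rpow_of_pos (by linarith)]; exact zero_le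
  set K := KK.toReal with hK
  have hKp : 0 < K := ENNReal.toReal_pos h0 hKt.ne
  have hKe : KK = ENNReal.ofReal K := (ENNReal.ofReal_toReal hKt.ne).symm
  have key : ∀ x, ENNReal.ofReal (v x ^ P) ≤ ENNReal.ofReal (C * K ^ θ) *
      (ENNReal.ofReal (|u x| ^ pb) + gg N s pb e u x) := by
    intro x
    rcases (hv0 x).eq_or_lt with hx | hx
    · rw [← hx, Real.zero_rpow hP0.ne']; simp
    rcases eq_or_ne (gg N s pb e u x) ⊤ with hg | hg
    · rw [hg, add_top, ENNReal.mul_top (by simpa using by positivity)]; exact le_top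
    obtain ⟨g, hg0, hge⟩ : ∃ g : ℝ, 0 ≤ g ∧ gg N s pb e u x = ENNReal.ofReal g :=
      ⟨_, ENNReal.toReal_nonneg, (ENNReal.ofReal_toReal hg).symm⟩
    rw [hge, ← ENNReal.ofReal_add (by positivity) hg0, ← ENNReal.ofReal_mul (by positivity)]
    refine ENNReal.ofReal_le_ofReal ?_
    set t := 2 * K * (2 / v x) ^ P / om N with ht
    have ht0 : 0 < t := by positivity
    refine (sob_core hx hKp hom hNN hθ0 hPθ he hP0 hg0 t ht ?_).trans ?_
    swap
    · rw [add_comm g]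
      have : v x ^ pb ≤ |u x| ^ pb := Real.rpow_le_rpow (hv0 x) (min_le_left _ _) (by linarith)
      gcongr
    intro hr
    set r := t ^ (1 / (N:ℝ)) with hrd
    have hr0 : 0 < r := by positivity
    have hrN : r ^ N = t := by
      rw [hrd, ← Real.rpow_natCast, ← Real.rpow_mul ht0.le, one_div, inv_mul_cancel₀ hNN.ne', Real.rpow_one]
    set Bd : Set (Euc N) := {y | v x / 2 ≤ v y} with hBd
    have hBm : MeasurableSet Bd := measurableSet_le measurable_const hvm
    have hBv : volume Bd ≤ ENNReal.ofReal (om N * t / 2) := by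
      have hm := mul_meas_ge_le_lintegral (μ := (volume : Measure (Euc N)))
        (by fun_prop : Measurable fun y => ENNReal.ofReal (v y ^ P)) (ENNReal.ofReal ((v x / 2) ^ P))
      have hsub : Bd ⊆ {y | ENNReal.ofReal ((v x / 2) ^ P) ≤ ENNReal.ofReal (v y ^ P)} := by
        intro y hy
        exact ENNReal.ofReal_le_ofReal (Real.rpow_le_rpow (by positivity) hy hP0.le)
      have h2 := (mul_le_mul_right (measure_mono hsub) (ENNReal.ofReal ((v x / 2) ^ P))).trans hm
      rw [← hKK, hKe] at h2
      have h3 : (v x / 2) ^ P * (om N * t / 2) = K := by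
        rw [ht, Real.div_rpow hx.le (by norm_num), Real.div_rpow (by norm_num) hx.le]
        field_simp
      rw [← h3, ENNReal.ofReal_mul (by positivity)] at h2
      exact (ENNReal.mul_le_mul_iff_right (by simpa using by positivity) (by simp)).1 h2
    set S := Metric.ball x r \ Bd with hSd
    have hSm : MeasurableSet S := measurableSet_ball.diff hBm
    have hSv : ENNReal.ofReal (om N * t / 2) ≤ volume S := by
      have h4 : ENNReal.ofReal (om N * t) ≤ volume S + volume Bd := by
        rw [mul_comm, ← hrN, ← vol_ball x hr0]
        refine (measure_mono ?_).trans (measure_union_le _ _)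
        intro y hy
        by_cases h : y ∈ Bd
        · exact Or.inr h
        · exact Or.inl ⟨hy, h⟩
      have h5 : ENNReal.ofReal (om N * t) = ENNReal.ofReal (om N * t / 2) + ENNReal.ofReal (om N * t / 2) := by
        rw [← ENNReal.ofReal_add (by positivity) (by positivity)]; congr 1; ring
      rw [h5] at h4
      exact (ENNReal.add_le_add_iff_right ENNReal.ofReal_ne_top).1 (h4.trans (add_le_add le_rfl hBv))
    have hl := loc_est hs h1.le hr0 hr u x hSm sdiff_subset
    rw [hge, ← ENNReal.ofReal_mul (by positivity)] at hl
    have hlow : ENNReal.ofReal ((v x / 2) ^ pb) * volume S ≤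
        ∫⁻ y in S, ENNReal.ofReal (|u x - u y| ^ pb) := by
      rw [← setLIntegral_const]
      refine setLIntegral_mono' hSm fun y hy => ENNReal.ofReal_le_ofReal ?_
      refine Real.rpow_le_rpow (by positivity) ?_ (by linarith)
      have h6 : v y < v x / 2 := not_le.1 hy.2
      have h7 : v x - v y ≤ |u x - u y| := by
        have h8 := abs_sub_abs_le_abs_sub (u x) (u y)
        rcases min_choice |u y| Tr with h | h
        · have : v y = |u y| := h
          have : v x ≤ |u x| := min_le_left _ _
          linarith
        · have : v y = Tr := h
          have : v x ≤ Tr := min_le_right _ _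
          linarith
      linarith
    have h9 := ((mul_le_mul_right hSv _).trans hlow).trans hl
    rw [← ENNReal.ofReal_mul (by positivity), ENNReal.ofReal_le_ofReal_iff (by positivity)] at h9
    refine h9.trans (le_of_eq ?_)
    congr 1
    rw [hrd, ← Real.rpow_mul ht0.le]
    congr 1
    rw [hθ]; field_simp
  have h10 : KK ≤ ENNReal.ofReal (C * K ^ θ) * (AA u pb + ∫⁻ x, gg N s pb e u x) := by
    unfold AA
    rw [← lintegral_add_left (by fun_prop), ← lintegral_const_mul' _ _ (by simp)]
    exact lintegral_mono key
  rw [mul_comm C, ENNReal.ofReal_mul (by positivity), mul_assoc] at h10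
  have h11 : KK = ENNReal.ofReal (K ^ θ) * KK ^ (1 - θ) := by
    rw [hKe, ENNReal.ofReal_rpow_of_pos hKp, ← ENNReal.ofReal_mul (by positivity),
      ← Real.rpow_add hKp]
    simp
  rw [h11] at h10
  exact (ENNReal.mul_le_mul_iff_right (by simpa using by positivity) (by simp)).1 h10

theorem sobolev (hs : 0 < s) (h1 : 1 < pb) (hN : s * pb < N) (he : 0 < e) :
    ∃ C : ℝ, 0 < C ∧ ∀ u : Euc N → ℝ, Measurable u → AA u pb < ⊤ →
      ∫⁻ x, ENNReal.ofReal (|u x| ^ (N * pb / (N - s * pb))) ≤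
        (ENNReal.ofReal C * (AA u pb + ∫⁻ x, gg N s pb e u x)) ^ ((1 - s * pb / N)⁻¹) := by
  obtain ⟨C, hC, h⟩ := sob_trunc (N := N) (e := e) hs h1 hN he
  refine ⟨C, hC, fun u hu hA => ?_⟩
  have hNN : (0:ℝ) < N := by nlinarith
  have hθ : 0 < 1 - s * pb / N := by rw [sub_pos, div_lt_one hNN]; exact hN
  have hP : 0 < N * pb / (N - s * pb) := div_pos (by positivity) (by linarith)
  have hlim : Tendsto (fun n : ℕ => ∫⁻ x, ENNReal.ofReal (min |u x| (n + 1 : ℝ) ^ (N * pb / (N - s * pb))))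
      atTop (𝓝 (∫⁻ x, ENNReal.ofReal (|u x| ^ (N * pb / (N - s * pb))))) := by
    refine lintegral_tendsto_of_tendsto_of_monotone (fun n => by fun_prop) ?_ ?_
    · refine ae_of_all _ fun x n m hnm => ENNReal.ofReal_le_ofReal ?_
      refine Real.rpow_le_rpow (le_min (abs_nonneg _) (by positivity)) ?_ hP.le
      exact min_le_min le_rfl (by simpa using hnm)
    · refine ae_of_all _ fun x => ?_
      refine tendsto_const_nhds.congr' ?_
      obtain ⟨k, hk⟩ := exists_nat_ge |u x|
      filter_upwards [eventually_ge_atTop k] with n hn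
      rw [min_eq_left]
      have : (k:ℝ) ≤ n := by exact_mod_cast hn
      linarith
  refine le_of_tendsto' hlim fun n => ?_
  rw [ENNReal.le_rpow_inv_iff hθ]
  exact h u hu hA _ (by positivity)

end sob


section insts
variable {N : ℕ} {s pm pb e : ℝ} {p : Euc N → Euc N → ℝ} {A : Set (Euc N)}

structure PH (s pm pb e : ℝ) (p : Euc N → Euc N → ℝ) (A : Set (Euc N)) : Prop where
  hs : 0 < s
  h1 : 1 < pm
  hpp : pm ≤ pb
  hN : s * pb < N
  he : 0 < e
  mp : Measurable fun z : Euc N × Euc N => p z.1 z.2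
  hP : ∀ x y, p x y ∈ Icc pm pb
  near : ∀ x y, dist x y < e → p x y = pb
  mA : MeasurableSet A
  fA : volume A < ⊤
  offA : ∀ x ∉ A, ∀ y, p x y = pb

theorem int_of_lint {Z : Type*} [MeasurableSpace Z] {m : Measure Z} {h : Z → ℝ} (hm : Measurable h)
    (h0 : ∀ z, 0 ≤ h z) {K : ℝ} (hK0 : 0 ≤ K) (hK : ∫⁻ z, ENNReal.ofReal (h z) ∂m ≤ ENNReal.ofReal K) :
    Integrable h m ∧ ∫ z, h z ∂m ≤ K := by
  have hi : Integrable h m := by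
    refine ⟨hm.aestronglyMeasurable, ?_⟩
    rw [hasFiniteIntegral_iff_ofReal (ae_of_all _ h0)]
    exact hK.trans_lt ENNReal.ofReal_lt_top
  refine ⟨hi, ?_⟩
  rw [← ofReal_integral_eq_lintegral_ofReal hi (ae_of_all _ h0)] at hK
  exact (ENNReal.ofReal_le_ofReal_iff hK0).1 hK

theorem PH.meas_sob (H : PH s pm pb e p A) {u : Euc N → ℝ} (hu : Measurable u) :
    Measurable fun z : Euc N × Euc N => sobKernel s p u z.1 z.2 := by
  have := H.mp
  unfold sobKernel
  fun_prop

def kfar (N : ℕ) (s pm pb e : ℝ) (z : Euc N) : ℝ :=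
  ((e / (1 + e)) ^ ((N:ℝ) + s * pb))⁻¹ * (1 + ‖z‖) ^ (-((N:ℝ) + s * pm))

theorem PH.fpt (H : PH s pm pb e p A) (u : Euc N → ℝ) (x y : Euc N) : sobKernel s p u x y ≤
      kkr N s pb e (dist x y) * ENNReal.ofReal (|u x - u y| ^ pb) +
      ENNReal.ofReal (kfar N s pm pb e (x - y)) * (A.indicator (fun _ => 1) x + ENNReal.ofReal (2 ^ pb) * (ENNReal.ofReal (|u x| ^ pb) +
        ENNReal.ofReal (|u y| ^ pb))) := by
  have hs := H.hs
  have h1 := H.h1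
  have he := H.he
  have hpp := H.hpp
  unfold kfar
  set c := e / (1 + e) with hc
  have hc0 : 0 < c := by positivity
  have hc1 : c ≤ 1 := by rw [hc, div_le_one (by positivity)]; linarith
  set E1 := (N:ℝ) + s * pm with hE1
  have hE0 : (N:ℝ) < E1 := by rw [hE1]; have : 0 < s * pm := by positivity
                              linarith
  have hP := H.hP x y
  unfold sobKernel
  rw [div_eq_mul_inv, mul_comm, ENNReal.ofReal_mul (by positivity)]
  by_cases hd : dist x y < e
  · rw [H.near x y hd, kkr, if_pos hd]; exact le_self_add
  push Not at hd
  refine le_add_left (mul_le_mul' ?_ ?_)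
  · refine ENNReal.ofReal_le_ofReal ?_
    rw [← dist_eq_norm]
    have hd0 : 0 < dist x y := he.trans_le hd
    have hcd : c * (1 + dist x y) ≤ dist x y := by
      rw [hc, div_mul_eq_mul_div, div_le_iff₀ (by positivity)]; nlinarith
    have hEE : E1 ≤ (N:ℝ) + s * p x y := by rw [hE1]; nlinarith [hP.1]
    rw [Real.rpow_neg (by positivity), ← mul_inv]
    refine inv_anti₀ (by positivity) ?_
    calc c ^ ((N:ℝ) + s * pb) * (1 + dist x y) ^ E1
        ≤ c ^ ((N:ℝ) + s * p x y) * (1 + dist x y) ^ ((N:ℝ) + s * p x y) := by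
          refine mul_le_mul ?_ ?_ (by positivity) (by positivity)
          · exact Real.rpow_le_rpow_of_exponent_ge hc0 hc1 (by nlinarith [hP.2])
          · exact Real.rpow_le_rpow_of_exponent_le (by linarith) hEE
      _ = (c * (1 + dist x y)) ^ ((N:ℝ) + s * p x y) := by rw [Real.mul_rpow hc0.le (by positivity)]
      _ ≤ _ := Real.rpow_le_rpow (by positivity) hcd (by linarith [Nat.cast_nonneg (α := ℝ) N])
  · rw [← ENNReal.ofReal_add (by positivity) (by positivity), ← ENNReal.ofReal_mul (by positivity)]
    have h3 : |u x - u y| ^ pb ≤ 2 ^ pb * (|u x| ^ pb + |u y| ^ pb) :=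
      (Real.rpow_le_rpow (abs_nonneg _) (abs_sub _ _) (by linarith)).trans
        (add_rpow_le2 (by linarith) le_rfl (abs_nonneg _) (abs_nonneg _))
    by_cases hx : x ∈ A
    · rw [indicator_of_mem hx, ← ENNReal.ofReal_one, ← ENNReal.ofReal_add (by norm_num) (by positivity)]
      refine ENNReal.ofReal_le_ofReal (le_trans ?_ (add_le_add le_rfl h3))
      rcases le_total |u x - u y| 1 with h | h
      · have := Real.rpow_le_one (abs_nonneg _) h (by linarith [hP.1] : 0 ≤ p x y)
        have : 0 ≤ |u x - u y| ^ pb := by positivity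
        linarith
      · have := Real.rpow_le_rpow_of_exponent_le h hP.2
        linarith
    · rw [H.offA x hx y]
      exact le_add_left (ENNReal.ofReal_le_ofReal h3)

theorem PH.far (H : PH s pm pb e p A) : ∃ C : ℝ≥0, ∀ u : Euc N → ℝ, Measurable u →
    ∫⁻ x, ∫⁻ y, sobKernel s p u x y ≤ C * (1 + AA u pb) + ∫⁻ x, gg N s pb e u x := by
  have hs := H.hs
  have h1 := H.h1
  have he := H.he
  have hpp := H.hpp
  have hE0 : (N:ℝ) < (N:ℝ) + s * pm := lt_add_of_pos_right _ (by positivity)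
  set k : Euc N → ℝ≥0∞ := fun z => ENNReal.ofReal (kfar N s pm pb e z) with hk
  have hkm : Measurable k := by unfold k kfar; fun_prop
  have hJ : ∫⁻ z, k z < ⊤ := by
    have hi : Integrable (kfar N s pm pb e) :=
      (integrable_one_add_norm (by simpa using hE0)).const_mul _
    exact hi.lintegral_lt_top
  set J := ∫⁻ z, k z with hJd
  have hJx : ∀ x : Euc N, ∫⁻ y, k (x - y) = J := fun x => lintegral_sub_left_eq_self k x
  have hJy : ∀ y : Euc N, ∫⁻ x, k (x - y) = J := fun y => lintegral_sub_right_eq_self k y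
  set T2 := ENNReal.ofReal (2 ^ pb) with hT2
  have hfin : J * volume A + 2 * (J * T2) < ⊤ := by
    refine ENNReal.add_lt_top.2 ⟨ENNReal.mul_lt_top hJ H.fA, ?_⟩
    exact ENNReal.mul_lt_top (by simp) (ENNReal.mul_lt_top hJ (by simp [hT2]))
  refine ⟨(J * volume A + 2 * (J * T2)).toNNReal, fun u hu => ?_⟩
  rw [ENNReal.coe_toNNReal hfin.ne]
  have hkm2 : Measurable fun z : Euc N × Euc N => k (z.1 - z.2) := hkm.comp (by fun_prop)
  clear_value k
  have hA := H.mA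
  have hind : Measurable (A.indicator (fun _ => (1:ℝ≥0∞))) := measurable_const.indicator hA
  set a : Euc N → ℝ≥0∞ := fun x => ENNReal.ofReal (|u x| ^ pb) with ha
  have ham : Measurable a := by fun_prop
  have haA : ∫⁻ x, a x = AA u pb := rfl
  set ia := A.indicator (fun _ => (1:ℝ≥0∞)) with hia
  have hstep : ∀ x, ∫⁻ y, sobKernel s p u x y ≤
      gg N s pb e u x + (J * (ia x + T2 * a x) + ∫⁻ y, k (x - y) * (T2 * a y)) := by
    intro x
    have hm1 : Measurable fun y => kkr N s pb e (dist x y) * ENNReal.ofReal (|u x - u y| ^ pb) :=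
      (kkr_meas.comp (by fun_prop : Measurable fun y => dist x y)).mul (by fun_prop)
    have hk1 : Measurable fun y => k (x - y) := hkm.comp (by fun_prop)
    rw [← hJx x, ← lintegral_mul_const _ hk1, ← lintegral_add_left (hk1.mul_const _), gg,
      ← lintegral_add_left hm1]
    refine lintegral_mono fun y => (H.fpt u x y).trans (le_of_eq ?_)
    simp only [hk, hT2, ha, hia]
    ring
  have hsw : ∫⁻ x, ∫⁻ y, k (x - y) * (T2 * a y) = J * (T2 * AA u pb) := by
    rw [lintegral_lintegral_swap (hkm2.mul (ham.comp measurable_snd |>.const_mul T2)).aemeasurable]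
    have : ∀ y, ∫⁻ x, k (x - y) * (T2 * a y) = J * (T2 * a y) := by
      intro y
      have : Measurable fun x => k (x - y) := hkm.comp (by fun_prop)
      rw [lintegral_mul_const _ this, hJy]
    simp only [this]
    rw [lintegral_const_mul _ (ham.const_mul T2), lintegral_const_mul _ ham, haA]
  refine (lintegral_mono hstep).trans ?_
  have hb : Measurable fun x => ia x + T2 * a x := hind.add (ham.const_mul T2)
  rw [lintegral_add_left (gg_meas hu), lintegral_add_left (hb.const_mul J),
    lintegral_const_mul _ hb, lintegral_add_left hind,
    lintegral_indicator_const hA, one_mul, lintegral_const_mul _ ham, haA, hsw, add_comm]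
  refine add_le_add ?_ le_rfl
  calc _ = J * volume A + (2 * (J * T2)) * AA u pb := by ring
    _ ≤ (J * volume A + 2 * (J * T2)) + (J * volume A + 2 * (J * T2)) * AA u pb :=
      add_le_add le_self_add (mul_le_mul_left (le_add_left le_rfl) _)
    _ = _ := by ring

theorem PH.nearle (H : PH s pm pb e p A) (u : Euc N → ℝ) :
    ∫⁻ x, gg N s pb e u x ≤ ∫⁻ x, ∫⁻ y, sobKernel s p u x y := by
  refine lintegral_mono fun x => lintegral_mono fun y => ?_
  unfold kkr sobKernel
  dsimp only
  split_ifs with h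
  · rw [H.near x y h, div_eq_mul_inv, mul_comm, ENNReal.ofReal_mul (by positivity)]
  · simp

def mK (s : ℝ) (p : Euc N → Euc N → ℝ) : Measure (Euc N × Euc N) :=
  (volume.prod volume).withDensity (fun z => ENNReal.ofReal ((dist z.1 z.2 ^ ((N:ℝ) + s * p z.1 z.2))⁻¹))

theorem PH.mKint (H : PH s pm pb e p A) {u : Euc N → ℝ} (hu : Measurable u) :
    ∫⁻ z, ENNReal.ofReal (|u z.1 - u z.2| ^ p z.1 z.2) ∂(mK s p) = ∫⁻ x, ∫⁻ y, sobKernel s p u x y := by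
  have := H.mp
  unfold mK
  rw [lintegral_withDensity_eq_lintegral_mul _ (by fun_prop) (by fun_prop)]
  rw [← lintegral_prod _ (H.meas_sob hu).aemeasurable]
  refine lintegral_congr fun z => ?_
  simp only [Pi.mul_apply]
  rw [← ENNReal.ofReal_mul (by positivity), sobKernel, div_eq_mul_inv, mul_comm]

variable [Fact (1 ≤ ENNReal.ofReal pb)]

theorem I0_inst (h1 : 1 < pb) : Inst (volume : Measure (Euc N)) (fun _ => pb) pb pb (TT N s pb e) where
  h1 := h1
  mP := measurable_const
  hP _ := ⟨le_rfl, le_rfl⟩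
  mT := TT_meas
  int u := (int_of_lint (by have := TT_meas u; fun_prop) (fun _ => by positivity) (by positivity) (AA_le u)).1
  bd R := by
    refine ⟨|R| ^ pb, by positivity, fun u hu => ?_⟩
    refine (int_of_lint (by have := TT_meas u; fun_prop) (fun _ => by positivity) (by positivity) (AA_le u)).2.trans ?_
    exact Real.rpow_le_rpow (norm_nonneg _) (hu.trans (le_abs_self _)) (by linarith)

theorem q_est (hs : 0 < s) (h1 : 1 < pb) (hN : s * pb < N) (he : 0 < e) {q : Euc N → ℝ}
    (mq : Measurable q) (hq : ∀ x, q x ∈ Icc pb (N * pb / (N - s * pb))) : ∀ B : ℝ, ∃ C : ℝ, 0 ≤ C ∧ ∀ u : W N s pb e,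
      ‖u‖ ≤ B → Integrable (fun x => |TT N s pb e u x| ^ q x) ∧
        ∫ x, |TT N s pb e u x| ^ q x ≤ C * ‖u‖ ^ pb := by
  intro B
  obtain ⟨C, hC, h⟩ := sobolev (N := N) (e := e) hs h1 hN he
  have hNN : (0:ℝ) < N := by nlinarith
  have hθ : 0 < 1 - s * pb / N := by rw [sub_pos, div_lt_one hNN]; exact hN
  set κ := (1 - s * pb / N)⁻¹ with hκ
  have hκ1 : 1 ≤ κ := by
    rw [hκ, one_le_inv₀ hθ]
    have : 0 ≤ s * pb / N := by positivity
    linarith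
  refine ⟨1 + (C * 2) ^ κ * (|B| ^ pb) ^ (κ - 1), by positivity, fun u hu => ?_⟩
  have hm := TT_meas u
  refine int_of_lint (by fun_prop) (fun _ => by positivity) (by positivity) ?_
  set t := ‖u‖ ^ pb with ht
  have ht0 : 0 ≤ t := by positivity
  have hA := AA_le u
  have hS := h _ hm (hA.trans_lt ENNReal.ofReal_lt_top)
  have hS2 : ∫⁻ x, ENNReal.ofReal (|TT N s pb e u x| ^ (N * pb / (N - s * pb))) ≤
      ENNReal.ofReal ((C * (t + t)) ^ κ) := by
    refine hS.trans ?_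
    rw [← ENNReal.ofReal_rpow_of_nonneg (by positivity) (by linarith), ENNReal.ofReal_mul hC.le,
      ENNReal.ofReal_add ht0 ht0]
    gcongr
    exact BB_le u
  calc ∫⁻ x, ENNReal.ofReal (|TT N s pb e u x| ^ q x)
      ≤ ∫⁻ x, (ENNReal.ofReal (|TT N s pb e u x| ^ pb) +
        ENNReal.ofReal (|TT N s pb e u x| ^ (N * pb / (N - s * pb)))) := by
        refine lintegral_mono fun x => ?_
        have hqx := hq x
        dsimp only
        rcases le_total |TT N s pb e u x| 1 with h | h
        · refine le_add_right (ENNReal.ofReal_le_ofReal ?_)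
          exact Real.rpow_le_rpow_of_exponent_ge_of_imp (abs_nonneg _) h hqx.1 (by intro _ h; linarith [hqx.1])
        · exact le_add_left (ENNReal.ofReal_le_ofReal (Real.rpow_le_rpow_of_exponent_le h hqx.2))
    _ ≤ ENNReal.ofReal t + ENNReal.ofReal ((C * (t + t)) ^ κ) := by
        rw [lintegral_add_left (by fun_prop)]
        exact add_le_add hA hS2
    _ ≤ _ := by
        rw [← ENNReal.ofReal_add ht0 (by positivity)]
        refine ENNReal.ofReal_le_ofReal ?_
        have h5 : (C * (t + t)) ^ κ = (C * 2) ^ κ * (t ^ (κ - 1) * t) := by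
          rw [show C * (t + t) = C * 2 * t by ring, Real.mul_rpow (by positivity) ht0]
          congr 1
          rw [← Real.rpow_add_one' ht0 (by linarith)]; simp
        rw [h5, add_mul, one_mul, ← mul_assoc]
        have h6 : t ≤ |B| ^ pb := Real.rpow_le_rpow (norm_nonneg _) (hu.trans (le_abs_self _)) (by linarith)
        have h7 : t ^ (κ - 1) ≤ (|B| ^ pb) ^ (κ - 1) := Real.rpow_le_rpow ht0 h6 (by linarith)
        gcongr

theorem Iq_inst (hs : 0 < s) (h1 : 1 < pb) (hN : s * pb < N) (he : 0 < e) {q : Euc N → ℝ} {qm : ℝ}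
    (mq : Measurable q) (hqm : pb ≤ qm) (hq : ∀ x, q x ∈ Icc qm (N * pb / (N - s * pb))) :
    Inst (volume : Measure (Euc N)) q qm (N * pb / (N - s * pb)) (TT N s pb e) where
  h1 := by linarith
  mP := mq
  hP := hq
  mT := TT_meas
  int u := by
    obtain ⟨C, _, h⟩ := q_est hs h1 hN he mq (fun x => ⟨hqm.trans (hq x).1, (hq x).2⟩) ‖u‖
    exact (h u le_rfl).1
  bd R := by
    obtain ⟨C, hC, h⟩ := q_est hs h1 hN he mq (fun x => ⟨hqm.trans (hq x).1, (hq x).2⟩) R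
    refine ⟨C * |R| ^ pb, by positivity, fun u hu => (h u hu).2.trans ?_⟩
    gcongr
    exact hu.trans (le_abs_self _)

theorem PH.bd1 (H : PH s pm pb e p A) : ∃ C : ℝ, 0 ≤ C ∧ ∀ u : W N s pb e,
    Integrable (fun z => |DD N s pb e u z| ^ p z.1 z.2) (mK s p) ∧
    ∫ z, |DD N s pb e u z| ^ p z.1 z.2 ∂(mK s p) ≤ C * (1 + ‖u‖ ^ pb) := by
  obtain ⟨C, hC⟩ := H.far
  refine ⟨C + 1, by positivity, fun u => ?_⟩
  have hm := TT_meas u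
  have := H.mp
  have ht : 0 ≤ ‖u‖ ^ pb := by positivity
  refine int_of_lint (by simp only [DD]; dsimp; fun_prop) (fun _ => by positivity) (by positivity) ?_
  refine (H.mKint hm).le.trans ((hC _ hm).trans ?_)
  refine (add_le_add (mul_le_mul_right (add_le_add le_rfl (AA_le u)) _) (BB_le u)).trans ?_
  rw [← ENNReal.ofReal_one, ← ENNReal.ofReal_add (by norm_num) ht, ← ENNReal.ofReal_coe_nnreal,
    ← ENNReal.ofReal_mul (by positivity), ← ENNReal.ofReal_add (by positivity) ht]
  refine ENNReal.ofReal_le_ofReal ?_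
  nlinarith

theorem PH.I1 (H : PH s pm pb e p A) :
    Inst (mK s p) (fun z => p z.1 z.2) pm pb (DD N s pb e) where
  h1 := H.h1
  mP := H.mp
  hP z := H.hP _ _
  mT u := by have := TT_meas u; simp only [DD]; dsimp; fun_prop
  int u := by obtain ⟨C, _, h⟩ := H.bd1; exact (h u).1
  bd R := by
    obtain ⟨C, hC, h⟩ := H.bd1
    refine ⟨C * (1 + |R| ^ pb), by positivity, fun u hu => (h u).2.trans ?_⟩
    have : ‖u‖ ^ pb ≤ |R| ^ pb := Real.rpow_le_rpow (norm_nonneg _) (hu.trans (le_abs_self _))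
      (by linarith [H.h1, H.hpp])
    gcongr

theorem PH.hn (H : PH s pm pb e p A) (u : W N s pb e) (I0 : Inst (volume : Measure (Euc N)) (fun _ => pb) pb pb (TT N s pb e)) :
    ‖u‖ ^ pb ≤ dPhi H.I1 u u + dPhi I0 u u := by
  rw [H.I1.dself, I0.dself]
  have hm := TT_meas u
  have h1 : 0 ≤ ∫ z, |DD N s pb e u z| ^ p z.1 z.2 ∂(mK s p) := integral_nonneg fun z => by positivity
  have h2 : 0 ≤ ∫ z, |TT N s pb e u z| ^ pb := integral_nonneg fun z => by positivity
  rw [← ENNReal.ofReal_le_ofReal_iff (by positivity), ENNReal.ofReal_add h1 h2,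
    ofReal_integral_eq_lintegral_ofReal (H.I1.int u) (ae_of_all _ fun z => by positivity),
    ofReal_integral_eq_lintegral_ofReal (I0.int u) (ae_of_all _ fun z => by positivity)]
  refine (norm_le u).trans ?_
  rw [add_comm]
  exact add_le_add ((H.nearle _).trans (H.mKint hm).ge) le_rfl

end insts


section cpt
variable {N : ℕ} {s pb e : ℝ}

theorem jens (h1 : 1 ≤ pb) {S : Set (Euc N)} (hS0 : volume S ≠ 0) (hSt : volume S ≠ ⊤)
    {f : Euc N → ℝ} (hfm : Measurable f) (hf : IntegrableOn f S) :
    volume S * ENNReal.ofReal (|⨍ y in S, f y| ^ pb) ≤ ∫⁻ y in S, ENNReal.ofReal (|f y| ^ pb) := by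
  rcases eq_or_ne (∫⁻ y in S, ENNReal.ofReal (|f y| ^ pb)) ⊤ with h | h
  · rw [h]; exact le_top
  have hi : IntegrableOn (fun y => |f y| ^ pb) S := by
    refine ⟨(by fun_prop : Measurable fun y => |f y| ^ pb).aestronglyMeasurable, ?_⟩
    rw [hasFiniteIntegral_iff_ofReal (ae_of_all _ fun y => by positivity)]
    exact h.lt_top
  have hJ := (convexOn_rpow h1).map_set_average_le (f := fun y => |f y|) (t := S) (μ := volume)
    (Real.continuous_rpow_const (by linarith)).continuousOn isClosed_Ici hS0 hSt
    (ae_of_all _ fun y => mem_Ici.2 (abs_nonneg _)) hf.abs hi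
  have h2 : |⨍ y in S, f y| ≤ ⨍ y in S, |f y| := by
    rw [setAverage_eq, setAverage_eq, smul_eq_mul, smul_eq_mul, abs_mul,
      abs_of_nonneg (inv_nonneg.2 measureReal_nonneg)]
    exact mul_le_mul_of_nonneg_left abs_integral_le_integral_abs (inv_nonneg.2 measureReal_nonneg)
  have h3 := (Real.rpow_le_rpow (abs_nonneg _) h2 (by linarith)).trans hJ
  have hV : 0 < volume.real S := ENNReal.toReal_pos hS0 hSt
  rw [setAverage_eq _ (fun y => |f y| ^ pb), smul_eq_mul, ← div_eq_inv_mul, le_div_iff₀ hV] at h3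
  rw [← ofReal_integral_eq_lintegral_ofReal hi (ae_of_all _ fun y => by positivity),
    ← ENNReal.ofReal_toReal hSt, ← ENNReal.ofReal_mul ENNReal.toReal_nonneg]
  refine ENNReal.ofReal_le_ofReal ?_
  rw [mul_comm]; exact h3

def Chh (N : ℕ) (s pb h : ℝ) : ℝ := (2 * h) ^ ((N:ℝ) + s * pb) / (h ^ N * om N)

theorem avg_est (hs : 0 < s) (h1 : 1 ≤ pb) {h : ℝ} (hh : 0 < h) (hhe : 2 * h ≤ e) {u : Euc N → ℝ}
    (hu : Measurable u) {x z : Euc N} (hxz : dist x z < h) (hi : IntegrableOn u (Metric.ball z h)) :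
    ENNReal.ofReal (|u x - ⨍ y in Metric.ball z h, u y| ^ pb) ≤
      ENNReal.ofReal (Chh N s pb h) * gg N s pb e u x := by
  have hom := om_pos (N := N)
  set V := volume (Metric.ball z h) with hV
  have hVe : V = ENNReal.ofReal (h ^ N * om N) := vol_ball z hh
  have hV0 : V ≠ 0 := (Metric.measure_ball_pos _ _ hh).ne'
  have hVt : V ≠ ⊤ := measure_ball_lt_top.ne
  have hcst : IntegrableOn (fun _ => u x) (Metric.ball z h) volume := integrableOn_const hVt
  have hJ := jens (f := fun y => u x - u y) h1 hV0 hVt (by fun_prop)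
    (hcst.sub hi)
  have h2 : ⨍ y in Metric.ball z h, (u x - u y) = u x - ⨍ y in Metric.ball z h, u y := by
    rw [setAverage_eq, setAverage_eq, integral_sub hcst hi, smul_sub,
      ← setAverage_eq, setAverage_const hV0 hVt]
  rw [h2] at hJ
  have h3 := hJ.trans (loc_est (e := e) hs h1 (by positivity : 0 < 2 * h) hhe u x measurableSet_ball (by
    intro y hy
    have := dist_triangle y z x
    rw [dist_comm z x] at this
    simp only [Metric.mem_ball] at hy ⊢
    linarith))
  rw [← ENNReal.mul_le_mul_iff_right hV0 hVt]
  refine h3.trans (le_of_eq ?_)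
  rw [← mul_assoc, hVe, ← ENNReal.ofReal_mul (by positivity), Chh]
  congr 2
  field_simp

def hj (e : ℝ) (j : ℕ) : ℝ := e / (2 * (j + 1))

theorem hj_pos (he : 0 < e) (j : ℕ) : 0 < hj e j := by unfold hj; positivity

theorem hj_le (he : 0 < e) (j : ℕ) : 2 * hj e j ≤ e := by
  unfold hj
  rw [mul_div_assoc', div_le_iff₀ (by positivity)]
  have : (0:ℝ) ≤ j := by positivity
  nlinarith

theorem Chh_lim (hs : 0 < s) (h1 : 1 ≤ pb) (he : 0 < e) :
    Tendsto (fun j => Chh N s pb (hj e j)) atTop (𝓝 0) := by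
  have h0 : Tendsto (fun j => hj e j) atTop (𝓝 0) := by
    unfold hj
    have := (tendsto_one_div_add_atTop_nhds_zero_nat (𝕜 := ℝ)).const_mul (e / 2)
    rw [mul_zero] at this
    refine this.congr fun n => ?_
    field_simp
  have hsp : 0 < s * pb := by positivity
  have h2 := ((h0.rpow_const (p := s * pb) (Or.inr hsp.le)).const_mul (2 ^ ((N:ℝ) + s * pb) / om N))
  rw [Real.zero_rpow hsp.ne', mul_zero] at h2
  refine h2.congr fun j => ?_
  have hp := hj_pos he j
  rw [Chh, Real.mul_rpow (by norm_num) hp.le, Real.rpow_add hp, Real.rpow_natCast]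
  have hom := om_pos (N := N)
  field_simp

def nu (N : ℕ) : Measure (Euc N) :=
  volume.withDensity fun x => ENNReal.ofReal ((1 + ‖x‖) ^ (-((N:ℝ) + 1)))

instance : IsFiniteMeasure (nu N) :=
  isFiniteMeasure_withDensity_ofReal (integrable_one_add_norm (by simp)).2

theorem nu_le : nu N ≤ volume := by
  conv_rhs => rw [← withDensity_one (μ := (volume : Measure (Euc N)))]
  refine withDensity_mono (ae_of_all _ fun x => ?_)
  simp only [Pi.one_apply, ENNReal.ofReal_le_one]
  exact Real.rpow_le_one_of_one_le_of_nonpos (by linarith [norm_nonneg x])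
    (by have : (0:ℝ) ≤ N := by positivity
        linarith)

theorem vol_ac : (volume : Measure (Euc N)) ≪ nu N := by
  refine withDensity_absolutelyContinuous' (by fun_prop) (ae_of_all _ fun x => ?_)
  have : 0 < (1 + ‖x‖) ^ (-((N:ℝ) + 1)) := by positivity
  simpa using this

def ctr (N : ℕ) (i : ℕ) : Euc N := TopologicalSpace.denseSeq (Euc N) i

theorem W_locint [Fact (1 ≤ ENNReal.ofReal pb)] (u : W N s pb e) (z : Euc N) (h : ℝ) :
    IntegrableOn (TT N s pb e u) (Metric.ball z h) := by
  have : Fact (volume (Metric.ball z h) < ⊤) := ⟨measure_ball_lt_top⟩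
  exact memLp_one_iff_integrable.1 ((TT_mem u).restrict _ |>.mono_exponent Fact.out)

variable [Fact (1 ≤ ENNReal.ofReal pb)]

variable (N s pb e) in
def ca (j i : ℕ) : W N s pb e →ₗ[ℝ] ℝ where
  toFun u := ⨍ y in Metric.ball (ctr N i) (hj e j), TT N s pb e u y
  map_add' u v := by
    simp only [setAverage_eq, map_add, Pi.add_apply]
    rw [integral_add (W_locint u _ _) (W_locint v _ _), smul_add]
  map_smul' c u := by
    simp only [setAverage_eq, map_smul, Pi.smul_apply, smul_eq_mul, RingHom.id_apply]
    rw [integral_const_mul]; ring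

theorem ca_bd (he : 0 < e) (j i : ℕ) (u : W N s pb e) :
    |ca N s pb e j i u| ^ pb ≤ (hj e j ^ N * om N)⁻¹ * ‖u‖ ^ pb := by
  have h1 := pb1 (pb := pb)
  have hp := hj_pos he j
  have hom := om_pos (N := N)
  have h := (jens h1 (Metric.measure_ball_pos _ (ctr N i) hp).ne' measure_ball_lt_top.ne (TT_meas u)
    (W_locint u _ _)).trans ((setLIntegral_le_lintegral _ _).trans (AA_le u))
  rw [vol_ball _ hp, ← ENNReal.ofReal_mul (by positivity), ENNReal.ofReal_le_ofReal_iff (by positivity)] at h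
  rw [← div_eq_inv_mul, le_div_iff₀ (by positivity), mul_comm]
  exact h

theorem C0 (hs : 0 < s) (he : 0 < e) {ι : Type*} {l : Filter ι} [l.IsCountablyGenerated]
    {u : ι → W N s pb e} {R : ℝ} (hR : ∀ n, ‖u n‖ ≤ R)
    (hc : ∀ j i, Tendsto (fun n => ca N s pb e j i (u n)) l (𝓝 0)) :
    Tendsto (fun n => ∫⁻ x, ENNReal.ofReal (|TT N s pb e (u n) x| ^ pb) ∂(nu N)) l (𝓝 0) := by
  have h1 := pb1 (pb := pb)
  have hpb : 0 < pb := by linarith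
  rw [ENNReal.tendsto_nhds_zero]
  intro ε hε
  have hlimj : Tendsto (fun j => ENNReal.ofReal (2 ^ pb * (Chh N s pb (hj e j) * |R| ^ pb))) atTop (𝓝 0) := by
    rw [← ENNReal.ofReal_zero]
    refine ENNReal.tendsto_ofReal ?_
    have := ((Chh_lim (N := N) hs h1 he).mul_const (|R| ^ pb)).const_mul (2 ^ pb)
    simpa using this
  obtain ⟨j, hj1⟩ := ((ENNReal.tendsto_nhds_zero.1 hlimj) (ε / 2) (ENNReal.half_pos hε.ne')).exists
  have hp := hj_pos he j
  have hex : ∀ x : Euc N, ∃ i, dist x (ctr N i) < hj e j := by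
    intro x
    exact (TopologicalSpace.denseRange_denseSeq (Euc N)).exists_dist_lt x hp
  classical
  set κ : Euc N → ℕ := fun x => Nat.find (hex x) with hκ
  have hκm : Measurable κ := measurable_find hex fun k => measurableSet_lt (by fun_prop) measurable_const
  have hκs : ∀ x, dist x (ctr N (κ x)) < hj e j := fun x => Nat.find_spec (hex x)
  set G : ι → Euc N → ℝ≥0∞ := fun n x => ENNReal.ofReal (|ca N s pb e j (κ x) (u n)| ^ pb) with hG
  have hGm : ∀ n, Measurable (G n) := fun n =>
    (measurable_from_nat (f := fun k => ENNReal.ofReal (|ca N s pb e j k (u n)| ^ pb))).comp hκm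
  have hom := om_pos (N := N)
  have hGl : Tendsto (fun n => ∫⁻ x, G n x ∂(nu N)) l (𝓝 (∫⁻ _, 0 ∂(nu N))) := by
    refine tendsto_lintegral_filter_of_dominated_convergence
      (fun _ => ENNReal.ofReal ((hj e j ^ N * om N)⁻¹ * |R| ^ pb)) (Eventually.of_forall hGm) ?_ ?_ ?_
    · refine Eventually.of_forall fun n => ae_of_all _ fun x => ENNReal.ofReal_le_ofReal ?_
      refine (ca_bd he j _ (u n)).trans ?_
      gcongr
      exact (hR n).trans (le_abs_self _)
    · simp only [lintegral_const]
      exact ENNReal.mul_ne_top (by simp) (measure_ne_top _ _)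
    · refine ae_of_all _ fun x => ?_
      rw [← ENNReal.ofReal_zero]
      refine ENNReal.tendsto_ofReal ?_
      have := (hc j (κ x)).abs.rpow_const (p := pb) (Or.inr hpb.le)
      simpa [Real.zero_rpow hpb.ne'] using this
  rw [lintegral_zero] at hGl
  have hGl2 := ENNReal.Tendsto.const_mul (a := ENNReal.ofReal (2 ^ pb)) hGl (Or.inr (by simp))
  rw [mul_zero] at hGl2
  filter_upwards [(ENNReal.tendsto_nhds_zero.1 hGl2) (ε / 2) (ENNReal.half_pos hε.ne')] with n hn
  have hm := TT_meas (u n)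
  have hpt : ∀ x, ENNReal.ofReal (|TT N s pb e (u n) x| ^ pb) ≤ ENNReal.ofReal (2 ^ pb) *
      (ENNReal.ofReal (Chh N s pb (hj e j)) * gg N s pb e (TT N s pb e (u n)) x) +
        ENNReal.ofReal (2 ^ pb) * G n x := by
    intro x
    rw [← mul_add]
    refine le_trans ?_ (mul_le_mul_right (add_le_add (avg_est hs h1 hp (hj_le he j) hm (hκs x)
      (W_locint (u n) _ _)) le_rfl) _)
    rw [hG, ← ENNReal.ofReal_add (by positivity) (by positivity), ← ENNReal.ofReal_mul (by positivity)]
    refine ENNReal.ofReal_le_ofReal ?_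
    refine le_trans ?_ (add_rpow_le2 hpb.le le_rfl (abs_nonneg _) (abs_nonneg _))
    refine Real.rpow_le_rpow (abs_nonneg _) ?_ hpb.le
    refine le_trans (le_of_eq ?_) (abs_add_le _ _)
    congr 1
    simp [ca]
  have hCh : 0 ≤ Chh N s pb (hj e j) := by unfold Chh; positivity
  calc _ ≤ ∫⁻ x, (ENNReal.ofReal (2 ^ pb) * (ENNReal.ofReal (Chh N s pb (hj e j)) *
      gg N s pb e (TT N s pb e (u n)) x) + ENNReal.ofReal (2 ^ pb) * G n x) ∂(nu N) := lintegral_mono hpt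
    _ = ENNReal.ofReal (2 ^ pb) * (ENNReal.ofReal (Chh N s pb (hj e j)) *
        ∫⁻ x, gg N s pb e (TT N s pb e (u n)) x ∂(nu N)) + ENNReal.ofReal (2 ^ pb) * ∫⁻ x, G n x ∂(nu N) := by
        rw [lintegral_add_right _ ((hGm n).const_mul _), lintegral_const_mul _ (hGm n),
          lintegral_const_mul _ ((gg_meas hm).const_mul _), lintegral_const_mul _ (gg_meas hm)]
    _ ≤ ε / 2 + ε / 2 := by
        refine add_le_add (le_trans ?_ hj1) hn
        rw [ENNReal.ofReal_mul (by positivity), ENNReal.ofReal_mul hCh]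
        refine mul_le_mul_right (mul_le_mul_right ?_ _) _
        refine (lintegral_mono' nu_le le_rfl).trans ((BB_le (u n)).trans (ENNReal.ofReal_le_ofReal ?_))
        exact Real.rpow_le_rpow (norm_nonneg _) ((hR n).trans (le_abs_self _)) hpb.le
    _ = ε := ENNReal.add_halves ε

end cpt


theorem fatou0 {Z : Type*} [MeasurableSpace Z] {m : Measure Z} {w : ℕ → Z → ℝ≥0∞} {v : Z → ℝ≥0∞}
    (hw : ∀ n, Measurable (w n)) (hl : ∀ᵐ z ∂m, Tendsto (fun n => w n z) atTop (𝓝 (v z))) {K : ℝ≥0∞}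
    (hK : ∀ n, ∫⁻ z, w n z ∂m ≤ K) : ∫⁻ z, v z ∂m ≤ K := by
  have h1 : ∫⁻ z, v z ∂m = ∫⁻ z, liminf (fun n => w n z) atTop ∂m :=
    lintegral_congr_ae (hl.mono fun z hz => hz.liminf_eq.symm)
  rw [h1]
  refine (lintegral_liminf_le hw).trans ?_
  exact liminf_le_of_le (by isBoundedDefault) fun b hb => by
    obtain ⟨n, hn⟩ := hb.exists
    exact hn.trans (hK n)

section cpt2
variable {N : ℕ} {s pb e : ℝ}

theorem ae_DD {u : ℕ → W N s pb e} {v : W N s pb e}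
    (h : ∀ᵐ x, Tendsto (fun n => TT N s pb e (u n) x) atTop (𝓝 (TT N s pb e v x)))
    {m : Measure (Euc N × Euc N)} (hm : m ≪ volume.prod volume) :
    ∀ᵐ z ∂m, Tendsto (fun n => DD N s pb e (u n) z) atTop (𝓝 (DD N s pb e v z)) := by
  refine hm.ae_le ?_
  filter_upwards [Measure.quasiMeasurePreserving_fst.ae h, Measure.quasiMeasurePreserving_snd.ae h]
    with z h1 h2 using h1.sub h2

variable [Fact (1 ≤ ENNReal.ofReal pb)]

theorem C1 (hs : 0 < s) (he : 0 < e) {ι : Type*} {l : Filter ι} [l.IsCountablyGenerated]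
    {u : ι → W N s pb e} {R : ℝ} (hR : ∀ n, ‖u n‖ ≤ R)
    (hc : ∀ j i, Tendsto (fun n => ca N s pb e j i (u n)) l (𝓝 0)) :
    Tendsto (fun n => eLpNorm (TT N s pb e (u n)) (ENNReal.ofReal pb) (nu N)) l (𝓝 0) := by
  have h1 := pb1 (pb := pb)
  have h0 : 0 < pb := by linarith
  have h := ((ENNReal.continuous_rpow_const (y := 1 / pb)).tendsto 0).comp (C0 hs he hR hc)
  rw [ENNReal.zero_rpow_of_pos (by positivity)] at h
  refine h.congr fun n => ?_
  rw [eLpNorm_eq_lintegral_rpow_enorm_toReal (by simpa using h0) (by simp), ENNReal.toReal_ofReal h0.le]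
  simp only [Function.comp]
  congr 1
  refine lintegral_congr fun z => ?_
  rw [← ENNReal.ofReal_rpow_of_nonneg (abs_nonneg _) h0.le, ← Real.norm_eq_abs, ofReal_norm]

theorem ca_bd1 (he : 0 < e) (j i : ℕ) : ∃ C, 0 ≤ C ∧ ∀ u : W N s pb e, |ca N s pb e j i u| ≤ C * ‖u‖ := by
  have h1 := pb1 (pb := pb)
  have h0 : 0 < pb := by linarith
  have hp := hj_pos he j
  have hom := om_pos (N := N)
  refine ⟨((hj e j ^ N * om N)⁻¹) ^ (1 / pb), by positivity, fun u => ?_⟩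
  have h := Real.rpow_le_rpow (by positivity) (ca_bd he j i u) (z := 1 / pb) (by positivity)
  rw [← Real.rpow_mul (abs_nonneg _), mul_one_div_cancel h0.ne', Real.rpow_one,
    Real.mul_rpow (by positivity) (by positivity), ← Real.rpow_mul (norm_nonneg _),
    mul_one_div_cancel h0.ne', Real.rpow_one] at h
  exact h

theorem W_compact (hs : 0 < s) (he : 0 < e) (u : ℕ → W N s pb e) (R : ℝ) (hR : ∀ n, ‖u n‖ ≤ R) :
    ∃ φ : ℕ → ℕ, StrictMono φ ∧ ∃ v : W N s pb e,
      ∀ᵐ z, Tendsto (fun n => TT N s pb e (u (φ n)) z) atTop (𝓝 (TT N s pb e v z)) := by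
  have h1 := pb1 (pb := pb)
  have h0 : 0 < pb := by linarith
  have hR0 : 0 ≤ R := (norm_nonneg _).trans (hR 0)
  choose C hC0 hC using fun k : ℕ × ℕ => ca_bd1 (N := N) (s := s) (pb := pb) he k.1 k.2
  have hK : IsCompact (Set.univ.pi fun k : ℕ × ℕ => Icc (-(C k * R)) (C k * R)) :=
    isCompact_univ_pi fun k => isCompact_Icc
  obtain ⟨c, -, φ, hφ, hlim⟩ := hK.tendsto_subseq (x := fun n k => ca N s pb e k.1 k.2 (u n)) (by
    intro n k _
    exact abs_le.1 ((hC k (u n)).trans (mul_le_mul_of_nonneg_left (hR n) (hC0 k))))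
  rw [tendsto_pi_nhds] at hlim
  have hb : ∀ n : ℕ × ℕ, ‖u (φ n.1) - u (φ n.2)‖ ≤ R + R := fun n =>
    (norm_sub_le _ _).trans (add_le_add (hR _) (hR _))
  have hcau := C1 (l := (atTop : Filter (ℕ × ℕ))) hs he hb (by
    intro j i
    have h := hlim (j, i)
    have h2 := (h.comp tendsto_fst).sub (h.comp (tendsto_snd (f := (atTop : Filter ℕ))))
    rw [sub_self, prod_atTop_atTop_eq] at h2
    refine h2.congr fun n => ?_
    simp [map_sub])
  have hex : ∀ k : ℕ, ∃ M, ∀ n m, M ≤ n → M ≤ m →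
      eLpNorm (TT N s pb e (u (φ n)) - TT N s pb e (u (φ m))) (ENNReal.ofReal pb) (nu N) <
        (1 / 2 : ℝ≥0∞) ^ k := by
    intro k
    have h := hcau.eventually (gt_mem_nhds (ENNReal.pow_pos (by simp) k : (0 : ℝ≥0∞) < (1 / 2) ^ k))
    obtain ⟨M, hM⟩ := eventually_atTop.1 h
    refine ⟨max M.1 M.2, fun n m hn hm => ?_⟩
    have := hM (n, m) ⟨(le_max_left _ _).trans hn, (le_max_right _ _).trans hm⟩
    rwa [map_sub] at this
  choose M hM using hex
  set σ : ℕ → ℕ := fun k => (∑ i ∈ Finset.range (k + 1), M i) + k with hσ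
  have hσm : StrictMono σ := strictMono_nat_of_lt_succ fun k => by
    simp only [hσ, Finset.sum_range_succ _ (k + 1)]; omega
  have hσM : ∀ k n, k ≤ n → M k ≤ σ n := fun k n hkn => by
    have : M k ≤ ∑ i ∈ Finset.range (n + 1), M i :=
      Finset.single_le_sum (f := M) (fun _ _ => Nat.zero_le _) (Finset.mem_range.2 (by omega))
    simp only [hσ]; omega
  have hae := Lp.ae_tendsto_of_cauchy_eLpNorm (μ := nu N) (p := ENNReal.ofReal pb)
    (f := fun k => TT N s pb e (u (φ (σ k)))) (fun n => (TT_meas _).aestronglyMeasurable) Fact.out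
    (B := fun k => (1 / 2 : ℝ≥0∞) ^ k) (by
      rw [ENNReal.tsum_geometric]; simp) (fun k n m hn hm => hM k _ _ (hσM k n hn) (hσM k m hm))
  replace hae := vol_ac.ae_le hae
  obtain ⟨v, hvm, hv⟩ := measurable_limit_of_tendsto_metrizable_ae
    (fun n => (TT_meas (u (φ (σ n)))).aemeasurable) hae
  have hRp : ∀ n, ENNReal.ofReal (‖u n‖ ^ pb) ≤ ENNReal.ofReal (R ^ pb) := fun n =>
    ENNReal.ofReal_le_ofReal (Real.rpow_le_rpow (norm_nonneg _) (hR n) h0.le)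
  have hcont : Continuous fun t : ℝ => ENNReal.ofReal (|t| ^ pb) :=
    ENNReal.continuous_ofReal.comp (continuous_abs.rpow_const fun _ => Or.inr h0.le)
  have hvW : v ∈ Wsub N s pb e := by
    rw [memW_iff h1 hvm]
    constructor
    · refine lt_of_le_of_lt (fatou0 (w := fun n x => ENNReal.ofReal (|TT N s pb e (u (φ (σ n))) x| ^ pb))
        (fun n => hcont.measurable.comp (TT_meas _)) (hv.mono fun x hx => (hcont.tendsto _).comp hx)
        fun n => (AA_le _).trans (hRp _)) ENNReal.ofReal_lt_top
    · rw [← gg_int hvm]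
      have hm2 : ∀ n, Measurable fun z : Euc N × Euc N => ENNReal.ofReal (|TT N s pb e (u (φ (σ n))) z.1 -
          TT N s pb e (u (φ (σ n))) z.2| ^ pb) := fun n => by
        have := TT_meas (u (φ (σ n)))
        fun_prop
      have hb2 : ∀ n, ∫⁻ z, ENNReal.ofReal (|TT N s pb e (u (φ (σ n))) z.1 -
          TT N s pb e (u (φ (σ n))) z.2| ^ pb) ∂(mu1 N s pb e) ≤ ENNReal.ofReal (R ^ pb) := fun n => by
        rw [gg_int (TT_meas _)]
        exact (BB_le _).trans (hRp _)
      refine lt_of_le_of_lt (fatou0 hm2 ?_ hb2) ENNReal.ofReal_lt_top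
      refine (withDensity_absolutelyContinuous _ _).ae_le ?_
      filter_upwards [Measure.quasiMeasurePreserving_fst.ae hv, Measure.quasiMeasurePreserving_snd.ae hv]
        with z h1 h2
      exact (hcont.tendsto _).comp (h1.sub h2)
  exact ⟨φ ∘ σ, hφ.comp hσm, (⟨v, hvW⟩ : Wsub N s pb e), hv⟩

theorem W_psi (hs : 0 < s) (he : 0 < e) {q : Euc N → ℝ} {q1 q2 : ℝ} {f : Euc N → ℝ → ℝ}
    (Iq : Inst volume q q1 q2 (TT N s pb e)) (S : SubC volume q f) :
    ∀ η > 0, ∃ d, ∃ ψ : W N s pb e →ₗ[ℝ] (Fin d → ℝ), Continuous ψ ∧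
      ∀ u, ψ u = 0 → ‖u‖ = 1 → |Psi volume f (TT N s pb e) u| ≤ η := by
  intro η hη
  by_contra hcon
  push Not at hcon
  set ψ : ∀ d : ℕ, W N s pb e →ₗ[ℝ] (Fin d → ℝ) := fun d =>
    LinearMap.pi fun k : Fin d => ca N s pb e (Nat.unpair k).1 (Nat.unpair k).2 with hψ
  have hψc : ∀ d, Continuous (ψ d) := by
    intro d
    refine continuous_pi fun k => ?_
    obtain ⟨C, _, hC⟩ := ca_bd1 (N := N) (s := s) (pb := pb) he (Nat.unpair k).1 (Nat.unpair k).2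
    exact AddMonoidHomClass.continuous_of_bound (ca N s pb e (Nat.unpair k).1 (Nat.unpair k).2) C
      fun u => hC u
  choose u hu0 hu1 huη using fun d => hcon d (ψ d) (hψc d)
  have hz := C1 (l := (atTop : Filter ℕ)) hs he (fun n => (hu1 n).le) (by
    intro j i
    refine tendsto_const_nhds.congr' ?_
    filter_upwards [eventually_gt_atTop (Nat.pair j i)] with d hd
    have := congrFun (hu0 d) ⟨Nat.pair j i, hd⟩
    simpa [hψ] using this.symm)
  have hm : TendstoInMeasure (nu N) (fun n => TT N s pb e (u n)) atTop 0 := by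
    refine tendstoInMeasure_of_tendsto_eLpNorm (p := ENNReal.ofReal pb)
      (by have := pb1 (pb := pb); simp; linarith)
      (fun n => (TT_meas _).aestronglyMeasurable) aestronglyMeasurable_zero ?_
    simpa using hz
  obtain ⟨ns, -, hns⟩ := hm.exists_seq_tendsto_ae
  have hl := S.psi_cont Iq (u := fun n => u (ns n)) (v := 0) (R := 1) (fun n => (hu1 _).le) (by
    filter_upwards [vol_ac.ae_le hns] with x hx
    simpa using hx)
  have h00 : Psi volume f (TT N s pb e) 0 = 0 := by simp [Psi, SubC.FF0]
  rw [h00] at hl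
  have h2 := hl.abs
  rw [abs_zero] at h2
  obtain ⟨n, hn⟩ := (h2.eventually (gt_mem_nhds hη)).exists
  exact absurd hn (not_lt.2 (huη _).le)

end cpt2


theorem pt_sub {a r q δ Q2 ε t t' : ℝ} (ha : 0 ≤ a) (hr : 1 < r) (hδ : 0 < δ) (hq : r + δ ≤ q)
    (hQ : q ≤ Q2) (hε : 0 < ε) (hε1 : ε ≤ 1) (ht : 0 ≤ t) (ht' : 0 ≤ t') :
    a * t ^ (r - 1) * t' ≤ (1 / ε) ^ (Q2 / δ) * a ^ (q / (q - r)) + ε * (t ^ q + t' ^ q) := by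
  have hqr : 0 < q - r := by linarith
  set M := max t t' with hM
  have hM0 : 0 ≤ M := ht.trans (le_max_left _ _)
  have hA : 0 ≤ (1 / ε) ^ (Q2 / δ) * a ^ (q / (q - r)) := by positivity
  have h1 : a * t ^ (r - 1) * t' ≤ a * M ^ r := by
    have : M ^ r = M ^ (r - 1) * M := by
      rcases hM0.eq_or_lt with h | h
      · rw [← h, Real.zero_rpow (by linarith), mul_zero]
      · rw [← Real.rpow_add_one h.ne']; ring_nf
    rw [this, mul_assoc]
    refine mul_le_mul_of_nonneg_left ?_ ha
    exact mul_le_mul (Real.rpow_le_rpow ht (le_max_left _ _) (by linarith)) (le_max_right _ _) ht'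
      (by positivity)
  have hMq : M ^ q ≤ t ^ q + t' ^ q := by
    have a1 : 0 ≤ t ^ q := by positivity
    have a2 : 0 ≤ t' ^ q := by positivity
    rcases le_total t t' with h | h
    · rw [hM, max_eq_right h]; linarith
    · rw [hM, max_eq_left h]; linarith
  refine h1.trans ?_
  rcases le_or_gt a (ε * M ^ (q - r)) with h | h
  · have h3 : a * M ^ r ≤ ε * M ^ q := by
      have : M ^ q = M ^ (q - r) * M ^ r := by
        rcases hM0.eq_or_lt with h | h
        · rw [← h, Real.zero_rpow (by linarith), Real.zero_rpow (by linarith), zero_mul]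
        · rw [← Real.rpow_add h]; ring_nf
      rw [this, ← mul_assoc]
      exact mul_le_mul_of_nonneg_right h (by positivity)
    have := mul_le_mul_of_nonneg_left hMq hε.le
    linarith
  · have ha' : 0 < a := lt_of_le_of_lt (by positivity) h
    have h4 : M ^ (q - r) ≤ 1 / ε * a := by
      rw [one_div_mul_eq_div, le_div_iff₀ hε]; linarith
    have h5 := Real.rpow_le_rpow (by positivity) h4 (z := r / (q - r)) (by positivity)
    rw [← Real.rpow_mul hM0, mul_div_cancel₀ _ hqr.ne', Real.mul_rpow (by positivity) ha] at h5
    have h6 : (1 / ε) ^ (r / (q - r)) ≤ (1 / ε) ^ (Q2 / δ) := by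
      refine Real.rpow_le_rpow_of_exponent_le (by rwa [le_div_iff₀ hε, one_mul]) ?_
      exact div_le_div₀ (by linarith) (by linarith) hδ (by linarith)
    have h7 : a ^ (q / (q - r)) = a ^ (r / (q - r)) * a := by
      rw [← Real.rpow_add_one ha'.ne']; congr 1; field_simp; ring
    have h8 : a * M ^ r ≤ (1 / ε) ^ (Q2 / δ) * a ^ (q / (q - r)) := by
      rw [h7, ← mul_assoc, mul_comm a]
      refine mul_le_mul_of_nonneg_right (h5.trans ?_) ha
      exact mul_le_mul_of_nonneg_right h6 (by positivity)
    have : 0 ≤ ε * (t ^ q + t' ^ q) := by positivity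
    linarith

theorem memvar_int {N : ℕ} {m : Measure (Euc N)} {h a : Euc N → ℝ} (hh : Measurable h) (ha : MemVarLp m h a) :
    Integrable (fun x => |a x| ^ h x) m := by
  refine ⟨((ha.1.aemeasurable.abs).pow hh.aemeasurable).aestronglyMeasurable, ?_⟩
  rw [hasFiniteIntegral_iff_ofReal (ae_of_all _ fun y => by positivity)]
  exact ha.2

theorem f_part {N : ℕ} {q : Euc N → ℝ} (mq : Measurable q) {Q2 : ℝ} (hQ2 : ∀ x, q x ≤ Q2)
    {f : Euc N → ℝ → ℝ} (hf_meas : ∀ t : ℝ, Measurable fun x => f x t)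
    (hf_cont : ∀ᵐ x ∂(volume : Measure (Euc N)), Continuous fun t => f x t)
    (hf_odd : ∀ᵐ x ∂(volume : Measure (Euc N)), ∀ t : ℝ, f x (-t) = - f x t)
    {m : ℕ} {r a : Fin m → Euc N → ℝ} (hr : ∀ j, Continuous (r j)) (hr1 : ∀ j x, 1 < r j x)
    (hd : ∀ j, ∃ δ > (0 : ℝ), ∀ x, r j x + δ ≤ q x)
    (ha : ∀ j, MemVarLp volume (fun x => q x / (q x - r j x)) (a j))
    (ha0 : ∀ j, ∀ᵐ x ∂(volume : Measure (Euc N)), 0 < a j x)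
    (hb : ∀ᵐ x ∂(volume : Measure (Euc N)), ∀ t : ℝ, |f x t| ≤ ∑ j, a j x * |t| ^ (r j x - 1)) :
    ∃ g : Euc N → ℝ → ℝ, SubC volume q g ∧ ∀ᵐ x ∂(volume : Measure (Euc N)), ∀ t, g x t = f x t := by
  classical
  have hall : ∀ᵐ x ∂(volume : Measure (Euc N)), (Continuous fun t => f x t) ∧ (∀ t : ℝ, f x (-t) = - f x t) ∧
      (∀ j, 0 < a j x) ∧ ∀ t : ℝ, |f x t| ≤ ∑ j, a j x * |t| ^ (r j x - 1) := by
    filter_upwards [hf_cont, hf_odd, ae_all_iff.2 ha0, hb] with x h1 h2 h3 h4 using ⟨h1, h2, h3, h4⟩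
  set B := toMeasurable volume {x | ¬ ((Continuous fun t => f x t) ∧ (∀ t : ℝ, f x (-t) = - f x t) ∧
      (∀ j, 0 < a j x) ∧ ∀ t : ℝ, |f x t| ≤ ∑ j, a j x * |t| ^ (r j x - 1))} with hB
  have hBm : MeasurableSet B := measurableSet_toMeasurable _ _
  have hB0 : volume B = 0 := by rw [hB, measure_toMeasurable]; exact ae_iff.1 hall
  have hgood : ∀ x, x ∉ B → ((Continuous fun t => f x t) ∧ (∀ t : ℝ, f x (-t) = - f x t) ∧
      (∀ j, 0 < a j x) ∧ ∀ t : ℝ, |f x t| ≤ ∑ j, a j x * |t| ^ (r j x - 1)) := by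
    intro x hx
    by_contra h
    exact hx (subset_toMeasurable _ _ h)
  choose δ hδ0 hδ using hd
  refine ⟨fun x t => if x ∈ B then 0 else f x t, ⟨?_, ?_, ?_, ?_⟩, ?_⟩
  · intro t
    exact Measurable.ite hBm measurable_const (hf_meas t)
  · intro x
    by_cases hx : x ∈ B
    · simp only [hx, if_true]; exact continuous_const
    · simp only [hx, if_false]; exact (hgood x hx).1
  · intro x t
    by_cases hx : x ∈ B
    · simp [hx]
    · simp only [hx, if_false]; exact (hgood x hx).2.1 t
  · intro ε hε
    set ε' := min ε 1 / (m + 1) with hε'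
    have he0 : 0 < ε' := by have := lt_min hε one_pos; positivity
    have he1 : ε' ≤ 1 := by
      rw [hε', div_le_iff₀ (by positivity)]
      have := min_le_right ε 1
      have : (0:ℝ) ≤ m := by positivity
      linarith
    have hem : m * ε' ≤ ε := by
      rw [hε', mul_div_assoc', div_le_iff₀ (by positivity)]
      have := min_le_left ε 1
      have : (0:ℝ) ≤ m := by positivity
      nlinarith
    refine ⟨fun x => ∑ j, (1 / ε') ^ (Q2 / δ j) * |a j x| ^ (q x / (q x - r j x)), ?_, ?_, ?_⟩
    · refine integrable_finsetSum _ fun j _ => (memvar_int ?_ (ha j)).const_mul _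
      have := (hr j).measurable
      fun_prop
    · intro x; positivity
    · intro x t t'
      have hG : 0 ≤ ∑ j, (1 / ε') ^ (Q2 / δ j) * |a j x| ^ (q x / (q x - r j x)) := by positivity
      have hT : 0 ≤ |t| ^ q x + |t'| ^ q x := by positivity
      by_cases hx : x ∈ B
      · simp only [hx, if_true, abs_zero, zero_mul]
        positivity
      · simp only [hx, if_false]
        obtain ⟨-, -, h3, h4⟩ := hgood x hx
        calc |f x t| * |t'| ≤ (∑ j, a j x * |t| ^ (r j x - 1)) * |t'| :=
              mul_le_mul_of_nonneg_right (h4 t) (abs_nonneg _)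
          _ ≤ ∑ j, ((1 / ε') ^ (Q2 / δ j) * |a j x| ^ (q x / (q x - r j x)) +
              ε' * (|t| ^ q x + |t'| ^ q x)) := by
              rw [Finset.sum_mul]
              refine Finset.sum_le_sum fun j _ => ?_
              rw [abs_of_pos (h3 j)]
              exact pt_sub (h3 j).le (hr1 j x) (hδ0 j) (hδ j x) (hQ2 x) he0 he1 (abs_nonneg _)
                (abs_nonneg _)
          _ ≤ _ := by
              rw [Finset.sum_add_distrib, Finset.sum_const, Finset.card_univ, Fintype.card_fin,
                nsmul_eq_mul, ← mul_assoc]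
              have := mul_le_mul_of_nonneg_right hem hT
              linarith
  · have : ∀ᵐ x ∂(volume : Measure (Euc N)), x ∉ B := measure_eq_zero_iff_ae_notMem.1 hB0
    filter_upwards [this] with x hx t
    simp [hx]


section tents
variable {N : ℕ} {s pb e : ℝ}

def tent (ρ : ℝ) (c x : Euc N) : ℝ := max 0 (ρ - dist x c)

theorem tent_meas (ρ : ℝ) (c : Euc N) : Measurable (tent ρ c) := by unfold tent; fun_prop

theorem tent_nonneg (ρ : ℝ) (c x : Euc N) : 0 ≤ tent ρ c x := le_max_left _ _

theorem tent_le {ρ : ℝ} (hρ : 0 < ρ) (c x : Euc N) : tent ρ c x ≤ ρ :=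
  max_le hρ.le (by linarith [dist_nonneg (x := x) (y := c)])

theorem tent_out {ρ : ℝ} {c x : Euc N} (h : ρ ≤ dist x c) : tent ρ c x = 0 :=
  max_eq_left (by linarith)

theorem tent_pos {ρ : ℝ} {c x : Euc N} (h : dist x c < ρ) : 0 < tent ρ c x :=
  lt_max_of_lt_right (by linarith)

theorem tent_lip (ρ : ℝ) (c x y : Euc N) : |tent ρ c x - tent ρ c y| ≤ dist x y := by
  unfold tent
  refine (abs_max_sub_max_le_max _ _ _ _).trans (max_le (by simp) ?_)
  have : ρ - dist x c - (ρ - dist y c) = -(dist x c - dist y c) := by ring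
  rw [this, abs_neg]
  exact abs_dist_sub_le x y c

theorem ker_fin (hs : 0 < s) (hs1 : s < 1) (h1 : 1 ≤ pb) (hN : 0 < N) (he : 0 < e) :
    ∫⁻ z : Euc N, kkr N s pb e ‖z‖ * ENNReal.ofReal (‖z‖ ^ pb) < ⊤ := by
  classical
  have hsp : 0 < s * pb := by positivity
  have hE : (0:ℝ) < (N:ℝ) + s * pb := by positivity
  have : Nonempty (Fin N) := ⟨⟨0, hN⟩⟩
  have : Nontrivial (Euc N) := inferInstance
  have hi : IntegrableOn (fun z : Euc N => ‖z‖ ^ (pb - ((N:ℝ) + s * pb))) (Metric.ball 0 e) := by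
    rw [integrableOn_fun_norm_addHaar volume (f := fun y : ℝ => y ^ (pb - ((N:ℝ) + s * pb)))]
    have h2 : IntegrableOn (fun y : ℝ => y ^ (pb * (1 - s) - 1)) (Ioo 0 e) := by
      rw [intervalIntegral.integrableOn_Ioo_rpow_iff he]
      nlinarith
    refine h2.congr_fun (fun y hy => ?_) measurableSet_Ioo
    rw [finrank_euclideanSpace, Fintype.card_fin, smul_eq_mul, ← Real.rpow_natCast,
      Nat.cast_sub (by omega), ← Real.rpow_add hy.1]
    push_cast; ring_nf
  refine lt_of_le_of_lt ?_ hi.lintegral_lt_top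
  rw [← lintegral_indicator measurableSet_ball]
  refine lintegral_mono fun z => ?_
  simp only [indicator_apply, Metric.mem_ball, dist_zero_right, kkr]
  split_ifs with h
  · rcases eq_or_ne z 0 with rfl | hz
    · simp [Real.zero_rpow hE.ne']
    · have hz : 0 < ‖z‖ := norm_pos_iff.2 hz
      rw [← ENNReal.ofReal_mul (by positivity), Real.rpow_sub hz, div_eq_inv_mul]
  · simp

theorem tent_W (hs : 0 < s) (hs1 : s < 1) (h1 : 1 ≤ pb) (hN : 0 < N) (he : 0 < e) {ρ : ℝ} (hρ : 0 < ρ)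
    (c : Euc N) : tent ρ c ∈ Wsub N s pb e := by
  classical
  have h0 : 0 < pb := by linarith
  rw [memW_iff h1 (tent_meas ρ c)]
  constructor
  · refine lt_of_le_of_lt (b := ∫⁻ x, (Metric.ball c ρ).indicator (fun _ => ENNReal.ofReal (ρ ^ pb)) x)
      (lintegral_mono fun x => ?_) ?_
    · simp only [indicator_apply, Metric.mem_ball]
      split_ifs with h
      · rw [abs_of_nonneg (tent_nonneg _ _ _)]
        exact ENNReal.ofReal_le_ofReal (Real.rpow_le_rpow (tent_nonneg _ _ _) (tent_le hρ _ _) h0.le)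
      · rw [tent_out (not_lt.1 h)]; simp [Real.zero_rpow h0.ne']
    · rw [lintegral_indicator_const measurableSet_ball]
      exact ENNReal.mul_lt_top ENNReal.ofReal_lt_top measure_ball_lt_top
  · set K := ∫⁻ z : Euc N, kkr N s pb e ‖z‖ * ENNReal.ofReal (‖z‖ ^ pb) with hK
    have hKt : K < ⊤ := ker_fin hs hs1 h1 hN he
    refine lt_of_le_of_lt (b := ∫⁻ x, (Metric.ball c (ρ + e)).indicator (fun _ => K) x)
      (lintegral_mono fun x => ?_) ?_
    · simp only [indicator_apply, Metric.mem_ball]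
      split_ifs with h
      · rw [hK, ← lintegral_sub_left_eq_self _ x]
        refine lintegral_mono fun y => ?_
        simp only [← dist_eq_norm]
        refine mul_le_mul_right (ENNReal.ofReal_le_ofReal ?_) _
        exact Real.rpow_le_rpow (abs_nonneg _) (tent_lip _ _ _ _) h0.le
      · refine le_of_eq ((lintegral_congr fun y => ?_).trans lintegral_zero)
        simp only [kkr]
        split_ifs with hd
        · have := dist_triangle x y c
          rw [tent_out (by linarith), tent_out (by linarith)]
          simp [Real.zero_rpow h0.ne']
        · simp
    · rw [lintegral_indicator_const measurableSet_ball]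
      exact ENNReal.mul_lt_top hKt measure_ball_lt_top

theorem centers (hN : 0 < N) (x₀ : Euc N) {ε : ℝ} (hε : 0 < ε) (n : ℕ) : ∃ (ρ : ℝ) (c : Fin n → Euc N),
    0 < ρ ∧ (∀ i x, dist x (c i) < ρ → dist x x₀ < ε) ∧
    ∀ i j x, i ≠ j → dist x (c i) < ρ → ρ ≤ dist x (c j) := by
  set w : Euc N := EuclideanSpace.single ⟨0, hN⟩ 1 with hw
  have hw1 : ‖w‖ = 1 := by simp [hw]
  have hn : (0:ℝ) < n + 1 := by positivity
  refine ⟨ε / (2 * (n + 1)), fun i => x₀ + (ε * i / (n + 1)) • w, by positivity, ?_, ?_⟩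
  · intro i x h
    have h1 : dist (x₀ + (ε * i / (n + 1)) • w) x₀ = ε * i / (n + 1) := by
      rw [dist_eq_norm, add_sub_cancel_left, norm_smul, hw1, mul_one, Real.norm_of_nonneg (by positivity)]
    have h2 := dist_triangle x (x₀ + (ε * i / (n + 1)) • w) x₀
    rw [h1] at h2
    have h3 : ε / (2 * (n + 1)) + ε * i / (n + 1) ≤ ε := by
      rw [div_add_div _ _ (by positivity) (by positivity), div_le_iff₀ (by positivity)]
      have : (i:ℝ) + 1 ≤ n := by exact_mod_cast i.2
      have h4 : (ε * (n + 1)) * ((i:ℝ) + 1) ≤ ε * (n + 1) * n := by gcongr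
      have : 0 < ε * (n + 1) := by positivity
      nlinarith
    linarith
  · intro i j x hij h
    have h1 : ε / (n + 1) ≤ dist (x₀ + (ε * i / (n + 1)) • w) (x₀ + (ε * j / (n + 1)) • w) := by
      rw [dist_eq_norm, add_sub_add_left_eq_sub, ← sub_smul, norm_smul, hw1, mul_one, Real.norm_eq_abs]
      have : ε * i / (n + 1) - ε * j / (n + 1) = ε / (n + 1) * ((i:ℝ) - j) := by ring
      rw [this, abs_mul, abs_of_nonneg (by positivity)]
      have h5 : (1:ℝ) ≤ |(i:ℝ) - j| := by
        have : ((i:ℕ):ℤ) - (j:ℕ) ≠ 0 := by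
          intro h; apply hij; ext; omega
        have := Int.one_le_abs this
        exact_mod_cast this
      exact le_mul_of_one_le_right (by positivity) h5
    have h2 := dist_triangle (x₀ + (ε * i / (n + 1)) • w) x (x₀ + (ε * j / (n + 1)) • w)
    rw [dist_comm _ x] at h2
    have h3 : ε / (n + 1) = 2 * (ε / (2 * (n + 1))) := by field_simp
    linarith

end tents


section hVsec
variable {N : ℕ} {s pm pb e : ℝ} {p : Euc N → Euc N → ℝ} {A : Set (Euc N)}

theorem sum_pow_le {n : ℕ} (h1 : 1 ≤ pb) (t : Fin n → ℝ) {X : ℝ} (hX : 0 ≤ X) (h : ∀ i, |t i| ^ pb ≤ X) :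
    (∑ i, |t i|) ^ pb ≤ (n + 1) ^ pb * X := by
  have h0 : 0 < pb := by linarith
  have h2 : ∀ i, |t i| ≤ X ^ (1 / pb) := fun i => by
    have := Real.rpow_le_rpow (by positivity) (h i) (z := 1 / pb) (by positivity)
    rwa [← Real.rpow_mul (abs_nonneg _), mul_one_div_cancel h0.ne', Real.rpow_one] at this
  have h3 : ∑ i, |t i| ≤ (n + 1) * X ^ (1 / pb) := by
    refine (Finset.sum_le_sum fun i _ => h2 i).trans ?_
    rw [Finset.sum_const, Finset.card_univ, Fintype.card_fin, nsmul_eq_mul]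
    have : 0 ≤ X ^ (1 / pb) := by positivity
    nlinarith
  have h4 := Real.rpow_le_rpow (Finset.sum_nonneg fun i _ => abs_nonneg (t i)) h3 h0.le
  rwa [Real.mul_rpow (by positivity) (by positivity), ← Real.rpow_mul hX, one_div_mul_cancel h0.ne',
    Real.rpow_one] at h4

theorem min_pos {n : ℕ} (c : Fin n → ℝ) (hc : ∀ i, 0 < c i) : ∃ d, 0 < d ∧ ∀ i, d ≤ c i := by
  have hs : 0 ≤ ∑ i, (c i)⁻¹ := Finset.sum_nonneg fun i _ => (inv_pos.2 (hc i)).le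
  refine ⟨(1 + ∑ i, (c i)⁻¹)⁻¹, by positivity, fun i => ?_⟩
  refine inv_le_of_inv_le₀ (hc i) ?_
  have := Finset.single_le_sum (f := fun i => (c i)⁻¹) (fun i _ => (inv_pos.2 (hc i)).le) (Finset.mem_univ i)
  linarith

theorem tsum_at {n : ℕ} {ρ : ℝ} {c : Fin n → Euc N}
    (hdis : ∀ i j x, i ≠ j → dist x (c i) < ρ → ρ ≤ dist x (c j)) (t : Fin n → ℝ) (i : Fin n) (x : Euc N)
    (hx : dist x (c i) < ρ) : ∑ j, t j * tent ρ (c j) x = t i * tent ρ (c i) x := by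
  refine Finset.sum_eq_single i (fun j _ hj => ?_) (by simp)
  rw [tent_out (hdis i j x hj.symm hx), mul_zero]

variable [Fact (1 ≤ ENNReal.ofReal pb)]

theorem PH.phi_up (H : PH s pm pb e p A) (I0 : Inst (volume : Measure (Euc N)) (fun _ => pb) pb pb (TT N s pb e)) :
    ∃ C, 0 ≤ C ∧ ∀ u : W N s pb e, Phi (mK s p) (fun z => p z.1 z.2) (DD N s pb e) u +
      Phi volume (fun _ => pb) (TT N s pb e) u ≤ C * (1 + ‖u‖ ^ pb) := by
  obtain ⟨C, hC0, hC⟩ := H.bd1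
  refine ⟨C + 1, by positivity, fun u => ?_⟩
  have h1 := H.h1
  have h1' := I0.h1
  have a1 := H.I1.phi_le u
  have a2 := I0.phi_le u
  have a3 : dPhi H.I1 u u / pm ≤ dPhi H.I1 u u := div_le_self (H.I1.dself_nonneg u) h1.le
  have a4 : dPhi I0 u u / pb ≤ dPhi I0 u u := div_le_self (I0.dself_nonneg u) h1'.le
  have a5 := (hC u).2
  have a6 := (int_of_lint (by have := TT_meas u; fun_prop) (fun _ => by positivity) (by positivity) (AA_le u)).2
  rw [H.I1.dself] at a1 a3
  rw [I0.dself] at a2 a4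
  nlinarith

theorem hV_thm (H : PH s pm pb e p A) (hs1 : s < 1) {q : Euc N → ℝ} {q1 q2 : ℝ} {f : Euc N → ℝ → ℝ}
    (I0 : Inst (volume : Measure (Euc N)) (fun _ => pb) pb pb (TT N s pb e))
    (Iq : Inst volume q q1 q2 (TT N s pb e)) (S : SubC volume q f) (hN : 0 < N)
    {x₀ : Euc N} {ε : ℝ} (hε : 0 < ε) {a : Euc N → ℝ} (hai : IntegrableOn a (Metric.ball x₀ ε))
    (ha0 : ∀ᵐ x ∂volume.restrict (Metric.ball x₀ ε), 0 < a x)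
    (hG : ∀ M : ℝ, 0 < M → ∃ G : Euc N → ℝ, IntegrableOn G (Metric.ball x₀ ε) ∧
        ∀ᵐ x ∂volume.restrict (Metric.ball x₀ ε), ∀ t : ℝ, |t| ≤ M → |FF f x t| ≤ G x)
    (hK : ∀ K : ℝ, ∃ M : ℝ, ∀ᵐ x ∂volume.restrict (Metric.ball x₀ ε), ∀ t : ℝ, M ≤ |t| →
        K * (a x * |t| ^ pb) ≤ FF f x t) (n : ℕ) :
    ∃ ι : (Fin n → ℝ) →ₗ[ℝ] W N s pb e, ∃ C, ∀ t, Phi (mK s p) (fun z => p z.1 z.2) (DD N s pb e) (ι t) +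
      Phi volume (fun _ => pb) (TT N s pb e) (ι t) - Psi volume f (TT N s pb e) (ι t) ≤ C - ∑ i, |t i| := by
  have h1 := pb1 (pb := pb)
  have h0 : 0 < pb := by linarith
  obtain ⟨C1, hC10, hC1⟩ := H.phi_up I0
  obtain ⟨ρ, c, hρ, hin, hdis⟩ := centers hN x₀ hε n
  set B := Metric.ball x₀ ε with hB
  set w : Fin n → W N s pb e := fun i =>
    (⟨tent ρ (c i), tent_W H.hs hs1 h1 hN H.he hρ (c i)⟩ : Wsub N s pb e) with hw
  set ι : (Fin n → ℝ) →ₗ[ℝ] W N s pb e := Fintype.linearCombination ℝ w with hι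
  have hTT : ∀ t x, TT N s pb e (ι t) x = ∑ i, t i * tent ρ (c i) x := by
    intro t x
    rw [hι, Fintype.linearCombination_apply, map_sum, Finset.sum_apply]
    refine Finset.sum_congr rfl fun i _ => ?_
    rw [map_smul]; rfl
  have hnorm : ∃ Cw, 0 ≤ Cw ∧ ∀ t, ‖ι t‖ ≤ Cw * ∑ i, |t i| := by
    refine ⟨∑ i, ‖w i‖, by positivity, fun t => ?_⟩
    rw [hι, Fintype.linearCombination_apply, Finset.mul_sum]
    refine (norm_sum_le _ _).trans (Finset.sum_le_sum fun i _ => ?_)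
    rw [norm_smul, Real.norm_eq_abs, mul_comm]
    exact mul_le_mul_of_nonneg_right
      (Finset.single_le_sum (f := fun i => ‖w i‖) (fun i _ => norm_nonneg _) (Finset.mem_univ i)) (abs_nonneg _)
  obtain ⟨Cw, hCw0, hCw⟩ := hnorm
  -- integrability of a * bounded
  have hbdi : ∀ (v : Euc N → ℝ) (R : ℝ), Measurable v → (∀ x, |v x| ≤ R) →
      IntegrableOn (fun x => a x * |v x| ^ pb) B := by
    intro v R hv hR
    refine Integrable.mul_bdd (c := R ^ pb) hai (by fun_prop : Measurable fun x => |v x| ^ pb).aestronglyMeasurable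
      (ae_of_all _ fun x => ?_)
    rw [Real.norm_of_nonneg (by positivity)]
    exact Real.rpow_le_rpow (abs_nonneg _) (hR x) h0.le
  have hti : ∀ i, IntegrableOn (fun x => a x * |tent ρ (c i) x| ^ pb) B := fun i =>
    hbdi _ ρ (tent_meas _ _) fun x => by
      rw [abs_of_nonneg (tent_nonneg _ _ _)]; exact tent_le hρ _ _
  have hcpos : ∀ i, 0 < ∫ x in B, a x * |tent ρ (c i) x| ^ pb := by
    intro i
    have hnn : 0 ≤ᵐ[volume.restrict B] fun x => a x * |tent ρ (c i) x| ^ pb :=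
      ha0.mono fun x hx => by have := hx.le; simp only [Pi.zero_apply]; positivity
    rw [setIntegral_pos_iff_support_of_nonneg_ae hnn (hti i)]
    have hsub : ∀ᵐ x, x ∈ Metric.ball (c i) ρ → x ∈ (Function.support fun x => a x * |tent ρ (c i) x| ^ pb) ∩ B := by
      filter_upwards [(ae_restrict_iff' measurableSet_ball).1 ha0] with x hx hxb
      have hxB : x ∈ B := hin i x hxb
      refine ⟨?_, hxB⟩
      have e1 := hx hxB
      have e2 := tent_pos hxb
      rw [Function.mem_support, abs_of_pos e2]
      positivity
    exact (Metric.measure_ball_pos volume (c i) hρ).trans_le (measure_mono_ae hsub)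
  obtain ⟨d, hd0, hd⟩ := min_pos _ hcpos
  have hvB : ∀ t, ∃ R, ∀ x, |TT N s pb e (ι t) x| ≤ R := by
    intro t
    refine ⟨∑ i, |t i| * ρ, fun x => ?_⟩
    rw [hTT]
    refine (Finset.abs_sum_le_sum_abs _ _).trans (Finset.sum_le_sum fun i _ => ?_)
    rw [abs_mul, abs_of_nonneg (tent_nonneg _ _ _)]
    exact mul_le_mul_of_nonneg_left (tent_le hρ _ _) (abs_nonneg _)
  have hai2 : ∀ t, IntegrableOn (fun x => a x * |TT N s pb e (ι t) x| ^ pb) B := fun t => by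
    obtain ⟨R, hR⟩ := hvB t
    exact hbdi _ R (TT_meas _) hR
  have hlow : ∀ t, ∀ i, |t i| ^ pb * d ≤ ∫ x in B, a x * |TT N s pb e (ι t) x| ^ pb := by
    intro t i
    refine (mul_le_mul_of_nonneg_left (hd i) (by positivity)).trans ?_
    rw [← integral_const_mul]
    refine integral_mono_ae ((hti i).const_mul _) (hai2 t) ?_
    filter_upwards [ha0] with x hx
    have hx' := hx.le
    by_cases hxb : dist x (c i) < ρ
    · rw [hTT, tsum_at hdis t i x hxb, abs_mul, Real.mul_rpow (abs_nonneg _) (abs_nonneg _)]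
      exact le_of_eq (by ring)
    · rw [tent_out (not_lt.1 hxb), abs_zero, Real.zero_rpow h0.ne', mul_zero, mul_zero]
      positivity
  set D := d / (n + 1) ^ pb with hD
  have hD0 : 0 < D := by positivity
  have hlow2 : ∀ t : Fin n → ℝ, D * (∑ i, |t i|) ^ pb ≤ ∫ x in B, a x * |TT N s pb e (ι t) x| ^ pb := by
    intro t
    have hX : 0 ≤ ∫ x in B, a x * |TT N s pb e (ι t) x| ^ pb :=
      integral_nonneg_of_ae (ha0.mono fun x hx => by have := hx.le; simp only [Pi.zero_apply]; positivity)
    have := sum_pow_le h1 t (X := (∫ x in B, a x * |TT N s pb e (ι t) x| ^ pb) / d) (by positivity)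
      fun i => by rw [le_div_iff₀ hd0]; exact hlow t i
    rw [hD, div_mul_eq_mul_div, div_le_iff₀ (by positivity)]
    calc d * (∑ i, |t i|) ^ pb ≤ d * ((n + 1) ^ pb * ((∫ x in B, a x * |TT N s pb e (ι t) x| ^ pb) / d)) := by
          gcongr
      _ = _ := by field_simp
  set K := (C1 * Cw ^ pb + 1) / D with hKd
  have hK0 : 0 ≤ K := by positivity
  obtain ⟨M', hM'⟩ := hK K
  set M := max M' 1 with hM
  have hM1 : 1 ≤ M := le_max_right _ _
  obtain ⟨G, hGi, hGb⟩ := hG M (by linarith)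
  set L := K * M ^ pb * (∫ x in B, a x) + ∫ x in B, G x with hL
  have hPsi : ∀ t, K * (∫ x in B, a x * |TT N s pb e (ι t) x| ^ pb) - L ≤ Psi volume f (TT N s pb e) (ι t) := by
    intro t
    have hz : Psi volume f (TT N s pb e) (ι t) = ∫ x in B, FF f x (TT N s pb e (ι t) x) := by
      unfold Psi
      refine (setIntegral_eq_integral_of_forall_compl_eq_zero fun x hx => ?_).symm
      have : TT N s pb e (ι t) x = 0 := by
        rw [hTT]
        refine Finset.sum_eq_zero fun i _ => ?_
        rw [tent_out, mul_zero]
        by_contra hlt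
        exact hx (hin i x (not_le.1 hlt))
      rw [this, SubC.FF0]
    have e1 := (hai2 t).const_mul K
    have e2 := hai.const_mul (K * M ^ pb)
    have e3 : Integrable (fun x => K * M ^ pb * a x + G x) (volume.restrict B) := e2.add hGi
    rw [hz, hL, ← integral_const_mul, ← integral_const_mul, ← integral_add e2 hGi, ← integral_sub e1 e3]
    refine integral_mono_ae (e1.sub e3) (S.intF Iq (ι t)).integrableOn ?_
    filter_upwards [ha0, hM', hGb] with x hx hx1 hx2
    have hx' := hx.le
    have hG0 : 0 ≤ G x := (abs_nonneg _).trans (hx2 0 (by simp; linarith))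
    set τ := TT N s pb e (ι t) x
    have hKM : 0 ≤ K * M ^ pb * a x := by positivity
    rcases le_total M |τ| with h | h
    · have := hx1 τ ((le_max_left _ _).trans h)
      linarith
    · have e3 := (abs_le.1 (hx2 τ h)).1
      have e4 : |τ| ^ pb ≤ M ^ pb := Real.rpow_le_rpow (abs_nonneg _) h h0.le
      have e5 : K * (a x * |τ| ^ pb) ≤ K * (a x * M ^ pb) := by gcongr
      linarith
  refine ⟨ι, C1 + L + 1, fun t => ?_⟩
  set σ := ∑ i, |t i| with hσ
  have hσ0 : 0 ≤ σ := Finset.sum_nonneg fun i _ => abs_nonneg _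
  have b1 := hC1 (ι t)
  have b2 : ‖ι t‖ ^ pb ≤ Cw ^ pb * σ ^ pb := by
    rw [← Real.mul_rpow hCw0 hσ0]
    exact Real.rpow_le_rpow (norm_nonneg _) (hCw t) h0.le
  have b3 := hPsi t
  have b4 := mul_le_mul_of_nonneg_left (hlow2 t) hK0
  have b5 : K * (D * σ ^ pb) = (C1 * Cw ^ pb + 1) * σ ^ pb := by rw [hKd]; field_simp
  have b6 : σ ≤ 1 + σ ^ pb := by
    have hp : 0 ≤ σ ^ pb := by positivity
    rcases le_total σ 1 with h | h
    · linarith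
    · have := Real.rpow_le_rpow_of_exponent_le h h1
      rw [Real.rpow_one] at this
      linarith
  have b7 := mul_le_mul_of_nonneg_left b2 hC10
  nlinarith

end hVsec


section fin
variable {N : ℕ} {s pm pb e : ℝ} {p : Euc N → Euc N → ℝ} {A : Set (Euc N)} [Fact (1 ≤ ENNReal.ofReal pb)]

theorem PH.diag (H : PH s pm pb e p A) (x : Euc N) : p x x = pb :=
  H.near x x (by rw [dist_self]; exact H.he)

theorem memSob_of_W (H : PH s pm pb e p A) (u : W N s pb e) : MemSob Set.univ s p (TT N s pb e u) := by
  refine ⟨(TT_meas u).aestronglyMeasurable, ?_⟩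
  unfold sobModular
  simp only [Measure.restrict_univ, H.diag]
  obtain ⟨C, hC⟩ := H.far
  have h1 : AA (TT N s pb e u) pb < ⊤ := (AA_le u).trans_lt ENNReal.ofReal_lt_top
  have h2 := (BB_le u).trans_lt ENNReal.ofReal_lt_top
  refine ENNReal.add_lt_top.2 ⟨h1, (hC _ (TT_meas u)).trans_lt (ENNReal.add_lt_top.2 ⟨?_, h2⟩)⟩
  exact ENNReal.mul_lt_top ENNReal.coe_lt_top (ENNReal.add_lt_top.2 ⟨ENNReal.one_lt_top, h1⟩)

theorem W_of_memSob (H : PH s pm pb e p A) {v : Euc N → ℝ} (hv : MemSob Set.univ s p v) :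
    ∃ w : W N s pb e, v =ᵐ[volume] TT N s pb e w := by
  obtain ⟨h1, h2⟩ := hv
  unfold sobModular at h2
  simp only [Measure.restrict_univ, H.diag] at h1 h2
  obtain ⟨h3, h4⟩ := ENNReal.add_lt_top.1 h2
  set v' := h1.aemeasurable.mk v with hv'
  have hm : Measurable v' := h1.aemeasurable.measurable_mk
  have he : v =ᵐ[volume] v' := h1.aemeasurable.ae_eq_mk
  have h5 : AA v' pb < ⊤ := by
    unfold AA
    rw [← lintegral_congr_ae (f := fun x => ENNReal.ofReal (|v x| ^ pb))]
    · exact h3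
    · filter_upwards [he] with x hx
      rw [hx]
  have h6 : ∫⁻ x, ∫⁻ y, sobKernel s p v' x y < ⊤ := by
    rw [← lintegral_congr_ae (f := fun x => ∫⁻ y, sobKernel s p v x y)]
    · exact h4
    · filter_upwards [he] with x hx
      refine lintegral_congr_ae ?_
      filter_upwards [he] with y hy
      unfold sobKernel
      rw [hx, hy]
  have h7 := (memW_iff (s := s) (e := e) (pb1 (pb := pb)) hm).2 ⟨h5, (H.nearle v').trans_lt h6⟩
  exact ⟨(⟨v', h7⟩ : Wsub N s pb e), he⟩

theorem dPhi1_eq (H : PH s pm pb e p A) (u w : W N s pb e) :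
    dPhi H.I1 u w = ∫ x, ∫ y, |TT N s pb e u x - TT N s pb e u y| ^ (p x y - 2) *
      (TT N s pb e u x - TT N s pb e u y) * (TT N s pb e w x - TT N s pb e w y) /
        dist x y ^ ((N : ℝ) + s * p x y) := by
  have hmp := H.mp
  have hd : Measurable (fun z : Euc N × Euc N => ENNReal.ofReal ((dist z.1 z.2 ^ ((N:ℝ) + s * p z.1 z.2))⁻¹)) := by
    fun_prop
  have hi := H.I1.intd u w
  rw [dPhi_apply]
  set G : Euc N × Euc N → ℝ := fun z => jp (p z.1 z.2) (DD N s pb e u z) * DD N s pb e w z with hG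
  have hf : ∀ᵐ z : Euc N × Euc N ∂(volume.prod volume), ENNReal.ofReal ((dist z.1 z.2 ^ ((N:ℝ) + s * p z.1 z.2))⁻¹) < ⊤ :=
    Eventually.of_forall fun _ => ENNReal.ofReal_lt_top
  have e1 : ∫ z, G z ∂(mK s p) = ∫ z, (ENNReal.ofReal ((dist z.1 z.2 ^ ((N:ℝ) + s * p z.1 z.2))⁻¹)).toReal • G z ∂(volume.prod volume) := by
    unfold mK
    exact integral_withDensity_eq_integral_toReal_smul hd hf G
  have e2 : Integrable (fun z : Euc N × Euc N => (ENNReal.ofReal ((dist z.1 z.2 ^ ((N:ℝ) + s * p z.1 z.2))⁻¹)).toReal • G z) (volume.prod volume) := by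
    unfold mK at hi
    exact (integrable_withDensity_iff_integrable_smul' hd hf).1 hi
  have e3 := integral_prod _ e2
  refine e1.trans (e3.trans ?_)
  refine integral_congr_ae (Eventually.of_forall fun x => ?_)
  refine integral_congr_ae (Eventually.of_forall fun y => ?_)
  simp only [hG, smul_eq_mul]
  rw [ENNReal.toReal_ofReal (by positivity)]
  have a1 : DD N s pb e u (x, y) = TT N s pb e u x - TT N s pb e u y := rfl
  have a2 : DD N s pb e w (x, y) = TT N s pb e w x - TT N s pb e w y := rfl
  rw [a1, a2]
  unfold jp
  ring

theorem weak_of_dJJ (H : PH s pm pb e p A) {q : Euc N → ℝ} {q1 q2 : ℝ} {f g : Euc N → ℝ → ℝ}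
    (I0 : Inst (volume : Measure (Euc N)) (fun _ => pb) pb pb (TT N s pb e))
    (Iq : Inst volume q q1 q2 (TT N s pb e)) (S : SubC volume q g)
    (hfg : ∀ᵐ x ∂(volume : Measure (Euc N)), ∀ t, g x t = f x t) {l : ℝ} {u : W N s pb e}
    (h : ∀ w, dJJ H.I1 I0 Iq S l u w = 0) : IsWeakSolution s p pb q f l (TT N s pb e u) := by
  refine ⟨memSob_of_W H u, fun v hv => ?_⟩
  obtain ⟨w, hw⟩ := W_of_memSob H hv
  have h1 := h w
  rw [dJJ_apply, dPhi1_eq H, dPhi_apply, dPhi_apply, dPsi_apply] at h1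
  have b1 : (∫ x, ∫ y, |TT N s pb e u x - TT N s pb e u y| ^ (p x y - 2) *
      (TT N s pb e u x - TT N s pb e u y) * (v x - v y) /
        dist x y ^ ((N : ℝ) + s * p x y)) = ∫ x, ∫ y, |TT N s pb e u x - TT N s pb e u y| ^ (p x y - 2) *
      (TT N s pb e u x - TT N s pb e u y) * (TT N s pb e w x - TT N s pb e w y) /
        dist x y ^ ((N : ℝ) + s * p x y) := by
    refine integral_congr_ae ?_
    filter_upwards [hw] with x hx
    refine integral_congr_ae ?_
    filter_upwards [hw] with y hy
    rw [hx, hy]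
  have b2 : (∫ x, |TT N s pb e u x| ^ (pb - 2) * TT N s pb e u x * v x) =
      ∫ x, jp pb (TT N s pb e u x) * TT N s pb e w x := by
    refine integral_congr_ae ?_
    filter_upwards [hw] with x hx
    rw [hx]; rfl
  have b3 : (∫ x, |TT N s pb e u x| ^ (q x - 2) * TT N s pb e u x * v x) =
      ∫ x, jp (q x) (TT N s pb e u x) * TT N s pb e w x := by
    refine integral_congr_ae ?_
    filter_upwards [hw] with x hx
    rw [hx]; rfl
  have b4 : (∫ x, f x (TT N s pb e u x) * v x) = ∫ x, g x (TT N s pb e u x) * TT N s pb e w x := by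
    refine integral_congr_ae ?_
    filter_upwards [hw, hfg] with x hx hx2
    rw [hx, hx2]
  rw [b1, b2, b3, b4]
  linarith

theorem W_norm_zero {u : W N s pb e} (h : TT N s pb e u =ᵐ[volume] 0) : ‖u‖ = 0 := by
  have h2 : DD N s pb e u =ᵐ[mu1 N s pb e] 0 := by
    refine (withDensity_absolutelyContinuous _ _).ae_le ?_
    filter_upwards [Measure.quasiMeasurePreserving_fst.ae h, Measure.quasiMeasurePreserving_snd.ae h] with z h1 h2
    have a1 : DD N s pb e u z = TT N s pb e u z.1 - TT N s pb e u z.2 := rfl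
    rw [a1, h1, h2]; simp
  rw [W_norm, eLpNorm_congr_ae h, eLpNorm_congr_ae h2]
  simp
end fin

/-- Theorem 5.1: existence of a decreasing sequence of positive reals
such that for λ between consecutive terms, the critical nonlocal problem admits at least
k pairs of nontrivial weak solutions. -/
theorem multiplicity_of_solutions {N : ℕ}
    (s pminus pbar ε₀ : ℝ) (hs : s ∈ Set.Ioo (0 : ℝ) 1)
    (p : Euc N → Euc N → ℝ) (pstar : Euc N → ℝ)
    (hpuc : UniformContinuous fun z : Euc N × Euc N => p z.1 z.2)
    (hpsym : ∀ x y, p x y = p y x)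
    (hpminus : IsGLB (Set.range fun z : Euc N × Euc N => p z.1 z.2) pminus)
    (hpbar : IsLUB (Set.range fun z : Euc N × Euc N => p z.1 z.2) pbar)
    (hpm1 : 1 < pminus) (hpbarN : pbar < (N : ℝ) / s)
    (hε₀ : ε₀ ∈ Set.Ioo (0 : ℝ) (1 / 2))
    (hdiag : ∀ x y : Euc N, dist x y < ε₀ → p x y = pbar)
    (hsupx : ∀ x : Euc N, IsLUB (Set.range (p x)) pbar)
    (hpstar : ∀ x : Euc N, IsGLB (Set.range (p x)) (pstar x))
    (hfin : volume {x : Euc N | pstar x ≠ pbar} < ⊤)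
    (q : Euc N → ℝ) (hquc : UniformContinuous q)
    (pbarS : ℝ) (hpbarS : pbarS = (N : ℝ) * pbar / ((N : ℝ) - s * pbar))
    (hqlb : ∀ x, pstar x ≤ q x) (hqub : ∀ x, q x ≤ pbarS)
    (hqcrit : {x : Euc N | q x = pbarS}.Nonempty)
    (qminus : ℝ) (hqminus : IsGLB (Set.range q) qminus) (hpq : pbar < qminus)
    (qinf : ℝ) (hqinf1 : 1 < qinf)
    (hpinf : Tendsto (fun z : Euc N × Euc N => p z.1 z.2)
      ((cocompact (Euc N)) ×ˢ (cocompact (Euc N))) (𝓝 pbar))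
    (hqinf : Tendsto q (cocompact (Euc N)) (𝓝 qinf))
    (f : Euc N → ℝ → ℝ)
    -- (F1)
    (hf_meas : ∀ t : ℝ, Measurable fun x => f x t)
    (hf_cont : ∀ᵐ x ∂(volume : Measure (Euc N)), Continuous fun t => f x t)
    (hf_odd : ∀ᵐ x ∂(volume : Measure (Euc N)), ∀ t : ℝ, f x (-t) = - f x t)
    -- (F2)
    (hF2 : ∃ (m : ℕ) (r a : Fin m → Euc N → ℝ),
      (∀ j, Continuous (r j)) ∧
      (∀ j, ∃ rlo rhi : ℝ, 1 < rlo ∧ (∀ x, rlo ≤ r j x) ∧ (∀ x, r j x ≤ rhi)) ∧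
      (∀ j, ∃ δ > (0 : ℝ), ∀ x, r j x + δ ≤ q x) ∧
      (∃ j x, pminus < r j x) ∧
      (∀ j, MemVarLp volume (fun x => q x / (q x - r j x)) (a j) ∧
        (∀ᵐ x ∂(volume : Measure (Euc N)), 0 < a j x)) ∧
      (∀ᵐ x ∂(volume : Measure (Euc N)), ∀ t : ℝ,
        |f x t| ≤ ∑ j, a j x * |t| ^ (r j x - 1)))
    -- (F3)
    (hF3 : ∃ (x₀ : Euc N) (ε : ℝ), 0 < ε ∧ ∃ a : Euc N → ℝ,
      MemVarLp (volume.restrict (Metric.ball x₀ ε)) (fun x => q x / (q x - pbar)) a ∧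
      (∀ᵐ x ∂volume.restrict (Metric.ball x₀ ε), 0 < a x) ∧
      (∀ M : ℝ, 0 < M → ∃ G : Euc N → ℝ, IntegrableOn G (Metric.ball x₀ ε) ∧
        ∀ᵐ x ∂volume.restrict (Metric.ball x₀ ε), ∀ t : ℝ, |t| ≤ M → |Fint f x t| ≤ G x) ∧
      (∀ K : ℝ, ∃ M : ℝ, ∀ᵐ x ∂volume.restrict (Metric.ball x₀ ε), ∀ t : ℝ, M ≤ |t| →
        K * (a x * |t| ^ pbar) ≤ Fint f x t))
    -- (F4)
    (hF4 : ∃ (α : ℝ) (g : Euc N → ℝ), pbar ≤ α ∧ α < qminus ∧ Integrable g ∧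
      (∀ᵐ x ∂(volume : Measure (Euc N)), 0 ≤ g x) ∧
      (∀ᵐ x ∂(volume : Measure (Euc N)), ∀ t : ℝ, α * Fint f x t - f x t * t ≤ g x)) :
    ∃ lam : ℕ → ℝ, (∀ k, 0 < lam k) ∧ (∀ k, lam (k + 1) < lam k) ∧
      ∀ k : ℕ, ∀ l : ℝ, lam (k + 1) < l → l < lam k →
        ∃ U : Fin k → Euc N → ℝ,
          (∀ i, IsWeakSolution s p pbar q f l (U i) ∧
            IsWeakSolution s p pbar q f l (fun x => -(U i x)) ∧
            ¬ U i =ᵐ[volume] 0) ∧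
          (∀ i j, i ≠ j → ¬ U i =ᵐ[volume] U j ∧
            ¬ U i =ᵐ[volume] fun x => -(U j x)) := by
  classical
  obtain ⟨hs0, hs1⟩ := hs
  have z0 : Euc N := 0
  have hP : ∀ x y, p x y ∈ Icc pminus pbar := fun x y => ⟨hpminus.1 ⟨(x, y), rfl⟩, hpbar.1 ⟨(x, y), rfl⟩⟩
  have hpp : pminus ≤ pbar := (hP z0 z0).1.trans (hP z0 z0).2
  have hpb1 : 1 < pbar := hpm1.trans_le hpp
  have hsN : s * pbar < N := by
    rw [lt_div_iff₀ hs0] at hpbarN; linarith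
  have hN0 : 0 < N := by
    have : (0:ℝ) < N := lt_trans (by positivity) hsN
    exact_mod_cast this
  have hfact : Fact (1 ≤ ENNReal.ofReal pbar) := ⟨by simpa using hpb1.le⟩
  subst hpbarS
  have mq : Measurable q := hquc.continuous.measurable
  have hq : ∀ x, q x ∈ Icc qminus ((N : ℝ) * pbar / ((N : ℝ) - s * pbar)) := fun x => ⟨hqminus.1 ⟨x, rfl⟩, hqub x⟩
  have hq' : ∀ x, q x ∈ Icc pbar ((N : ℝ) * pbar / ((N : ℝ) - s * pbar)) := fun x => ⟨hpq.le.trans (hq x).1, hqub x⟩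
  have H : PH s pminus pbar ε₀ p (toMeasurable volume {x : Euc N | pstar x ≠ pbar}) :=
    { hs := hs0, h1 := hpm1, hpp := hpp, hN := hsN, he := hε₀.1
      mp := hpuc.continuous.measurable, hP := hP, near := hdiag
      mA := measurableSet_toMeasurable _ _
      fA := by rw [measure_toMeasurable]; exact hfin
      offA := by
        intro x hx y
        have h1 : pstar x = pbar := by
          by_contra h
          exact hx (subset_toMeasurable _ _ h)
        exact le_antisymm (hP x y).2 (h1 ▸ (hpstar x).1 ⟨y, rfl⟩) }
  have I0 : Inst (volume : Measure (Euc N)) (fun _ => pbar) pbar pbar (TT N s pbar ε₀) := I0_inst hpb1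
  have Iq : Inst (volume : Measure (Euc N)) q qminus ((N : ℝ) * pbar / ((N : ℝ) - s * pbar)) (TT N s pbar ε₀) :=
    Iq_inst hs0 hpb1 hsN hε₀.1 mq hpq.le hq
  obtain ⟨m, r, a, hr, hr1, hd, -, ha, hb⟩ := hF2
  have hr1' : ∀ j x, 1 < r j x := fun j x => by
    obtain ⟨lo, hi, h1, h2, -⟩ := hr1 j
    exact h1.trans_le (h2 x)
  obtain ⟨g, S, hg⟩ := f_part mq hqub hf_meas hf_cont hf_odd hr hr1' hd (fun j => (ha j).1) (fun j => (ha j).2) hb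
  have hFF : ∀ᵐ x ∂(volume : Measure (Euc N)), ∀ t, FF g x t = Fint f x t := by
    filter_upwards [hg] with x hx t
    unfold FF Fint
    exact intervalIntegral.integral_congr fun τ _ => hx τ
  obtain ⟨x₀, ε, hε, b, hbm, hb0, hG, hK⟩ := hF3
  obtain ⟨α, g4, hα, hαq, hg4, -, hF4'⟩ := hF4
  have hFFr : ∀ᵐ x ∂volume.restrict (Metric.ball x₀ ε), ∀ t, FF g x t = Fint f x t := ae_restrict_of_ae hFF
  have hbi : IntegrableOn b (Metric.ball x₀ ε) := by
    have h1 := memvar_int (m := volume.restrict (Metric.ball x₀ ε))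
      (h := fun x => q x / (q x - pbar)) (by fun_prop) hbm
    have hfm : IsFiniteMeasure (volume.restrict (Metric.ball x₀ ε)) := ⟨by
      rw [Measure.restrict_apply_univ]; exact measure_ball_lt_top⟩
    have h2 : Integrable (fun x => (1:ℝ) + |b x| ^ (q x / (q x - pbar))) (volume.restrict (Metric.ball x₀ ε)) :=
      (integrable_const _).add h1
    refine h2.mono' hbm.1 (Eventually.of_forall fun x => ?_)
    rw [Real.norm_eq_abs]
    have h3 : 0 < q x - pbar := by linarith [(hq x).1]
    have h4 : 1 ≤ q x / (q x - pbar) := by rw [le_div_iff₀ h3]; linarith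
    rcases le_total |b x| 1 with h5 | h5
    · have : 0 ≤ |b x| ^ (q x / (q x - pbar)) := by positivity
      linarith
    · have := Real.rpow_le_rpow_of_exponent_le h5 h4
      rw [Real.rpow_one] at this
      linarith
  have hG' : ∀ M : ℝ, 0 < M → ∃ G : Euc N → ℝ, IntegrableOn G (Metric.ball x₀ ε) ∧
        ∀ᵐ x ∂volume.restrict (Metric.ball x₀ ε), ∀ t : ℝ, |t| ≤ M → |FF g x t| ≤ G x := by
    intro M hM
    obtain ⟨G, h1, h2⟩ := hG M hM
    refine ⟨G, h1, ?_⟩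
    filter_upwards [h2, hFFr] with x h3 h4 t ht
    rw [h4]; exact h3 t ht
  have hK' : ∀ K : ℝ, ∃ M : ℝ, ∀ᵐ x ∂volume.restrict (Metric.ball x₀ ε), ∀ t : ℝ, M ≤ |t| →
        K * (b x * |t| ^ pbar) ≤ FF g x t := by
    intro K
    obtain ⟨M, h2⟩ := hK K
    refine ⟨M, ?_⟩
    filter_upwards [h2, hFFr] with x h3 h4 t ht
    rw [h4]; exact h3 t ht
  have hF : ∀ᵐ x ∂(volume : Measure (Euc N)), ∀ t, α * FF g x t - g x t * t ≤ g4 x := by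
    filter_upwards [hF4', hFF, hg] with x h1 h2 h3 t
    rw [h2, h3]; exact h1 t
  have hB : ∀ B : ℝ, ∃ C, 0 ≤ C ∧ ∀ u : W N s pbar ε₀, ‖u‖ ≤ B → dPhi Iq u u ≤ C * ‖u‖ ^ pbar := by
    intro B
    obtain ⟨C, hC0, hC⟩ := q_est hs0 hpb1 hsN hε₀.1 mq hq' B
    refine ⟨C, hC0, fun u hu => ?_⟩
    rw [Iq.dself]
    exact (hC u hu).2
  have hc : ∀ (u : ℕ → W N s pbar ε₀) (R : ℝ), (∀ n, ‖u n‖ ≤ R) → ∃ φ : ℕ → ℕ, StrictMono φ ∧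
      ∃ v : W N s pbar ε₀, (∀ᵐ z, Tendsto (fun n => TT N s pbar ε₀ (u (φ n)) z) atTop (𝓝 (TT N s pbar ε₀ v z))) ∧
        ∀ᵐ z ∂(mK s p), Tendsto (fun n => DD N s pbar ε₀ (u (φ n)) z) atTop (𝓝 (DD N s pbar ε₀ v z)) := by
    intro u R hR
    obtain ⟨φ, h1, v, h2⟩ := W_compact hs0 hε₀.1 u R hR
    exact ⟨φ, h1, v, h2, ae_DD (u := fun n => u (φ n)) h2 (withDensity_absolutelyContinuous _ _)⟩
  have key := abstract_main H.I1 I0 Iq S (fun u => H.hn u I0) hB hc hα hαq hg4 hF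
    (W_psi hs0 hε₀.1 Iq S) (hV_thm H hs1 I0 Iq S hN0 hε hbi hb0 hG' hK')
  choose Λ hΛ0 hΛ using key
  set lam : ℕ → ℝ := fun k => Nat.rec (Λ 0) (fun n x => min (x / 2) (Λ (n + 1))) k with hlam
  have hl0 : lam 0 = Λ 0 := rfl
  have hls : ∀ k, lam (k + 1) = min (lam k / 2) (Λ (k + 1)) := fun k => rfl
  have hpos : ∀ k, 0 < lam k := by
    intro k
    induction k with
    | zero => rw [hl0]; exact hΛ0 0
    | succ n ih => rw [hls]; exact lt_min (half_pos ih) (hΛ0 _)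
  have hle : ∀ k, lam k ≤ Λ k := by
    intro k
    cases k with
    | zero => exact hl0.le
    | succ n => rw [hls]; exact min_le_right _ _
  refine ⟨lam, hpos, fun k => ?_, fun k l h1 h2 => ?_⟩
  · rw [hls]; exact (min_le_left _ _).trans_lt (half_lt_self (hpos k))
  obtain ⟨c, hc1, hc2, hc3⟩ := hΛ k l ((hpos (k + 1)).trans h1) (h2.trans_le (hle k))
  refine ⟨fun i => TT N s pbar ε₀ (c i), fun i => ⟨weak_of_dJJ H I0 Iq S hg (hc1 i), ?_, ?_⟩, fun i j hij => ⟨?_, ?_⟩⟩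
  · have h3 : ∀ w, dJJ H.I1 I0 Iq S l (-(c i)) w = 0 := fun w => by
      rw [dJJ_neg, hc1, neg_zero]
    have h4 := weak_of_dJJ H I0 Iq S hg h3
    rw [map_neg] at h4
    exact h4
  · exact fun h => hc2 i (W_norm_zero h)
  · intro h
    refine (hc3 i j hij).1 (W_norm_zero ?_)
    rw [map_sub]
    filter_upwards [h] with x hx
    rw [Pi.sub_apply, hx, sub_self]; rfl
  · intro h
    refine (hc3 i j hij).2 (W_norm_zero ?_)
    rw [map_add]
    filter_upwards [h] with x hx
    rw [Pi.add_apply, hx, neg_add_cancel]; rfl
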